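/- Let n ≥ 1 and k ≥ 1 be integers and let A ∈ ℝ^{n×(n+k)} have columns a_1,…,a_{n+k} ∈ ℝⁿ that do not all lie in a single affine hyperplane of ℝⁿ. Then there is an open dense subset U ⊆ ℝ^{n+k} such that for every c = (c_1,…,c_{n+k}) ∈ U, the zero set Z_ℝ(g_c) has at most (n+k)(n+k−1)/2 + ⌊2^{(k−2)(k−3)/2}·(n+2)^{k−2}⌋ connected components (the expression inside the floor being a real power when k < 2). -/

import Mathlib

/-- The exponential sum `g_c(y) = ∑_j c_j · exp(a_j · y)`. -/
noncomputable def expSum {n N : ℕ} (a : Fin N → Fin n → ℝ) (c : Fin N → ℝ)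
    (y : Fin n → ℝ) : ℝ :=
  ∑ j, c j * Real.exp (∑ i, a j i * y i)

/-- The columns `a_1, …, a_N` do not all lie in a single affine hyperplane of ℝⁿ. -/
def NotAllInAffineHyperplane {n N : ℕ} (a : Fin N → Fin n → ℝ) : Prop :=
  ¬ ∃ (w : Fin n → ℝ) (b : ℝ), w ≠ 0 ∧ ∀ j, (∑ i, w i * a j i) = b


/-! ## Bezout bound for real nondegenerate zeros -/
set_option linter.unusedSectionVars false
section Bezout
open MvPolynomial

variable {σ : Type} [Fintype σ] [DecidableEq σ]

/-- Jacobian matrix of a family of functions. -/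
noncomputable def jac (G : σ → (σ → ℝ) → ℝ) (x : σ → ℝ) : Matrix σ σ ℝ :=
  Matrix.of fun i k => fderiv ℝ (G i) x (Pi.single k 1)

lemma contDiff_mvEval (p : MvPolynomial σ ℝ) (m : WithTop ℕ∞) :
    ContDiff ℝ m (fun x : σ → ℝ => eval x p) := by
  induction p using MvPolynomial.induction_on with
  | C a => simpa using contDiff_const
  | add p q hp hq => simpa using hp.add hq
  | mul_X p i hp => simpa using hp.mul (contDiff_apply ℝ ℝ i)

lemma bez_interp (Q : Finset (σ → ℝ)) (q : σ → ℝ) :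
    ∃ f : MvPolynomial σ ℝ, f.totalDegree ≤ Q.card ∧ eval q f = 1 ∧
      ∀ q' ∈ Q, q' ≠ q → eval q' f = 0 := by
  induction Q using Finset.induction_on with
  | empty => exact ⟨1, by simp, by simp, by simp⟩
  | insert a Q ha ih =>
    obtain ⟨f, h1, h2, h3⟩ := ih
    by_cases hq : a = q
    · refine ⟨f, h1.trans (by simp [ha]), h2, ?_⟩
      intro q' hq' hne
      rcases Finset.mem_insert.1 hq' with h | h
      · exact absurd (h.trans hq) hne
      · exact h3 q' h hne
    · obtain ⟨i, hi⟩ : ∃ i, a i ≠ q i := by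
        by_contra h
        push Not at h
        exact hq (funext h)
      have hne0 : q i - a i ≠ 0 := sub_ne_zero.2 (Ne.symm hi)
      refine ⟨C ((q i - a i)⁻¹) * (X i - C (a i)) * f, ?_, ?_, ?_⟩
      · refine (totalDegree_mul _ _).trans ?_
        have : (C ((q i - a i)⁻¹) * (X i - C (a i)) : MvPolynomial σ ℝ).totalDegree ≤ 1 := by
          refine (totalDegree_mul _ _).trans ?_
          rw [totalDegree_C, zero_add]
          refine (totalDegree_sub _ _).trans ?_
          simp
        rw [Finset.card_insert_of_notMem ha]
        omega
      · simp [h2, hne0]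
      · intro q' hq' hne
        rcases Finset.mem_insert.1 hq' with h | h
        · simp [h]
        · simp [h3 q' h hne]

/-- reduction operator -/
noncomputable def bezRed (P : σ → MvPolynomial σ ℝ) (d : σ → ℕ) :
    MvPolynomial σ ℝ →ₗ[ℝ] MvPolynomial σ ℝ :=
  (basisMonomials σ ℝ).constr ℝ fun α =>
    open Classical in
    if h : ∃ i, d i ≤ α i then
      P h.choose * monomial (α - Finsupp.single h.choose (d h.choose)) 1 else 0

noncomputable def bezProj (d : σ → ℕ) :
    MvPolynomial σ ℝ →ₗ[ℝ] MvPolynomial σ ℝ :=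
  (basisMonomials σ ℝ).constr ℝ fun α =>
    open Classical in
    if ∃ i, d i ≤ α i then 0 else monomial α 1

lemma bezRed_monomial (P : σ → MvPolynomial σ ℝ) (d : σ → ℕ) (α : σ →₀ ℕ) :
    bezRed P d (monomial α 1) = open Classical in
      if h : ∃ i, d i ≤ α i then
      P h.choose * monomial (α - Finsupp.single h.choose (d h.choose)) 1 else 0 := by
  have := (basisMonomials σ ℝ).constr_basis ℝ (fun α =>
    open Classical in
    if h : ∃ i, d i ≤ α i then
      P h.choose * monomial (α - Finsupp.single h.choose (d h.choose)) 1 else 0) α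
  rwa [coe_basisMonomials] at this

lemma bezProj_monomial (d : σ → ℕ) (α : σ →₀ ℕ) :
    bezProj d (monomial α 1) = open Classical in
      if ∃ i, d i ≤ α i then 0 else monomial α (1:ℝ) := by
  have := (basisMonomials σ ℝ).constr_basis ℝ (fun α =>
    open Classical in
    if ∃ i, d i ≤ α i then 0 else monomial α (1:ℝ)) α
  rwa [coe_basisMonomials] at this

lemma bez_eval (P : σ → MvPolynomial σ ℝ) (d : σ → ℕ) (s : ℝ) (x : σ → ℝ)
    (hx : ∀ i, eval x (P i) + s * x i ^ d i = 0) (u : MvPolynomial σ ℝ) :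
    eval x (bezRed P d u + s • u) = eval x (s • bezProj d u) := by
  have key : (aeval x : MvPolynomial σ ℝ →ₐ[ℝ] ℝ).toLinearMap ∘ₗ (bezRed P d + s • LinearMap.id)
      = (aeval x : MvPolynomial σ ℝ →ₐ[ℝ] ℝ).toLinearMap ∘ₗ (s • bezProj d) := by
    apply (basisMonomials σ ℝ).ext
    intro α
    rw [coe_basisMonomials]
    simp only [LinearMap.comp_apply, LinearMap.add_apply, LinearMap.smul_apply, LinearMap.id_apply,
      bezRed_monomial, bezProj_monomial]
    split_ifs with h
    · set i := h.choose
      have hi : d i ≤ α i := h.choose_spec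
      have hα : (monomial α (1:ℝ)) = monomial (α - Finsupp.single i (d i)) 1 * X i ^ d i := by
        rw [X_pow_eq_monomial, monomial_mul, mul_one, tsub_add_cancel_of_le]
        simpa using hi
      rw [hα]
      simp only [AlgHom.toLinearMap_apply, map_add, map_mul, map_smul, map_pow, aeval_X, smul_eq_mul,
        map_zero, mul_zero]
      have := hx i
      rw [← MvPolynomial.coe_aeval_eq_eval] at this
      simp only [RingHom.coe_coe] at this
      linear_combination (aeval x (monomial (α - Finsupp.single i (d i)) (1:ℝ))) * this
    · simp
  have := LinearMap.congr_fun key u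
  simpa [MvPolynomial.aeval_eq_eval] using this

lemma bezRed_mem (P : σ → MvPolynomial σ ℝ) (d : σ → ℕ) (hP : ∀ i, (P i).totalDegree ≤ d i)
    (D : ℕ) (u : MvPolynomial σ ℝ) (hu : u ∈ restrictTotalDegree σ ℝ D) :
    bezRed P d u ∈ restrictTotalDegree σ ℝ D := by
  classical
  have h1 : u = ∑ α ∈ u.support, coeff α u • monomial α (1:ℝ) := by
    conv_lhs => rw [u.as_sum]
    refine Finset.sum_congr rfl fun α _ => ?_
    rw [smul_monomial, smul_eq_mul, mul_one]
  rw [h1, map_sum]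
  refine Submodule.sum_mem _ fun α hα => ?_
  rw [map_smul]
  refine Submodule.smul_mem _ _ ?_
  rw [bezRed_monomial]
  have hdeg : α.degree ≤ D := by
    rw [mem_restrictTotalDegree] at hu
    have := le_totalDegree hα
    rw [Finsupp.degree_eq_sum]
    rw [Finsupp.sum_fintype _ _ (by simp)] at this
    omega
  split_ifs with h
  · set i := h.choose
    have hi : d i ≤ α i := h.choose_spec
    rw [mem_restrictTotalDegree]
    refine (totalDegree_mul _ _).trans ?_
    have h2 : (monomial (α - Finsupp.single i (d i)) (1:ℝ)).totalDegree
        ≤ (α - Finsupp.single i (d i)).degree := by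
      rw [totalDegree_monomial _ one_ne_zero]
      rw [Finsupp.degree_eq_sum, Finsupp.sum_fintype _ _ (by simp)]
    have h3 : (α - Finsupp.single i (d i)).degree + d i = α.degree := by
      have : (α - Finsupp.single i (d i)) + Finsupp.single i (d i) = α :=
        tsub_add_cancel_of_le (by simpa using hi)
      conv_rhs => rw [← this]
      rw [map_add, Finsupp.degree_single]
    have := hP i
    omega
  · exact Submodule.zero_mem _

instance bezFin (D : ℕ) : FiniteDimensional ℝ (restrictTotalDegree σ ℝ D) := by
  have hfin : ({α : σ →₀ ℕ | α.degree ≤ D}).Finite := by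
    apply Set.Finite.subset (Set.finite_Iic (Finsupp.equivFunOnFinite.symm (fun _ : σ => D)))
    intro α hα i
    simp only [Set.mem_ofPred_eq] at hα
    exact (Finsupp.le_degree i α).trans hα
  have : restrictTotalDegree σ ℝ D ≤
      Submodule.span ℝ ((fun α => monomial α (1:ℝ)) '' {α : σ →₀ ℕ | α.degree ≤ D}) := by
    intro u hu
    rw [mem_restrictTotalDegree] at hu
    rw [u.as_sum]
    refine Submodule.sum_mem _ fun α hα => ?_
    have : monomial α (coeff α u) = coeff α u • monomial α (1:ℝ) := by
      rw [smul_monomial, smul_eq_mul, mul_one]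
    rw [this]
    refine Submodule.smul_mem _ _ (Submodule.subset_span ⟨α, ?_, rfl⟩)
    have := le_totalDegree hα
    simp only [Set.mem_ofPred_eq]
    rw [Finsupp.degree_eq_sum]
    rw [Finsupp.sum_fintype _ _ (by simp)] at this
    omega
  have hf := FiniteDimensional.span_of_finite ℝ (hfin.image (fun α => monomial α (1:ℝ)))
  exact Submodule.finiteDimensional_of_le this

lemma bez_alg (P : σ → MvPolynomial σ ℝ) (d : σ → ℕ) (hP : ∀ i, (P i).totalDegree ≤ d i)
    (D : ℕ) : ∃ bad : Set ℝ, bad.Finite ∧ ∀ s ∉ bad, ∀ Q : Finset (σ → ℝ), Q.card ≤ D →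
      (∀ x ∈ Q, ∀ i, eval x (P i) + s * x i ^ d i = 0) → Q.card ≤ ∏ i, d i := by
  classical
  let T : Module.End ℝ (restrictTotalDegree σ ℝ D) :=
    (bezRed P d).restrict (fun u hu => bezRed_mem P d hP D u hu)
  refine ⟨(fun μ => -μ) '' {μ | T.HasEigenvalue μ}, (T.finite_hasEigenvalue).image _, ?_⟩
  intro s hs Q hQ hz
  have hne : ¬ T.HasEigenvalue (-s) := fun h => hs ⟨-s, h, by simp⟩
  have hker : LinearMap.ker (T + s • 1) = ⊥ := by
    rw [Module.End.hasEigenvalue_iff, not_not, Module.End.eigenspace_def] at hne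
    rw [← hne]
    congr 1
    ext; simp [sub_eq_add_neg]
  have hsurj : Function.Surjective ⇑(T + s • (1 : Module.End ℝ (restrictTotalDegree σ ℝ D))) :=
    LinearMap.surjective_of_injective (LinearMap.ker_eq_bot.1 hker)
  -- the basis monomials
  let B : Finset (MvPolynomial σ ℝ) := (Fintype.piFinset fun i => Finset.range (d i)).image
    (fun α => monomial (Finsupp.equivFunOnFinite.symm α) (1:ℝ))
  have hBcard : B.card ≤ ∏ i, d i := by
    refine Finset.card_image_le.trans ?_
    simp
  have hproj : ∀ u, bezProj d u ∈ Submodule.span ℝ (B : Set (MvPolynomial σ ℝ)) := by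
    intro u
    rw [u.as_sum, map_sum]
    refine Submodule.sum_mem _ fun α hα => ?_
    have : monomial α (coeff α u) = coeff α u • monomial α (1:ℝ) := by
      rw [smul_monomial, smul_eq_mul, mul_one]
    rw [this, map_smul]
    refine Submodule.smul_mem _ _ ?_
    rw [bezProj_monomial]
    split_ifs with h
    · exact Submodule.zero_mem _
    · push Not at h
      apply Submodule.subset_span
      simp only [B, Finset.coe_image, Set.mem_image, Finset.mem_coe, Fintype.mem_piFinset,
        Finset.mem_range]
      exact ⟨α, h, by simp⟩
  -- evaluation
  let ev : MvPolynomial σ ℝ →ₗ[ℝ] (Q → ℝ) :=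
    LinearMap.pi fun q => (aeval (q : σ → ℝ) : MvPolynomial σ ℝ →ₐ[ℝ] ℝ).toLinearMap
  have hev : ∀ u (q : Q), ev u q = eval (q : σ → ℝ) u := by
    intro u q
    simp [ev, MvPolynomial.aeval_eq_eval]
  have hspan : (⊤ : Submodule ℝ (Q → ℝ)) ≤ (Submodule.span ℝ (B : Set (MvPolynomial σ ℝ))).map ev := by
    rw [← (Pi.basisFun ℝ Q).span_eq, Submodule.span_le]
    rintro _ ⟨q, rfl⟩
    obtain ⟨f, hf1, hf2, hf3⟩ := bez_interp Q (q : σ → ℝ)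
    obtain ⟨u, hu⟩ := hsurj ⟨f, (mem_restrictTotalDegree _ _ _).2 (hf1.trans hQ)⟩
    have hu' : bezRed P d (u : MvPolynomial σ ℝ) + s • (u : MvPolynomial σ ℝ) = f := by
      have := congrArg Subtype.val hu
      simpa [T] using this
    refine ⟨s • bezProj d u, Submodule.smul_mem _ _ (hproj _), ?_⟩
    ext q'
    rw [hev, ← bez_eval P d s q' (hz q' q'.2), hu', Pi.basisFun_apply]
    by_cases h : q' = q
    · subst h; simp [hf2]
    · rw [hf3 q' q'.2 (fun h' => h (Subtype.ext h')), Pi.single_eq_of_ne h]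
  have h1 : Q.card = Module.finrank ℝ (⊤ : Submodule ℝ (Q → ℝ)) := by
    simp
  have : FiniteDimensional ℝ (Submodule.span ℝ (B : Set (MvPolynomial σ ℝ))) :=
    FiniteDimensional.span_finset ℝ B
  rw [h1]
  calc _ ≤ Module.finrank ℝ ((Submodule.span ℝ (B : Set (MvPolynomial σ ℝ))).map ev) :=
        Submodule.finrank_mono hspan
    _ ≤ Module.finrank ℝ (Submodule.span ℝ (B : Set (MvPolynomial σ ℝ))) :=
        Submodule.finrank_map_le _ _
    _ ≤ B.card := finrank_span_finset_le_card B
    _ ≤ _ := hBcard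

lemma hasStrictFDerivAt_pi_mv (P : σ → MvPolynomial σ ℝ) (d : σ → ℕ) :
    ContDiff ℝ 1 (fun z : ℝ × (σ → ℝ) =>
      ((z.1, fun i => eval z.2 (P i) + z.1 * z.2 i ^ d i) : ℝ × (σ → ℝ))) := by
  refine contDiff_fst.prodMk ?_
  rw [contDiff_pi]
  intro i
  refine ((contDiff_mvEval (P i) 1).comp contDiff_snd).add (contDiff_fst.mul ?_)
  exact ((contDiff_apply ℝ ℝ i).comp contDiff_snd).pow _

/-- Bezout bound for nondegenerate real zeros. -/
theorem bezout_real (P : σ → MvPolynomial σ ℝ) (d : σ → ℕ) (hP : ∀ i, (P i).totalDegree ≤ d i)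
    (Q : Finset (σ → ℝ)) (hQ0 : ∀ x ∈ Q, ∀ i, eval x (P i) = 0)
    (hQ1 : ∀ x ∈ Q, (jac (fun i x => eval x (P i)) x).det ≠ 0) :
    Q.card ≤ ∏ i, d i := by
  classical
  obtain ⟨bad, hbad, hmain⟩ := bez_alg P d hP Q.card
  let Ψ : ℝ × (σ → ℝ) → ℝ × (σ → ℝ) :=
    fun z => (z.1, fun i => eval z.2 (P i) + z.1 * z.2 i ^ d i)
  have hΨ : ContDiff ℝ 1 Ψ := hasStrictFDerivAt_pi_mv P d
  have hopen : ∀ q ∈ Q, Filter.map Ψ (nhds ((0:ℝ), q)) = nhds ((0:ℝ), (0 : σ → ℝ)) := by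
    intro q hq
    have hs : HasStrictFDerivAt Ψ (fderiv ℝ Ψ (0, q)) (0, q) :=
      hΨ.contDiffAt.hasStrictFDerivAt (by norm_num)
    have hval : Ψ (0, q) = (0, 0) := by
      simp only [Ψ, zero_mul, add_zero]
      ext i
      · rfl
      · simp [hQ0 q hq i]
    rw [← hval]
    apply hs.map_nhds_eq_of_surj
    have hinj : Function.Injective (fderiv ℝ Ψ (0, q)) := by
      rw [injective_iff_map_eq_zero]
      rintro ⟨t, v⟩ htv
      have h1 : HasFDerivAt (fun z => (Ψ z).1) ((ContinuousLinearMap.fst ℝ ℝ (σ → ℝ)).comp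
          (fderiv ℝ Ψ (0, q))) (0, q) :=
        hs.hasFDerivAt.fst
      have h1' : HasFDerivAt (fun z => (Ψ z).1) (ContinuousLinearMap.fst ℝ ℝ (σ → ℝ)) (0, q) :=
        (ContinuousLinearMap.fst ℝ ℝ (σ → ℝ)).hasFDerivAt
      have ht : t = 0 := by
        have := congrArg (fun L : (ℝ × (σ → ℝ)) →L[ℝ] ℝ => L (t, v)) (h1'.unique h1)
        simpa [htv] using this
      subst ht
      -- restrict to the slice
      have h2 : HasFDerivAt (fun x : σ → ℝ => ((0:ℝ), x)) (ContinuousLinearMap.inr ℝ ℝ (σ → ℝ)) q :=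
        (ContinuousLinearMap.inr ℝ ℝ (σ → ℝ)).hasFDerivAt
      have h3 : HasFDerivAt (fun x : σ → ℝ => (fun i => eval x (P i)))
          ((ContinuousLinearMap.snd ℝ ℝ (σ → ℝ)).comp ((fderiv ℝ Ψ (0, q)).comp
            (ContinuousLinearMap.inr ℝ ℝ (σ → ℝ)))) q := by
        have := (ContinuousLinearMap.snd ℝ ℝ (σ → ℝ)).hasFDerivAt.comp q
          ((hs.hasFDerivAt).comp q h2)
        refine this.congr_of_eventuallyEq (Filter.Eventually.of_forall fun x => ?_)
        ext i
        simp [Ψ]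
      have h4 : (jac (fun i x => eval x (P i)) q).mulVec v = 0 := by
        ext i
        have h5 := (hasFDerivAt_pi'.1 h3 i).fderiv
        have : fderiv ℝ (fun x => eval x (P i)) q v = 0 := by
          rw [h5]
          simp [htv]
        rw [pi_eq_sum_univ' v, map_sum] at this
        simp only [jac, Matrix.mulVec, dotProduct, Matrix.of_apply, Pi.zero_apply]
        rw [← this]
        refine Finset.sum_congr rfl fun k _ => ?_
        rw [map_smul, smul_eq_mul, mul_comm]
      have hv := Matrix.eq_zero_of_mulVec_eq_zero (hQ1 q hq) h4
      rw [hv]; rfl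
    have : Function.Surjective ((fderiv ℝ Ψ (0, q) : ℝ × (σ → ℝ) →L[ℝ] ℝ × (σ → ℝ)) :
        ℝ × (σ → ℝ) →ₗ[ℝ] ℝ × (σ → ℝ)) :=
      LinearMap.surjective_of_injective hinj
    exact LinearMap.range_eq_top.2 this
  obtain ⟨U, hU1, hU2⟩ := (Q.finite_toSet).t2_separation
  have hev : ∀ᶠ s in nhds (0:ℝ), ∀ q ∈ Q, ∃ x ∈ U q, ∀ i, eval x (P i) + s * x i ^ d i = 0 := by
    rw [Filter.eventually_all_finset]
    intro q hq
    have hmem : (Set.univ ×ˢ U q) ∈ nhds ((0:ℝ), q) :=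
      prod_mem_nhds Filter.univ_mem ((hU1 q).2.mem_nhds (hU1 q).1)
    have h2 : Ψ '' (Set.univ ×ˢ U q) ∈ nhds ((0:ℝ), (0 : σ → ℝ)) := by
      rw [← hopen q hq]; exact Filter.image_mem_map hmem
    have h3 : Filter.Tendsto (fun s : ℝ => (s, (0 : σ → ℝ))) (nhds 0) (nhds (0, 0)) :=
      (Continuous.prodMk_left (0 : σ → ℝ)).tendsto 0
    filter_upwards [h3 h2] with s hs
    obtain ⟨⟨s', x⟩, ⟨_, hx⟩, hsx⟩ := hs
    have e1 : s' = s := congrArg Prod.fst hsx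
    subst e1
    exact ⟨x, hx, fun i => congrFun (congrArg Prod.snd hsx) i⟩
  have hev2 : ∃ᶠ s in nhds (0:ℝ), s ∉ bad := by
    have : badᶜ ∈ nhdsWithin (0:ℝ) {0}ᶜ := by
      have := (hbad.subset (Set.sdiff_subset : bad \ {0} ⊆ bad)).isClosed.isOpen_compl.mem_nhds
        (show (0:ℝ) ∈ (bad \ {0})ᶜ by simp)
      filter_upwards [mem_nhdsWithin_of_mem_nhds this, self_mem_nhdsWithin] with s h1 h2 h3
      exact h1 ⟨h3, h2⟩
    have h4 : ∃ᶠ s in nhdsWithin (0:ℝ) {0}ᶜ, s ∉ bad := Filter.Eventually.frequently this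
    exact h4.filter_mono nhdsWithin_le_nhds
  obtain ⟨s, hs1, hs2⟩ := (hev2.and_eventually hev).exists
  choose! y hy1 hy2 using hs2
  have hinj : Set.InjOn y Q := by
    intro q hq q' hq' h
    by_contra hne
    have := hU2 hq hq' hne
    exact Set.disjoint_left.1 this (hy1 q hq) (h ▸ hy1 q' hq')
  have hc : (Q.image y).card = Q.card := Finset.card_image_of_injOn hinj
  rw [← hc]
  refine hmain s hs1 _ hc.le ?_
  intro x hx
  obtain ⟨q, hq, rfl⟩ := Finset.mem_image.1 hx
  exact hy2 q hq

end Bezout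


/-! ## Abstract Khovanskii-Rolle lemma -/
set_option linter.unusedSectionVars false
section Rolle
open Set Filter Topology MeasureTheory

lemma sard_one (u : ℝ → ℝ) (hu : Differentiable ℝ u) :
    volume (u '' {t | deriv u t = 0}) = 0 := by
  refine addHaar_image_eq_zero_of_det_fderivWithin_eq_zero (f' := fun t => fderiv ℝ u t) volume
    (fun t _ => (hu t).hasFDerivAt.hasFDerivWithinAt) ?_
  intro t ht
  have : fderiv ℝ u t = 0 := by
    ext
    simpa using ht
  rw [this]
  simp [ContinuousLinearMap.det]

variable {E : Type} [NormedAddCommGroup E] [NormedSpace ℝ E]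

lemma global_flow [CompleteSpace E] (W : E → E) (K : NNReal) (hL : LipschitzWith K W) (C : NNReal)
    (hb : ∀ x, ‖W x‖ ≤ C) (q : E) :
    ∃ γ : ℝ → E, γ 0 = q ∧ ∀ t, HasDerivAt γ (W (γ t)) t := by
  have hloc : ∀ T : NNReal, ∃ α : ℝ → E, α 0 = q ∧
      ∀ t ∈ Ioo (-(T:ℝ)) T, HasDerivAt α (W (α t)) t := by
    intro T
    have hT : (0:ℝ) ∈ Icc (-(T:ℝ)) T := ⟨by simp, by simp⟩
    have hPL : IsPicardLindelof (fun _ => W) (⟨0, hT⟩ : Icc (-(T:ℝ)) T) q (C * T) 0 C K := by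
      refine ⟨fun t _ => hL.lipschitzOnWith, fun x _ => continuousOn_const,
        fun t _ x _ => hb x, ?_⟩
      simp
    obtain ⟨α, h1, h2⟩ := hPL.exists_eq_forall_mem_Icc_hasDerivWithinAt₀
    exact ⟨α, h1, fun t ht => (h2 t (Ioo_subset_Icc_self ht)).hasDerivAt (Icc_mem_nhds ht.1 ht.2)⟩
  choose α h1 h2 using hloc
  have huniq : ∀ S T : NNReal, S ≤ T → EqOn (α S) (α T) (Ioo (-(S:ℝ)) S) := by
    intro S T hST
    rcases eq_or_lt_of_le (zero_le : 0 ≤ S) with h | h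
    · rw [← h]; intro t ht; simp at ht
    · have hST' : (S:ℝ) ≤ T := hST
      exact ODE_solution_unique_of_mem_Ioo (v := fun _ => W) (s := fun _ => univ) (K := K)
        (t₀ := 0) (fun t _ => hL.lipschitzOnWith) ⟨by simpa using h, by simpa using h⟩
        (fun t ht => ⟨h2 S t ht, trivial⟩)
        (fun t ht => ⟨h2 T t ⟨by linarith [ht.1], by linarith [ht.2]⟩, trivial⟩)
        ((h1 S).trans (h1 T).symm)
  let γ : ℝ → E := fun t => α (‖t‖₊ + 1) t
  have hγ : ∀ T : NNReal, EqOn γ (α T) (Ioo (-(T:ℝ)) T) := by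
    intro T t ht
    have hmem : t ∈ Ioo (-((‖t‖₊ + 1 : NNReal):ℝ)) (‖t‖₊ + 1 : NNReal) := by
      constructor
      · push_cast; rw [Real.norm_eq_abs]; linarith [neg_abs_le t]
      · push_cast; rw [Real.norm_eq_abs]; linarith [le_abs_self t]
    rcases le_total (‖t‖₊ + 1) T with h | h
    · exact huniq _ _ h hmem
    · exact (huniq _ _ h ht).symm
  refine ⟨γ, h1 _, fun t => ?_⟩
  set T : NNReal := ‖t‖₊ + 1
  have hmem : t ∈ Ioo (-(T:ℝ)) T := by
    constructor
    · simp only [T]; push_cast; rw [Real.norm_eq_abs]; linarith [neg_abs_le t]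
    · simp only [T]; push_cast; rw [Real.norm_eq_abs]; linarith [le_abs_self t]
  have h3 : γ =ᶠ[𝓝 t] α T := by
    filter_upwards [isOpen_Ioo.mem_nhds hmem] with s hs using hγ T hs
  rw [hγ T hmem]
  exact (h2 T t hmem).congr_of_eventuallyEq h3

lemma exit_time (γ : ℝ → E) (hγ : Continuous γ) (O Cl : Set E) (hO : IsOpen O) (hC : IsCompact Cl)
    (hOC : O ⊆ Cl) (φ ρ : E → ℝ) (hφ : ContinuousOn φ Cl) (hρ : ContinuousOn ρ Cl)
    (hpos : ∀ x ∈ Cl, 0 < ρ x) (hder : ∀ t, γ t ∈ Cl → HasDerivAt (fun t => φ (γ t)) (ρ (γ t)) t)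
    (h0 : γ 0 ∈ O) : ∃ t > 0, γ t ∈ Cl ∧ γ t ∉ O ∧ ∀ r ∈ Icc 0 t, γ r ∈ Cl := by
  by_cases hall : ∀ t ≥ 0, γ t ∈ O
  · exfalso
    have hne : Cl.Nonempty := ⟨_, hOC h0⟩
    obtain ⟨x0, hx0, hmin⟩ := hC.exists_isMinOn hne hρ
    obtain ⟨B, hB⟩ := hC.exists_bound_of_continuousOn hφ
    have hc := hpos x0 hx0
    set c := ρ x0
    have hgrow : ∀ t ≥ 0, φ (γ 0) + c * t ≤ φ (γ t) := by
      intro t ht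
      have hmono : MonotoneOn (fun t => φ (γ t) - c * t) (Ici 0) := by
        apply monotoneOn_of_deriv_nonneg (convex_Ici 0)
        · intro s hs
          exact (((hder s (hOC (hall s hs))).sub ((hasDerivAt_id s).const_mul c)).continuousAt).continuousWithinAt
        · intro s hs
          rw [interior_Ici] at hs
          exact ((hder s (hOC (hall s (le_of_lt hs)))).sub ((hasDerivAt_id s).const_mul c)).differentiableAt.differentiableWithinAt
        · intro s hs
          rw [interior_Ici] at hs
          have hd : HasDerivAt (fun t => φ (γ t) - c * t) (ρ (γ s) - c * 1) s :=
            (hder s (hOC (hall s (le_of_lt hs)))).sub ((hasDerivAt_id s).const_mul c)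
          rw [hd.deriv]
          have := hmin (hOC (hall s (le_of_lt hs)))
          simp only [mul_one]
          have h' : c ≤ ρ (γ s) := this
          linarith
      have := hmono (mem_Ici.2 le_rfl) (mem_Ici.2 ht) ht
      simp only [mul_zero, sub_zero] at this
      linarith
    have hB0 := hB _ (hOC h0)
    have ht0 : (0:ℝ) ≤ (2 * B + 1) / c := by
      have : 0 ≤ B := (norm_nonneg _).trans hB0
      positivity
    have h1 := hgrow _ ht0
    have h2 := hB _ (hOC (hall _ ht0))
    rw [mul_div_cancel₀ _ hc.ne'] at h1
    rw [Real.norm_eq_abs] at h2 hB0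
    linarith [le_abs_self (φ (γ ((2 * B + 1) / c))), neg_abs_le (φ (γ 0))]
  · push Not at hall
    obtain ⟨t1, ht1, hn1⟩ := hall
    set S := {t : ℝ | 0 ≤ t ∧ γ t ∉ O} with hS
    have hScl : IsClosed S := isClosed_Ici.inter ((hO.preimage hγ).isClosed_compl)
    have hSne : S.Nonempty := ⟨t1, ht1, hn1⟩
    have hSbdd : BddBelow S := ⟨0, fun t ht => ht.1⟩
    have hmem : sInf S ∈ S := hScl.csInf_mem hSne hSbdd
    set t := sInf S
    have hlt : ∀ r, 0 ≤ r → r < t → γ r ∈ O := by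
      intro r hr hrt
      by_contra h
      exact absurd (csInf_le hSbdd (show r ∈ S from ⟨hr, h⟩)) (not_le.2 hrt)
    have htpos : 0 < t := by
      rcases eq_or_lt_of_le hmem.1 with h | h
      · exact absurd h0 (by have := hmem.2; rwa [← h] at this)
      · exact h
    have htCl : γ t ∈ Cl := by
      have h1 : t ∈ closure (Ico 0 t) := by
        rw [closure_Ico htpos.ne]; exact ⟨htpos.le, le_rfl⟩
      have h2 : MapsTo γ (Ico 0 t) Cl := fun r hr => hOC (hlt r hr.1 hr.2)
      have := h2.closure hγ h1
      rwa [hC.isClosed.closure_eq] at this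
    refine ⟨t, htpos, htCl, hmem.2, ?_⟩
    intro r hr
    rcases eq_or_lt_of_le hr.2 with h | h
    · rw [h]; exact htCl
    · exact hOC (hlt r hr.1 h)

lemma strictMono_along (γ : ℝ → E) (Cl : Set E) (φ ρ : E → ℝ)
    (hpos : ∀ x ∈ Cl, 0 < ρ x) (hder : ∀ t, γ t ∈ Cl → HasDerivAt (fun t => φ (γ t)) (ρ (γ t)) t)
    (a b : ℝ) (hab : ∀ r ∈ Icc a b, γ r ∈ Cl) : StrictMonoOn (fun t => φ (γ t)) (Icc a b) := by
  apply strictMonoOn_of_deriv_pos (convex_Icc a b)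
  · intro s hs
    exact (hder s (hab s hs)).continuousAt.continuousWithinAt
  · intro s hs
    have hs' := interior_subset hs
    rw [(hder s (hab s hs')).deriv]
    exact hpos _ (hab s hs')

/-- cut-off vector field -/
lemma exists_cutoff [FiniteDimensional ℝ E] (Δ : Set E) (hΔ : IsOpen Δ) (V : E → E)
    (hV : ContDiffOn ℝ 1 V Δ) (K0 : Set E) (hK0 : IsCompact K0) (hKΔ : K0 ⊆ Δ) :
    ∃ χ : E → ℝ, ContDiff ℝ 1 χ ∧ (∀ x ∈ K0, 0 < χ x) ∧ (∀ x ∉ Δ, χ x = 0) ∧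
      (∃ K, LipschitzWith K (fun x => χ x • V x)) ∧ ∃ C : NNReal, ∀ x, ‖χ x • V x‖ ≤ C := by
  obtain ⟨K1, hK1, h1, h2⟩ := exists_compact_between hK0 hΔ hKΔ
  obtain ⟨χ, hχs, hχd, hχr⟩ := (isOpen_interior (s := K1)).exists_contDiff_support_eq (n := ⊤)
  have hts : tsupport χ ⊆ K1 := by
    rw [tsupport, hχs]
    exact closure_minimal interior_subset hK1.isClosed
  have hχ1 : ContDiff ℝ 1 χ := hχd.of_le (by exact_mod_cast le_top)
  have hcd : ContDiff ℝ 1 (fun x => χ x • V x) := by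
    rw [contDiff_iff_contDiffAt]
    intro x
    by_cases hx : x ∈ tsupport χ
    swap
    · have : (fun x => χ x • V x) =ᶠ[𝓝 x] fun _ => 0 := by
        filter_upwards [(isClosed_tsupport χ).isOpen_compl.mem_nhds hx] with z hz
        rw [image_eq_zero_of_notMem_tsupport hz, zero_smul]
      exact contDiffAt_const.congr_of_eventuallyEq this
    have hx' : x ∈ Δ := h2 (hts hx)
    exact hχ1.contDiffAt.smul (hV.contDiffAt (hΔ.mem_nhds hx'))
  have hcs : HasCompactSupport (fun x => χ x • V x) :=
    HasCompactSupport.smul_right (HasCompactSupport.of_support_subset_isCompact hK1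
      ((subset_tsupport _).trans hts))
  refine ⟨χ, hχ1, ?_, ?_, hcd.lipschitzWith_of_hasCompactSupport hcs (by simp), ?_⟩
  · intro x hx
    have : x ∈ Function.support χ := by rw [hχs]; exact h1 hx
    exact lt_of_le_of_ne (hχr ⟨x, rfl⟩).1 (Ne.symm this)
  · intro x hx
    by_contra h
    exact hx (h2 (interior_subset (hχs ▸ (show x ∈ Function.support χ from h))))
  · obtain ⟨C, hC⟩ := hcs.exists_bound_of_continuous hcd.continuous
    exact ⟨⟨max C 0, le_max_right _ _⟩, fun x => (hC x).trans (le_max_left _ _)⟩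


lemma exists_notMem_of_null (N : Set ℝ) (hN : volume N = 0) (a b : ℝ) (hab : a < b) :
    ∃ x, a < x ∧ x < b ∧ x ∉ N := by
  by_contra h
  push Not at h
  have hsub : Ioo a b ⊆ N := fun x hx => h x hx.1 hx.2
  have := measure_mono_null hsub hN
  rw [Real.volume_Ioo, ENNReal.ofReal_eq_zero] at this
  linarith

theorem rolle_main [FiniteDimensional ℝ E] {κ : Type} [Fintype κ] (Δ : Set E) (hΔ : IsOpen Δ)
    (V : E → E) (hV : ContDiffOn ℝ 1 V Δ) (f J j : E → ℝ)
    (hf : DifferentiableOn ℝ f Δ) (hJ : ContinuousOn J Δ)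
    (hfJ : ∀ x ∈ Δ, fderiv ℝ f x (V x) = J x)
    (hj : Differentiable ℝ j) (hjJ : ∀ x ∈ Δ, ∃ h > 0, j x = h * J x)
    (ψ : κ → E → ℝ) (hψ : ∀ c, Differentiable ℝ (ψ c)) (lo hi : κ → ℝ) (hlh : ∀ c, lo c < hi c)
    (hK : IsCompact {x | ∀ c, lo c ≤ ψ c x}) (hKΔ : {x | ∀ c, lo c ≤ ψ c x} ⊆ Δ)
    (Q : Finset E) (hQψ : ∀ q ∈ Q, ∀ c, hi c < ψ c q) (hQf : ∀ q ∈ Q, f q = 0)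
    (hQJ : ∀ q ∈ Q, J q ≠ 0) :
    ∃ (δ : ℝ) (ε : κ → ℝ) (Ap Am : Finset E) (B : κ → Finset E), 0 < δ ∧
      2 * Q.card ≤ Ap.card + Am.card + ∑ c, (B c).card ∧
      (∀ e, (e ∈ Ap ∨ e ∈ Am ∨ ∃ c, e ∈ B c) → e ∈ Δ ∧
        ∀ u : E → ℝ, DifferentiableOn ℝ u Δ → (∀ x ∈ Δ, fderiv ℝ u x (V x) = 0) →
          (∀ q ∈ Q, u q = 0) → u e = 0) ∧
      (∀ e ∈ Ap, j e = δ ∧ fderiv ℝ j e (V e) ≠ 0) ∧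
      (∀ e ∈ Am, j e = -δ ∧ fderiv ℝ j e (V e) ≠ 0) ∧
      (∀ c, ∀ e ∈ B c, ψ c e = ε c ∧ fderiv ℝ (ψ c) e (V e) ≠ 0) ∧
      ((∀ q ∈ Q, 0 < J q) → Am = ∅) := by
  classical
  obtain ⟨χ, hχd, hχpos, -, ⟨KL, hKL⟩, C, hC⟩ := exists_cutoff Δ hΔ V hV _ hK hKΔ
  set W : E → E := fun x => χ x • V x with hW
  choose γ hγ0 hγd using global_flow W KL hKL C hC
  have hγc : ∀ q, Continuous (γ q) := fun q =>
    continuous_iff_continuousAt.2 fun t => (hγd q t).continuousAt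
  -- derivative of functions along orbits
  have hder : ∀ (u : E → ℝ) (q : E) (t : ℝ), DifferentiableAt ℝ u (γ q t) →
      HasDerivAt (fun s => u (γ q s)) (χ (γ q t) * fderiv ℝ u (γ q t) (V (γ q t))) t := by
    intro u q t hu
    have := hu.hasFDerivAt.comp_hasDerivAt t (hγd q t)
    simp only [hW, map_smul, smul_eq_mul] at this
    exact this
  have hQK : ∀ q ∈ Q, q ∈ {x | ∀ c, lo c ≤ ψ c x} := fun q hq c =>
    (hlh c).le.trans (hQψ q hq c).le
  have hQΔ : ∀ q ∈ Q, q ∈ Δ := fun q hq => hKΔ (hQK q hq)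
  have hQj : ∀ q ∈ Q, j q ≠ 0 := by
    intro q hq
    obtain ⟨h, hh, he⟩ := hjJ q (hQΔ q hq)
    rw [he]; exact mul_ne_zero hh.ne' (hQJ q hq)
  -- choice of levels
  have hnull : ∀ u : E → ℝ, Differentiable ℝ u →
      volume (⋃ q ∈ Q, (fun s => u (γ q s)) '' {t | deriv (fun s => u (γ q s)) t = 0}) = 0 := by
    intro u hu
    refine (measure_biUnion_null_iff Q.countable_toSet).2 ?_
    intro q _
    exact sard_one _ fun t => (hder u q t (hu _)).differentiableAt
  have hε : ∀ c, ∃ x, lo c < x ∧ x < hi c ∧ x ∉ (⋃ q ∈ Q, (fun s => ψ c (γ q s)) ''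
      {t | deriv (fun s => ψ c (γ q s)) t = 0}) := fun c =>
    exists_notMem_of_null _ (hnull (ψ c) (hψ c)) _ _ (hlh c)
  choose ε hε1 hε2 hε3 using hε
  obtain ⟨δ0, hδ0, hdQQ⟩ : ∃ δ0 > 0, ∀ q ∈ Q, δ0 ≤ |j q| := by
    by_cases hne : Q.Nonempty
    · obtain ⟨q0, hq0, hmin⟩ := Q.exists_min_image (fun q => |j q|) hne
      exact ⟨|j q0|, abs_pos.2 (hQj q0 hq0), hmin⟩
    · rw [Finset.not_nonempty_iff_eq_empty] at hne
      exact ⟨1, one_pos, by simp [hne]⟩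
  obtain ⟨δ, hδpos, hδlt, hδN⟩ := exists_notMem_of_null
    ((⋃ q ∈ Q, (fun s => j (γ q s)) '' {t | deriv (fun s => j (γ q s)) t = 0}) ∪
     (⋃ q ∈ Q, (fun s => (-j) (γ q s)) '' {t | deriv (fun s => (-j) (γ q s)) t = 0}))
    (measure_union_null (hnull j hj) (hnull (-j) hj.neg)) 0 δ0 hδ0
  -- signs
  let a : E → ℝ := fun q => if 0 < J q then 1 else -1
  have ha2 : ∀ q, a q * a q = 1 := by
    intro q; simp only [a]; split_ifs <;> norm_num
  let bs : Bool → ℝ := fun b => if b then 1 else -1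
  have hb2 : ∀ b, bs b * bs b = 1 := by
    intro b; cases b <;> simp [bs]
  let Cl : ℝ → Set E := fun s => {x | (∀ c, ε c ≤ ψ c x) ∧ δ ≤ s * j x}
  let O : ℝ → Set E := fun s => {x | (∀ c, ε c < ψ c x) ∧ δ < s * j x}
  have hOopen : ∀ s, IsOpen (O s) := by
    intro s
    have h1 : IsOpen {x | ∀ c, ε c < ψ c x} := by
      have : {x | ∀ c, ε c < ψ c x} = ⋂ c, {x | ε c < ψ c x} := by ext; simp
      rw [this]
      exact isOpen_iInter_of_finite fun c => isOpen_lt continuous_const (hψ c).continuous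
    exact h1.inter (isOpen_lt continuous_const (continuous_const.mul hj.continuous))
  have hClclosed : ∀ s, IsClosed (Cl s) := by
    intro s
    have h1 : IsClosed {x | ∀ c, ε c ≤ ψ c x} := by
      have : {x | ∀ c, ε c ≤ ψ c x} = ⋂ c, {x | ε c ≤ ψ c x} := by ext; simp
      rw [this]
      exact isClosed_iInter fun c => isClosed_le continuous_const (hψ c).continuous
    exact h1.inter (isClosed_le continuous_const (continuous_const.mul hj.continuous))
  have hClK : ∀ s, Cl s ⊆ {x | ∀ c, lo c ≤ ψ c x} := fun s x hx c => (hε1 c).le.trans (hx.1 c)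
  have hClcomp : ∀ s, IsCompact (Cl s) := fun s => hK.of_isClosed_subset (hClclosed s) (hClK s)
  have hClΔ : ∀ s, Cl s ⊆ Δ := fun s => (hClK s).trans hKΔ
  have hOCl : ∀ s, O s ⊆ Cl s := fun s x hx => ⟨fun c => (hx.1 c).le, hx.2.le⟩
  have hQO : ∀ q ∈ Q, q ∈ O (a q) := by
    intro q hq
    refine ⟨fun c => (hε2 c).trans (hQψ q hq c), ?_⟩
    have h1 : a q * j q = |j q| := by
      obtain ⟨h, hh, he⟩ := hjJ q (hQΔ q hq)
      simp only [a]
      split_ifs with h0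
      · rw [one_mul, abs_of_pos]; rw [he]; positivity
      · have : J q < 0 := lt_of_le_of_ne (not_lt.1 h0) (hQJ q hq)
        rw [neg_one_mul, abs_of_neg]; rw [he]; exact mul_neg_of_pos_of_neg hh this
    rw [h1]
    exact hδlt.trans_le (hdQQ q hq)
  have hρpos : ∀ s, s * s = 1 → ∀ x ∈ Cl s, 0 < s * (χ x * J x) := by
    intro s hs x hx
    have h1 := hχpos x (hClK s hx)
    obtain ⟨h, hh, he⟩ := hjJ x (hClΔ s hx)
    have h2 := hx.2
    rw [he] at h2
    have h3 : 0 < h * (s * J x) := by linarith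
    have h4 : 0 < s * J x := (mul_pos_iff_of_pos_left hh).1 h3
    have : s * (χ x * J x) = χ x * (s * J x) := by ring
    rw [this]; positivity
  have hρc : ∀ s, ContinuousOn (fun x => s * (χ x * J x)) (Cl s) := fun s =>
    continuousOn_const.mul (hχd.continuous.continuousOn.mul (hJ.mono (hClΔ s)))
  -- reparametrized orbits
  have hder2 : ∀ (q : E) (b : Bool) (s : ℝ) (t : ℝ), γ q (bs b * t) ∈ Cl s →
      HasDerivAt (fun t => (s * bs b) * f (γ q (bs b * t)))
        (s * (χ (γ q (bs b * t)) * J (γ q (bs b * t)))) t := by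
    intro q b s t ht
    have h1 := hder f q (bs b * t) (hf.differentiableAt (hΔ.mem_nhds (hClΔ s ht)))
    rw [hfJ _ (hClΔ s ht)] at h1
    have h2 : HasDerivAt (fun t => bs b * t) (bs b) t := by
      simpa using (hasDerivAt_id t).const_mul (bs b)
    have h3 := (h1.comp t h2).const_mul (s * bs b)
    have h4 : s * (χ (γ q (bs b * t)) * J (γ q (bs b * t))) =
        s * bs b * (χ (γ q (bs b * t)) * J (γ q (bs b * t)) * bs b) := by
      linear_combination (-(s * (χ (γ q (bs b * t)) * J (γ q (bs b * t))))) * hb2 b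
    rw [h4]
    exact h3
  have hexit : ∀ q b, q ∈ Q → ∃ t > 0, γ q (bs b * t) ∈ Cl (a q) ∧ γ q (bs b * t) ∉ O (a q) ∧
      ∀ r ∈ Icc 0 t, γ q (bs b * r) ∈ Cl (a q) := by
    intro q b hq
    exact exit_time (fun t => γ q (bs b * t)) ((hγc q).comp (continuous_const.mul continuous_id))
      (O (a q)) (Cl (a q)) (hOopen _) (hClcomp _) (hOCl _) (fun x => (a q * bs b) * f x)
      (fun x => a q * (χ x * J x))
      (continuousOn_const.mul ((hf.continuousOn).mono (hClΔ _))) (hρc _) (hρpos _ (ha2 q))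
      (fun t ht => hder2 q b (a q) t ht) (by simpa [hγ0] using hQO q hq)
  choose! τ hτ1 hτ2 hτ3 hτ4 using hexit
  let ev : E × Bool → E := fun z => γ z.1 (bs z.2 * τ z.1 z.2)
  -- strict monotonicity
  have hmono : ∀ q b, q ∈ Q → StrictMonoOn (fun t => (a q * bs b) * f (γ q (bs b * t)))
      (Icc 0 (τ q b)) := by
    intro q b hq
    exact strictMono_along (fun t => γ q (bs b * t)) (Cl (a q)) (fun x => (a q * bs b) * f x)
      (fun x => a q * (χ x * J x)) (hρpos _ (ha2 q)) (fun t ht => hder2 q b (a q) t ht) 0 _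
      (hτ4 q b hq)
  have hevpos : ∀ q b, q ∈ Q → 0 < (a q * bs b) * f (ev (q, b)) := by
    intro q b hq
    have := hmono q b hq ⟨le_rfl, (hτ1 q b hq).le⟩ ⟨(hτ1 q b hq).le, le_rfl⟩ (hτ1 q b hq)
    simpa [hγ0, hQf q hq] using this
  have haux : ∀ q q' b, q ∈ Q → q' ∈ Q → a q = a q' → ev (q, b) = ev (q', b) →
      τ q b ≤ τ q' b → q = q' := by
    intro q q' b hq hq' haa he hle
    have hfield : ∀ p (s : ℝ) (r : ℝ), HasDerivAt (fun r => γ p (bs b * (s + r)))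
        (bs b • W (γ p (bs b * (s + r)))) r := by
      intro p s r
      have h2 : HasDerivAt (fun r => bs b * (s + r)) (bs b) r := by
        simpa using ((hasDerivAt_id r).const_add s).const_mul (bs b)
      exact (hγd p (bs b * (s + r))).scomp r h2
    have hLb : LipschitzWith (‖bs b‖₊ * KL) (fun x => bs b • W x) := by
      have := (lipschitzWith_smul (bs b) (β := E)).comp hKL
      exact this
    have heq : (fun r => γ q (bs b * (τ q b + r))) = (fun r => γ q' (bs b * (τ q' b + r))) := by
      refine ODE_solution_unique_univ (v := fun _ x => bs b • W x) (s := fun _ => univ)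
        (t₀ := 0) (fun _ => hLb.lipschitzOnWith) (fun r => ⟨hfield q _ r, trivial⟩)
        (fun r => ⟨hfield q' _ r, trivial⟩) ?_
      simpa [ev] using he
    have h1 := congrFun heq (-(τ q b))
    simp only [add_neg_cancel, mul_zero, hγ0] at h1
    have hm : τ q' b + -τ q b ∈ Icc 0 (τ q' b) := by
      constructor
      · linarith
      · linarith [hτ1 q b hq]
    have h2 := (hmono q' b hq').injOn hm ⟨le_rfl, (hτ1 q' b hq').le⟩ (by
      show a q' * bs b * f (γ q' (bs b * (τ q' b + -τ q b))) = a q' * bs b * f (γ q' (bs b * 0))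
      rw [← h1, mul_zero, hγ0, hQf q hq, hQf q' hq'])
    rw [h2, mul_zero, hγ0] at h1
    exact h1
  have hasign : ∀ q b, q ∈ Q → δ ≤ a q * j (ev (q, b)) := fun q b hq => (hτ2 q b hq).2
  have hinj : Set.InjOn ev (Q ×ˢ (Finset.univ : Finset Bool) : Finset (E × Bool)) := by
    rintro ⟨q, b⟩ hq ⟨q', b'⟩ hq' he
    simp only [Finset.coe_product, Set.mem_prod, Finset.mem_coe, Finset.coe_univ, Set.mem_univ,
      and_true] at hq hq'
    have haa : a q = a q' := by
      have h1 := hasign q b hq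
      have h2 := hasign q' b' hq'
      rw [he] at h1
      simp only [a] at h1 h2 ⊢
      split_ifs at h1 h2 ⊢ <;> linarith
    have hbb : b = b' := by
      have h1 := hevpos q b hq
      have h2 := hevpos q' b' hq'
      rw [he, haa] at h1
      simp only [bs] at h1 h2
      cases b <;> cases b' <;> simp at h1 h2 ⊢ <;> linarith
    subst hbb
    rcases le_total (τ q b) (τ q' b) with h | h
    · rw [haux q q' b hq hq' haa he h]
    · rw [haux q' q b hq' hq haa.symm he.symm h]
  set T : Finset E := (Q ×ˢ (Finset.univ : Finset Bool)).image ev with hT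
  have hTcard : T.card = 2 * Q.card := by
    rw [hT, Finset.card_image_of_injOn hinj, Finset.card_product]
    simp [mul_comm]
  have hTmem : ∀ e ∈ T, ∃ q ∈ Q, ∃ b, e = ev (q, b) := by
    intro e he
    obtain ⟨⟨q, b⟩, hqb, rfl⟩ := Finset.mem_image.1 he
    exact ⟨q, (Finset.mem_product.1 hqb).1, b, rfl⟩
  have hVne : ∀ (u : E → ℝ), Differentiable ℝ u → ∀ q ∈ Q, ∀ t l, u (γ q t) = l →
      l ∉ (⋃ q ∈ Q, (fun s => u (γ q s)) '' {t | deriv (fun s => u (γ q s)) t = 0}) →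
      fderiv ℝ u (γ q t) (V (γ q t)) ≠ 0 := by
    intro u hu q hq t l hl hn h0
    apply hn
    simp only [Set.mem_iUnion]
    refine ⟨q, hq, t, ?_, hl⟩
    show deriv (fun s => u (γ q s)) t = 0
    rw [(hder u q t (hu _)).deriv, h0, mul_zero]
  refine ⟨δ, ε, T.filter (fun e => j e = δ), T.filter (fun e => j e = -δ),
    fun c => T.filter (fun e => ψ c e = ε c), hδpos, ?_, ?_, ?_, ?_, ?_, ?_⟩
  · rw [← hTcard]
    have hsub : T ⊆ (T.filter (fun e => j e = δ) ∪ T.filter (fun e => j e = -δ)) ∪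
        Finset.univ.biUnion (fun c => T.filter (fun e => ψ c e = ε c)) := by
      intro e he
      obtain ⟨q, hq, b, rfl⟩ := hTmem e he
      have h1 := hτ2 q b hq
      have h2 := hτ3 q b hq
      simp only [Finset.mem_union, Finset.mem_filter, he, true_and, Finset.mem_biUnion,
        Finset.mem_univ]
      by_contra hcon
      push Not at hcon
      obtain ⟨⟨hc1, hc2⟩, hc3⟩ := hcon
      apply h2
      refine ⟨fun c => lt_of_le_of_ne (h1.1 c) (Ne.symm (hc3 c)), lt_of_le_of_ne h1.2 ?_⟩
      intro h
      simp only [a] at h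
      split_ifs at h
      · exact hc1 (by simpa using h.symm)
      · apply hc2
        simp only [ev]
        linarith
    refine (Finset.card_le_card hsub).trans ((Finset.card_union_le _ _).trans ?_)
    gcongr
    · exact Finset.card_union_le _ _
    · exact Finset.card_biUnion_le
  · intro e he
    have heT : e ∈ T := by
      rcases he with h | h | ⟨c, h⟩ <;> exact (Finset.mem_filter.1 h).1
    obtain ⟨q, hq, b, rfl⟩ := hTmem e heT
    refine ⟨hClΔ _ (hτ2 q b hq), ?_⟩
    intro u hu hu0 huQ
    have hd : ∀ r ∈ Icc 0 (τ q b), HasDerivAt (fun r => u (γ q (bs b * r))) 0 r := by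
      intro r hr
      have hm := hClΔ _ (hτ4 q b hq r hr)
      have h1 := hder u q (bs b * r) (hu.differentiableAt (hΔ.mem_nhds hm))
      rw [hu0 _ hm, mul_zero] at h1
      have h2 : HasDerivAt (fun t => bs b * t) (bs b) r := by
        simpa using (hasDerivAt_id r).const_mul (bs b)
      have h3 := h1.comp r h2
      rw [zero_mul] at h3
      exact h3
    have := constant_of_has_deriv_right_zero
      (fun r hr => (hd r hr).continuousAt.continuousWithinAt)
      (fun r hr => (hd r (Ico_subset_Icc_self hr)).hasDerivWithinAt) (τ q b)
      ⟨(hτ1 q b hq).le, le_rfl⟩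
    simp only [mul_zero, hγ0] at this
    simp only [ev]
    rw [this, huQ q hq]
  · intro e he
    obtain ⟨heT, hje⟩ := Finset.mem_filter.1 he
    obtain ⟨q, hq, b, rfl⟩ := hTmem e heT
    exact ⟨hje, hVne j hj q hq _ δ hje (fun h => hδN (Or.inl h))⟩
  · intro e he
    obtain ⟨heT, hje⟩ := Finset.mem_filter.1 he
    obtain ⟨q, hq, b, rfl⟩ := hTmem e heT
    refine ⟨hje, ?_⟩
    have := hVne (-j) hj.neg q hq _ δ (by
      show - j _ = δ
      simp only [ev] at hje
      rw [hje, neg_neg]) (fun h => hδN (Or.inr h))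
    rw [fderiv_neg] at this
    simpa using this
  · intro c e he
    obtain ⟨heT, hje⟩ := Finset.mem_filter.1 he
    obtain ⟨q, hq, b, rfl⟩ := hTmem e heT
    exact ⟨hje, hVne (ψ c) (hψ c) q hq _ (ε c) hje (hε3 c)⟩
  · intro hall
    rw [Finset.filter_eq_empty_iff]
    intro e heT hje
    obtain ⟨q, hq, b, rfl⟩ := hTmem e heT
    have h1 := hasign q b hq
    rw [hje] at h1
    simp only [a, if_pos (hall q hq)] at h1
    linarith

end Rolle


/-! ## Log-polynomial systems -/
set_option linter.unusedSectionVars false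
section LogPoly
open MvPolynomial

variable {σ ι : Type} [Fintype σ] [DecidableEq σ] [Fintype ι] [DecidableEq ι]

lemma fderiv_mvEval (p : MvPolynomial σ ℝ) (x : σ → ℝ) (k : σ) :
    fderiv ℝ (fun x : σ → ℝ => eval x p) x (Pi.single k 1) = eval x (pderiv k p) := by
  have hd : ∀ p : MvPolynomial σ ℝ, DifferentiableAt ℝ (fun x : σ → ℝ => eval x p) x := fun p =>
    (contDiff_mvEval p 1).differentiable (by norm_num) x
  induction p using MvPolynomial.induction_on with
  | C a => simp
  | add p q hp hq =>
    simp only [map_add]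
    rw [fderiv_fun_add (hd p) (hd q)]
    simp [hp, hq]
  | mul_X p i hp =>
    have h1 : (fun x : σ → ℝ => eval x (p * X i)) = fun x => eval x p * x i := by
      ext; simp
    have h2 : DifferentiableAt ℝ (fun x : σ → ℝ => x i) x := differentiableAt_apply i x
    rw [h1, fderiv_fun_mul (hd p) h2, pderiv_mul, pderiv_X]
    have h3 : fderiv ℝ (fun x : σ → ℝ => x i) x = ContinuousLinearMap.proj i :=
      (ContinuousLinearMap.proj (R := ℝ) (φ := fun _ : σ => ℝ) i).hasFDerivAt.fderiv
    simp only [add_apply, smul_apply, hp, h3, ContinuousLinearMap.proj_apply, smul_eq_mul, map_add, map_mul,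
      eval_X]
    by_cases h : i = k
    · subst h; simp; ring
    · simp [Pi.single_apply, h]; ring

lemma totalDegree_pderiv_le' (p : MvPolynomial σ ℝ) (k : σ) :
    (pderiv k p).totalDegree ≤ p.totalDegree - 1 := by
  conv_lhs => rw [p.as_sum, map_sum]
  refine (totalDegree_finsetSum _ _).trans (Finset.sup_le fun α hα => ?_)
  rw [pderiv_monomial]
  by_cases h : α k = 0
  · simp [h]
  · have h1 : (α - Finsupp.single k 1).degree + 1 = α.degree := by
      have : (α - Finsupp.single k 1) + Finsupp.single k 1 = α :=
        tsub_add_cancel_of_le (by simpa using Nat.one_le_iff_ne_zero.2 h)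
      conv_rhs => rw [← this]
      rw [map_add, Finsupp.degree_single]
    have h2 : (monomial (α - Finsupp.single k 1) (coeff α p * (α k : ℝ))).totalDegree ≤
        (α - Finsupp.single k 1).degree := by
      refine (totalDegree_monomial_le _ _).trans ?_
      rw [Finsupp.degree_eq_sum, Finsupp.sum_fintype _ _ (by simp)]
      exact le_rfl
    have h3 := le_totalDegree hα
    rw [Finsupp.sum_fintype _ _ (by simp), ← Finsupp.degree_eq_sum] at h3
    omega

lemma totalDegree_det_le (M : Matrix σ σ (MvPolynomial σ ℝ)) (r : σ → ℕ)
    (h : ∀ i k, (M i k).totalDegree ≤ r i) : M.det.totalDegree ≤ ∑ i, r i := by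
  rw [← Matrix.det_transpose, Matrix.det_apply]
  refine (totalDegree_finsetSum _ _).trans (Finset.sup_le fun τ _ => ?_)
  have : (Equiv.Perm.sign τ • ∏ i, M.transpose (τ i) i).totalDegree ≤
      (∏ i, M.transpose (τ i) i).totalDegree := by
    rcases Int.units_eq_one_or (Equiv.Perm.sign τ) with h | h <;> rw [h]
    · simp
    · simp
  refine this.trans ((totalDegree_finsetProd _ _).trans (Finset.sum_le_sum fun i _ => ?_))
  exact h i _

/-- the system: log forms for `i ∈ S`, polynomials otherwise. -/
noncomputable def lpSys (p : ι → MvPolynomial σ ℝ) (S : Finset σ) (v : σ → ι → ℝ) (κ : σ → ℝ)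
    (P : σ → MvPolynomial σ ℝ) (i : σ) (x : σ → ℝ) : ℝ :=
  if i ∈ S then ∑ j, v i j * Real.log (eval x (p j)) - κ i else eval x (P i)

/-- the chamber -/
def lpDom (p : ι → MvPolynomial σ ℝ) : Set (σ → ℝ) := {x | ∀ j, 0 < eval x (p j)}

lemma isOpen_lpDom (p : ι → MvPolynomial σ ℝ) : IsOpen (lpDom p) := by
  have : lpDom p = ⋂ j, {x | 0 < eval x (p j)} := by ext; simp [lpDom]
  rw [this]
  exact isOpen_iInter_of_finite fun j =>
    isOpen_lt continuous_const (contDiff_mvEval (p j) 0).continuous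

lemma contDiffOn_lpSys (p : ι → MvPolynomial σ ℝ) (S : Finset σ) (v : σ → ι → ℝ) (κ : σ → ℝ)
    (P : σ → MvPolynomial σ ℝ) (i : σ) : ContDiffOn ℝ 2 (lpSys p S v κ P i) (lpDom p) := by
  unfold lpSys
  split_ifs with h
  · refine ContDiffOn.sub (ContDiffOn.sum fun j _ => contDiffOn_const.mul ?_) contDiffOn_const
    exact (contDiff_mvEval (p j) 2).contDiffOn.log (fun x hx => (hx j).ne')
  · exact (contDiff_mvEval (P i) 2).contDiffOn

lemma jac_lpSys (p : ι → MvPolynomial σ ℝ) (S : Finset σ) (v : σ → ι → ℝ) (κ : σ → ℝ)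
    (P : σ → MvPolynomial σ ℝ) (x : σ → ℝ) (hx : x ∈ lpDom p) (i k : σ) :
    jac (lpSys p S v κ P) x i k = if i ∈ S then
      ∑ j, v i j * (eval x (pderiv k (p j)) / eval x (p j)) else eval x (pderiv k (P i)) := by
  simp only [jac, Matrix.of_apply]
  split_ifs with h
  · have h1 : lpSys p S v κ P i = fun x => ∑ j, v i j * Real.log (eval x (p j)) - κ i := by
      ext x; simp [lpSys, h]
    have h2 : ∀ j, HasFDerivAt (fun x => v i j * Real.log (eval x (p j)))
        (v i j • ((eval x (p j))⁻¹ • fderiv ℝ (fun x => eval x (p j)) x)) x := fun j =>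
      (((contDiff_mvEval (p j) 1).differentiable (by norm_num) x).hasFDerivAt.log
        (hx j).ne').const_mul (v i j)
    have h3 : HasFDerivAt (fun x => ∑ j, v i j * Real.log (eval x (p j)) - κ i)
        (∑ j, v i j • ((eval x (p j))⁻¹ • fderiv ℝ (fun x => eval x (p j)) x)) x :=
      (HasFDerivAt.fun_sum fun j _ => h2 j).sub_const _
    rw [h1, h3.fderiv, sum_apply]
    refine Finset.sum_congr rfl fun j _ => ?_
    simp only [smul_apply, smul_eq_mul]
    rw [fderiv_mvEval]
    ring
  · have h1 : lpSys p S v κ P i = fun x => eval x (P i) := by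
      ext x; simp [lpSys, h]
    rw [h1, fderiv_mvEval]

/-- `(∏ p_j) * det Jac` is a polynomial of controlled degree. -/
lemma exists_jacPoly (p : ι → MvPolynomial σ ℝ) (hp : ∀ j, (p j).totalDegree ≤ 1)
    (S : Finset σ) (v : σ → ι → ℝ) (κ : σ → ℝ)
    (P : σ → MvPolynomial σ ℝ) (d : σ → ℕ) (hd : ∀ i ∉ S, 1 ≤ d i)
    (hP : ∀ i ∉ S, (P i).totalDegree ≤ d i) (n : ℕ) (hn : Fintype.card ι = n + Fintype.card σ) :
    ∃ jj : MvPolynomial σ ℝ, jj.totalDegree ≤ n + ∑ i ∈ Sᶜ, d i ∧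
      ∀ x ∈ lpDom p, eval x jj = (∏ j, eval x (p j)) * (jac (lpSys p S v κ P) x).det := by
  let A : σ → Finset (Option ι) := fun i =>
    if i ∈ S then Finset.univ.image some else {none}
  let g : (σ → ℝ) → σ → Option ι → σ → ℝ := fun x i o k =>
    match o with
    | none => eval x (pderiv k (P i))
    | some j => v i j * (eval x (pderiv k (p j)) / eval x (p j))
  have hexp : ∀ x ∈ lpDom p, (jac (lpSys p S v κ P) x).det =
      ∑ φ ∈ Fintype.piFinset A, Matrix.det (Matrix.of fun i => g x i (φ i)) := by
    intro x hx
    have h1 : (jac (lpSys p S v κ P) x) = Matrix.of fun i => ∑ o ∈ A i, g x i o := by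
      ext i k
      rw [jac_lpSys p S v κ P x hx, Matrix.of_apply, Finset.sum_apply]
      simp only [A]
      split_ifs with h
      · rw [Finset.sum_image (fun a _ b _ hab => Option.some_injective _ hab)]
      · simp [g]
    rw [h1]
    exact (Matrix.detRowAlternating (R := ℝ) (n := σ)).toMultilinearMap.map_sum_finset (g x) A
  have hterm : ∀ φ ∈ Fintype.piFinset A, ∃ jj : MvPolynomial σ ℝ,
      jj.totalDegree ≤ n + ∑ i ∈ Sᶜ, d i ∧
      ∀ x ∈ lpDom p, eval x jj = (∏ j, eval x (p j)) * Matrix.det (Matrix.of fun i => g x i (φ i)) := by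
    intro φ hφ
    rw [Fintype.mem_piFinset] at hφ
    have hφS : ∀ i ∈ S, ∃ j, φ i = some j := by
      intro i hi
      have := hφ i
      simp only [A, if_pos hi, Finset.mem_image, Finset.mem_univ, true_and] at this
      obtain ⟨j, hj⟩ := this
      exact ⟨j, hj.symm⟩
    have hφN : ∀ i ∉ S, φ i = none := by
      intro i hi
      have := hφ i
      simpa only [A, if_neg hi, Finset.mem_singleton] using this
    by_cases hinj : Set.InjOn φ S
    · -- injective case
      let M : Matrix σ σ (MvPolynomial σ ℝ) := Matrix.of fun i k =>
        match φ i with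
        | none => pderiv k (P i)
        | some j => pderiv k (p j)
      let I : Finset ι := Finset.univ.filter fun j => some j ∈ S.image φ
      have hIcard : I.card = S.card := by
        rw [← Finset.card_image_of_injOn hinj]
        rw [← Finset.card_image_of_injective I (Option.some_injective ι)]
        congr 1
        ext o
        simp only [I, Finset.mem_image, Finset.mem_filter, Finset.mem_univ, true_and]
        constructor
        · rintro ⟨j, hj, rfl⟩; exact hj
        · rintro ⟨i, hi, rfl⟩
          obtain ⟨j, hj⟩ := hφS i hi
          exact ⟨j, ⟨i, hi, hj⟩, hj.symm⟩
      let w : σ → ℝ := fun i => match φ i with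
        | none => 1
        | some j => v i j
      refine ⟨C (∏ i, w i) * (∏ j ∈ Iᶜ, p j) * M.det, ?_, ?_⟩
      · have h1 : (∏ j ∈ Iᶜ, p j).totalDegree ≤ Fintype.card ι - S.card := by
          refine (totalDegree_finsetProd _ _).trans ?_
          refine (Finset.sum_le_card_nsmul _ _ 1 fun j _ => hp j).trans ?_
          rw [Finset.card_compl, hIcard]; simp
        have h2 : M.det.totalDegree ≤ ∑ i, (if i ∈ S then 0 else d i - 1) := by
          apply totalDegree_det_le
          intro i k
          simp only [M, Matrix.of_apply]
          split_ifs with h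
          · obtain ⟨j, hj⟩ := hφS i h
            rw [hj]
            have := totalDegree_pderiv_le' (p j) k
            have := hp j
            simp only []
            omega
          · rw [hφN i h]
            have := totalDegree_pderiv_le' (P i) k
            have := hP i h
            simp only []
            omega
        have h3 : ∑ i, (if i ∈ S then 0 else d i - 1) + (Fintype.card σ - S.card) =
            ∑ i ∈ Sᶜ, d i := by
          rw [← Finset.card_compl, Finset.card_eq_sum_ones]
          have : ∑ i, (if i ∈ S then 0 else d i - 1) = ∑ i ∈ Sᶜ, (d i - 1) := by
            rw [← Finset.sum_filter_add_sum_filter_not Finset.univ (· ∈ S)]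
            rw [Finset.sum_eq_zero (fun i hi => if_pos (Finset.mem_filter.1 hi).2), zero_add]
            have : Finset.univ.filter (fun i => i ∉ S) = Sᶜ := by ext; simp
            rw [this]
            exact Finset.sum_congr rfl fun i hi => if_neg (Finset.mem_compl.1 hi)
          rw [this, ← Finset.sum_add_distrib]
          refine Finset.sum_congr rfl fun i hi => ?_
          have := hd i (Finset.mem_compl.1 hi)
          omega
        have h4 : S.card ≤ Fintype.card σ := Finset.card_le_univ S
        refine (totalDegree_mul _ _).trans ?_
        have h5 : (C (∏ i, w i) * (∏ j ∈ Iᶜ, p j)).totalDegree ≤ Fintype.card ι - S.card := by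
          refine (totalDegree_mul _ _).trans ?_
          rw [totalDegree_C, zero_add]; exact h1
        omega
      · intro x hx
        let s : σ → ℝ := fun i => match φ i with
          | none => 1
          | some j => (eval x (p j))⁻¹
        have hM : Matrix.of (fun i => g x i (φ i)) =
            Matrix.of fun i k => (w i * s i) * ((eval x).mapMatrix M) i k := by
          ext i k
          simp only [Matrix.of_apply, g, w, s, M, RingHom.mapMatrix_apply, Matrix.map_apply]
          cases φ i <;> simp
          ring
        rw [hM, Matrix.det_mul_column, ← RingHom.map_det, map_mul, map_mul, eval_C, map_prod,
          Finset.prod_mul_distrib]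
        have hs : (∏ j ∈ I, eval x (p j)) * ∏ i, s i = 1 := by
          have e1 : ∏ i, s i = ∏ i ∈ S, s i := by
            symm
            apply Finset.prod_subset (Finset.subset_univ _)
            intro i _ hi
            simp only [s, hφN i hi]
          have e2 : ∏ j ∈ I, eval x (p j) = ∏ i ∈ S, (s i)⁻¹ := by
            symm
            refine Finset.prod_bij' (fun i hi => (hφS i hi).choose)
              (fun j hj => (Finset.mem_image.1 (Finset.mem_filter.1 hj).2).choose) ?_ ?_ ?_ ?_ ?_
            · intro i hi
              simp only [I, Finset.mem_filter, Finset.mem_univ, true_and, Finset.mem_image]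
              exact ⟨i, hi, (hφS i hi).choose_spec⟩
            · intro j hj
              exact (Finset.mem_image.1 (Finset.mem_filter.1 hj).2).choose_spec.1
            · intro i hi
              have hj : (hφS i hi).choose ∈ I := by
                simp only [I, Finset.mem_filter, Finset.mem_univ, true_and, Finset.mem_image]
                exact ⟨i, hi, (hφS i hi).choose_spec⟩
              have := (Finset.mem_image.1 (Finset.mem_filter.1 hj).2).choose_spec
              apply hinj this.1 hi
              exact this.2.trans (hφS i hi).choose_spec.symm
            · intro j hj
              have h := (Finset.mem_image.1 (Finset.mem_filter.1 hj).2).choose_spec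
              have h' := (hφS _ h.1).choose_spec
              exact Option.some_injective _ (h'.symm.trans h.2)
            · intro i hi
              have := (hφS i hi).choose_spec
              generalize (hφS i hi).choose = j0 at this
              simp only [s, this, inv_inv]
          rw [e1, e2, ← Finset.prod_mul_distrib]
          apply Finset.prod_eq_one
          intro i hi
          apply inv_mul_cancel₀
          obtain ⟨j, hj⟩ := hφS i hi
          simp only [s, hj]
          exact inv_ne_zero (hx j).ne'
        rw [← Finset.prod_mul_prod_compl I (fun j => eval x (p j))]
        linear_combination (-(∏ i, w i) * (∏ j ∈ Iᶜ, eval x (p j)) * eval x M.det) * hs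
    · refine ⟨0, by simp, ?_⟩
      intro x hx
      simp only [Set.InjOn, not_forall] at hinj
      obtain ⟨i, hi, i', hi', he, hne⟩ := hinj
      obtain ⟨j, hj⟩ := hφS i hi
      rw [map_zero]
      symm
      apply mul_eq_zero_of_right
      let B : Matrix σ σ ℝ := Matrix.of fun l => if l = i ∨ l = i' then
        (fun k => eval x (pderiv k (p j)) / eval x (p j)) else g x l (φ l)
      have : Matrix.of (fun l => g x l (φ l)) =
          Matrix.of fun l k => (if l = i ∨ l = i' then v l j else 1) * B l k := by
        ext l k
        simp only [Matrix.of_apply, B]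
        by_cases h : l = i ∨ l = i'
        · simp only [h, if_true]
          have : φ l = some j := by
            rcases h with h | h
            · rw [h, hj]
            · rw [h, ← he, hj]
          rw [this]
        · simp [h]
      rw [this, Matrix.det_mul_column]
      apply mul_eq_zero_of_right
      apply Matrix.det_zero_of_row_eq hne
      ext k
      simp [B]
  choose! t ht1 ht2 using hterm
  refine ⟨∑ φ ∈ Fintype.piFinset A, t φ, ?_, ?_⟩
  · refine (totalDegree_finsetSum _ _).trans (Finset.sup_le fun φ hφ => ht1 φ hφ)
  · intro x hx
    rw [map_sum, hexp x hx, Finset.mul_sum]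
    exact Finset.sum_congr rfl fun φ hφ => ht2 φ hφ x hx

end LogPoly


/-! ## The Khovanskii recursion -/
set_option linter.unusedSectionVars false
section Recursion
open MvPolynomial

variable {σ ι : Type} [Fintype σ] [DecidableEq σ] [Fintype ι] [DecidableEq ι]

/-- the field tangent to all levels except the `i0`-th. -/
noncomputable def tanV (G : σ → (σ → ℝ) → ℝ) (i0 : σ) (x : σ → ℝ) : σ → ℝ :=
  fun k => (jac G x).adjugate k i0

lemma jac_update (G : σ → (σ → ℝ) → ℝ) (i0 : σ) (u : (σ → ℝ) → ℝ) (x : σ → ℝ) :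
    jac (Function.update G i0 u) x =
      (jac G x).updateRow i0 (fun k => fderiv ℝ u x (Pi.single k 1)) := by
  ext i k
  by_cases h : i = i0
  · subst h; simp [jac]
  · simp [jac, h]

lemma fderiv_tanV (G : σ → (σ → ℝ) → ℝ) (i0 : σ) (u : (σ → ℝ) → ℝ) (x : σ → ℝ) :
    fderiv ℝ u x (tanV G i0 x) = (jac (Function.update G i0 u) x).det := by
  set g : σ → ℝ := fun k => fderiv ℝ u x (Pi.single k 1) with hg
  rw [jac_update]
  have h1 : fderiv ℝ u x (tanV G i0 x) = ∑ k, g k * tanV G i0 x k := by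
    conv_lhs => rw [pi_eq_sum_univ' (tanV G i0 x)]
    rw [map_sum]
    refine Finset.sum_congr rfl fun k _ => ?_
    rw [map_smul, smul_eq_mul, mul_comm]
  have h2 := congrFun (congrFun (Matrix.mul_adjugate ((jac G x).updateRow i0 g)) i0) i0
  rw [Matrix.mul_apply] at h2
  simp only [Matrix.smul_apply, Matrix.one_apply_eq, smul_eq_mul, mul_one] at h2
  rw [← h2, h1]
  refine Finset.sum_congr rfl fun k _ => ?_
  rw [Matrix.updateRow_self, Matrix.adjugate_apply, Matrix.updateRow_idem, tanV,
    Matrix.adjugate_apply]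

lemma fderiv_tanV_self (G : σ → (σ → ℝ) → ℝ) (i0 : σ) (x : σ → ℝ) :
    fderiv ℝ (G i0) x (tanV G i0 x) = (jac G x).det := by
  rw [fderiv_tanV, Function.update_eq_self]

lemma fderiv_tanV_ne (G : σ → (σ → ℝ) → ℝ) (i0 i : σ) (h : i ≠ i0) (x : σ → ℝ) :
    fderiv ℝ (G i) x (tanV G i0 x) = 0 := by
  rw [fderiv_tanV]
  apply Matrix.det_zero_of_row_eq h
  ext k
  simp [jac, h]

lemma contDiffOn_jac_det {Δ : Set (σ → ℝ)} (M : (σ → ℝ) → Matrix σ σ ℝ)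
    (h : ∀ i k, ContDiffOn ℝ 1 (fun x => M x i k) Δ) : ContDiffOn ℝ 1 (fun x => (M x).det) Δ := by
  simp only [Matrix.det_apply]
  refine ContDiffOn.sum fun τ _ => ?_
  have : ContDiffOn ℝ 1 (fun x => ∏ i, M x (τ i) i) Δ := contDiffOn_prod fun i _ => h _ _
  simp only [Units.smul_def, zsmul_eq_mul]
  exact contDiffOn_const.mul this

lemma contDiffOn_jac (G : σ → (σ → ℝ) → ℝ) {Δ : Set (σ → ℝ)} (hΔ : IsOpen Δ)
    (hG : ∀ i, ContDiffOn ℝ 2 (G i) Δ) (i k : σ) : ContDiffOn ℝ 1 (fun x => jac G x i k) Δ := by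
  have h := (hG i).fderiv_of_isOpen (m := 1) hΔ (by norm_num)
  exact h.clm_apply contDiffOn_const

lemma contDiffOn_tanV (G : σ → (σ → ℝ) → ℝ) {Δ : Set (σ → ℝ)} (hΔ : IsOpen Δ)
    (hG : ∀ i, ContDiffOn ℝ 2 (G i) Δ) (i0 : σ) : ContDiffOn ℝ 1 (tanV G i0) Δ := by
  rw [contDiffOn_pi]
  intro k
  simp only [tanV, Matrix.adjugate_apply]
  apply contDiffOn_jac_det
  intro i kk
  by_cases h : i = i0
  · subst h; simp only [Matrix.updateRow_self]; exact contDiffOn_const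
  · simp only [Matrix.updateRow_ne h]; exact contDiffOn_jac G hΔ hG i kk

/-- nondegenerate zeros in the chamber -/
def NDZ (p : ι → MvPolynomial σ ℝ) (S : Finset σ) (v : σ → ι → ℝ) (κ : σ → ℝ)
    (P : σ → MvPolynomial σ ℝ) (x : σ → ℝ) : Prop :=
  x ∈ lpDom p ∧ (∀ i, lpSys p S v κ P i x = 0) ∧ (jac (lpSys p S v κ P) x).det ≠ 0

lemma lpSys_update (p : ι → MvPolynomial σ ℝ) (S : Finset σ) (v : σ → ι → ℝ) (κ : σ → ℝ)
    (P : σ → MvPolynomial σ ℝ) (i0 : σ) (q : MvPolynomial σ ℝ) :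
    lpSys p (S.erase i0) v κ (Function.update P i0 q) =
      Function.update (lpSys p S v κ P) i0 (fun x => eval x q) := by
  ext i x
  by_cases h : i = i0
  · subst h; simp [lpSys]
  · simp [lpSys, h]

lemma exists_pos_lt {α : Type*} (Q : Finset α) (f : α → ℝ) (h : ∀ q ∈ Q, 0 < f q) :
    ∃ ε > 0, ∀ q ∈ Q, ε < f q := by
  classical
  induction Q using Finset.induction_on with
  | empty => exact ⟨1, one_pos, by simp⟩
  | insert a s ha ih =>
    obtain ⟨ε, he, hs⟩ := ih fun q hq => h q (Finset.mem_insert_of_mem hq)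
    have ha := h a (Finset.mem_insert_self _ _)
    refine ⟨min ε (f a / 2), by positivity, fun q hq => ?_⟩
    rcases Finset.mem_insert.1 hq with rfl | hq
    · exact (min_le_right _ _).trans_lt (by linarith)
    · exact (min_le_left _ _).trans_lt (hs q hq)

lemma lp_step (p : ι → MvPolynomial σ ℝ) (hp : ∀ j, (p j).totalDegree ≤ 1)
    (hprop : ∀ R : ℝ, Bornology.IsBounded
      {x : σ → ℝ | (∀ j, 0 ≤ eval x (p j)) ∧ ∑ j, eval x (p j) ≤ R})
    (S : Finset σ) (v : σ → ι → ℝ) (κ : σ → ℝ)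
    (P : σ → MvPolynomial σ ℝ) (d : σ → ℕ) (hd : ∀ i ∉ S, 1 ≤ d i)
    (hP : ∀ i ∉ S, (P i).totalDegree ≤ d i) (n : ℕ) (hn : Fintype.card ι = n + Fintype.card σ)
    (i0 : σ) (hi0 : i0 ∈ S) (Q : Finset (σ → ℝ)) (hQ : ∀ q ∈ Q, NDZ p S v κ P q) :
    ∃ (jp jm : MvPolynomial σ ℝ) (w : Option ι → MvPolynomial σ ℝ)
      (Ap Am : Finset (σ → ℝ)) (B : Option ι → Finset (σ → ℝ)),
      jp.totalDegree ≤ n + ∑ i ∈ Sᶜ, d i ∧ jm.totalDegree ≤ n + ∑ i ∈ Sᶜ, d i ∧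
      (∀ c, (w c).totalDegree ≤ 1) ∧
      2 * Q.card ≤ Ap.card + Am.card + ∑ c, (B c).card ∧
      (∀ e ∈ Ap, NDZ p (S.erase i0) v κ (Function.update P i0 jp) e) ∧
      (∀ e ∈ Am, NDZ p (S.erase i0) v κ (Function.update P i0 jm) e) ∧
      (∀ c, ∀ e ∈ B c, NDZ p (S.erase i0) v κ (Function.update P i0 (w c)) e) ∧
      ((∀ q ∈ Q, 0 < (jac (lpSys p S v κ P) q).det) → Am = ∅) := by
  set G := lpSys p S v κ P with hG
  obtain ⟨jj, hjd, hjj⟩ := exists_jacPoly p hp S v κ P d hd hP n hn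
  have hΔ := isOpen_lpDom p
  have hGC : ∀ i, ContDiffOn ℝ 2 (G i) (lpDom p) := contDiffOn_lpSys p S v κ P
  let ψp : Option ι → MvPolynomial σ ℝ := fun c => match c with
    | none => -∑ j, p j
    | some j => p j
  let ψ : Option ι → (σ → ℝ) → ℝ := fun c x => eval x (ψp c)
  have hψd : ∀ c, (ψp c).totalDegree ≤ 1 := by
    intro c
    cases c with
    | none => 
      simp only [ψp]
      rw [totalDegree_neg]
      exact (totalDegree_finsetSum _ _).trans (Finset.sup_le fun j _ => hp j)
    | some j => exact hp j
  have hdiff : ∀ q : MvPolynomial σ ℝ, Differentiable ℝ (fun x : σ → ℝ => eval x q) := fun q =>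
    (contDiff_mvEval q 1).differentiable (by norm_num)
  have hε : ∀ j, ∃ ε > 0, ∀ q ∈ Q, ε < eval q (p j) := fun j =>
    exists_pos_lt Q _ fun q hq => (hQ q hq).1 j
  choose ε hε0 hε1 using hε
  obtain ⟨R, hR⟩ : ∃ R : ℝ, ∀ q ∈ Q, R < -∑ j, eval q (p j) := by
    obtain ⟨R, hR⟩ := (Q.image fun q => -∑ j, eval q (p j)).bddBelow
    refine ⟨R - 1, fun q hq => ?_⟩
    have := hR (Finset.mem_coe.2 (Finset.mem_image_of_mem (fun q => -∑ j, eval q (p j)) hq))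
    linarith
  let hi : Option ι → ℝ := fun c => match c with
    | none => R
    | some j => ε j
  let lo : Option ι → ℝ := fun c => match c with
    | none => R - 1
    | some j => ε j / 2
  have hlh : ∀ c, lo c < hi c := by
    intro c
    cases c with
    | none => simp [lo, hi]
    | some j => simp only [lo, hi]; linarith [hε0 j]
  have hKΔ : {x : σ → ℝ | ∀ c, lo c ≤ ψ c x} ⊆ lpDom p := by
    intro x hx j
    have := hx (some j)
    simp only [lo, ψ, ψp] at this
    linarith [hε0 j]
  have hK : IsCompact {x : σ → ℝ | ∀ c, lo c ≤ ψ c x} := by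
    apply Metric.isCompact_of_isClosed_isBounded
    · have : {x : σ → ℝ | ∀ c, lo c ≤ ψ c x} = ⋂ c, {x | lo c ≤ ψ c x} := by ext; simp
      rw [this]
      exact isClosed_iInter fun c => isClosed_le continuous_const (hdiff _).continuous
    · refine (hprop (1 - R)).subset fun x hx => ⟨fun j => (hKΔ hx j).le, ?_⟩
      have := hx none
      simp only [lo, ψ, ψp, map_neg, map_sum] at this
      linarith
  obtain ⟨δ, ε', Ap, Am, B, hδ, hcard, hz, hAp, hAm, hB, hpos⟩ := rolle_main (κ := Option ι)
    (lpDom p) hΔ (tanV G i0) (contDiffOn_tanV G hΔ hGC i0) (G i0) (fun x => (jac G x).det)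
    (fun x => eval x jj) ((hGC i0).differentiableOn (by norm_num))
    (contDiffOn_jac_det (jac G) (contDiffOn_jac G hΔ hGC)).continuousOn
    (fun x _ => fderiv_tanV_self G i0 x) (hdiff jj)
    (fun x hx => ⟨∏ j, eval x (p j), Finset.prod_pos fun j _ => hx j, hjj x hx⟩)
    ψ (fun c => hdiff _) lo hi hlh hK hKΔ Q
    (by
      intro q hq c
      cases c with
      | none => simpa [hi, ψ, ψp] using hR q hq
      | some j => exact hε1 j q hq)
    (fun q hq => (hQ q hq).2.1 i0) (fun q hq => (hQ q hq).2.2)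
  have key : ∀ (r : MvPolynomial σ ℝ) (t : ℝ) (e : σ → ℝ), 
      (e ∈ Ap ∨ e ∈ Am ∨ ∃ c, e ∈ B c) → eval e r = t → 
      fderiv ℝ (fun x => eval x r) e (tanV G i0 e) ≠ 0 → 
      NDZ p (S.erase i0) v κ (Function.update P i0 (r - C t)) e := by
    intro r t e he hr hne
    obtain ⟨h1, h2⟩ := hz e he
    refine ⟨h1, ?_, ?_⟩
    · rw [lpSys_update]
      intro i
      by_cases h : i = i0
      · subst h; simp [hr]
      · rw [Function.update_of_ne h]
        exact h2 (G i) ((hGC i).differentiableOn (by norm_num))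
          (fun x _ => fderiv_tanV_ne G i0 i h x) (fun q hq => (hQ q hq).2.1 i)
    · rw [lpSys_update, ← hG, ← fderiv_tanV]
      have : (fun x : σ → ℝ => eval x (r - C t)) = fun x => eval x r - t := by
        ext; simp
      rw [this, fderiv_sub_const]
      exact hne
  refine ⟨jj - C δ, jj - C (-δ), fun c => ψp c - C (ε' c), Ap, Am, B, ?_, ?_, ?_, hcard, ?_, ?_, ?_, hpos⟩
  · exact (totalDegree_sub_C_le _ _).trans hjd
  · exact (totalDegree_sub_C_le _ _).trans hjd
  · exact fun c => (totalDegree_sub_C_le _ _).trans (hψd c)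
  · exact fun e he => key jj δ e (Or.inl he) (hAp e he).1 (hAp e he).2
  · exact fun e he => key jj (-δ) e (Or.inr (Or.inl he)) (hAm e he).1 (hAm e he).2
  · exact fun c e he => key (ψp c) (ε' c) e (Or.inr (Or.inr ⟨c, he⟩)) (hB c e he).1 (hB c e he).2

/-- the recursive bound -/
noncomputable def rr (N' : ℕ) : ℕ → ℕ → ℝ
  | 0, _ => 1
  | m + 1, s => s * rr N' m (2 * s) + (N' / 2 : ℝ) * rr N' m (s + 1)

lemma count_bound (p : ι → MvPolynomial σ ℝ) (hp : ∀ j, (p j).totalDegree ≤ 1)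
    (hprop : ∀ R : ℝ, Bornology.IsBounded
      {x : σ → ℝ | (∀ j, 0 ≤ eval x (p j)) ∧ ∑ j, eval x (p j) ≤ R})
    (v : σ → ι → ℝ) (κ : σ → ℝ) (n : ℕ) (hn1 : 1 ≤ n)
    (hn : Fintype.card ι = n + Fintype.card σ) (m : ℕ) :
    ∀ (S : Finset σ) (_ : S.card = m) (P : σ → MvPolynomial σ ℝ) (d : σ → ℕ)
    (_ : ∀ i ∉ S, 1 ≤ d i) (_ : ∀ i ∉ S, (P i).totalDegree ≤ d i)
    (Q : Finset (σ → ℝ)) (_ : ∀ q ∈ Q, NDZ p S v κ P q),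
    (Q.card : ℝ) ≤ (∏ i ∈ Sᶜ, (d i : ℝ)) * rr (Fintype.card ι + 1) m (n + ∑ i ∈ Sᶜ, d i) := by
  induction m with
  | zero =>
    intro S hS P d hd hP Q hQ
    rw [Finset.card_eq_zero] at hS
    subst hS
    have : ∀ i x, lpSys p ∅ v κ P i x = eval x (P i) := by simp [lpSys]
    have h2 : lpSys p ∅ v κ P = fun i x => eval x (P i) := by ext i x; simp [lpSys]
    have := bezout_real P d (by simpa using hP) Q
      (fun x hx i => by rw [← this]; exact (hQ x hx).2.1 i)
      (fun x hx => by rw [← h2]; exact (hQ x hx).2.2)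
    simp only [rr, mul_one, Finset.compl_empty]
    exact_mod_cast this
  | succ m ih =>
    intro S hS P d hd hP Q hQ
    obtain ⟨i0, hi0⟩ : S.Nonempty := Finset.card_pos.1 (by omega)
    obtain ⟨jp, jm, w, Ap, Am, B, hjp, hjm, hw, hc, hAp, hAm, hB, -⟩ :=
      lp_step p hp hprop S v κ P d hd hP n hn i0 hi0 Q hQ
    have hcard : (S.erase i0).card = m := by rw [Finset.card_erase_of_mem hi0]; omega
    set s := n + ∑ i ∈ Sᶜ, d i with hs
    have hcomp : (S.erase i0)ᶜ = insert i0 Sᶜ := by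
      ext i; simp only [Finset.mem_compl, Finset.mem_erase, Finset.mem_insert]; tauto
    have hni : i0 ∉ Sᶜ := by simpa using hi0
    have key : ∀ (q : MvPolynomial σ ℝ) (e : ℕ) (_ : 1 ≤ e) (_ : q.totalDegree ≤ e)
        (T : Finset (σ → ℝ)) (_ : ∀ x ∈ T, NDZ p (S.erase i0) v κ (Function.update P i0 q) x),
        (T.card : ℝ) ≤ (∏ i ∈ Sᶜ, (d i : ℝ)) * (e * rr (Fintype.card ι + 1) m (s + e)) := by
      intro q e he hq T hT
      have := ih (S.erase i0) hcard (Function.update P i0 q) (Function.update d i0 e) ?_ ?_ T hT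
      · rw [hcomp, Finset.prod_insert hni, Finset.sum_insert hni] at this
        rw [Function.update_self] at this
        have e1 : ∏ x ∈ Sᶜ, ((Function.update d i0 e x : ℕ) : ℝ) = ∏ i ∈ Sᶜ, (d i : ℝ) := by
          refine Finset.prod_congr rfl fun i hi => ?_
          rw [Function.update_of_ne (ne_of_mem_of_not_mem hi hni)]
        have e2 : ∑ x ∈ Sᶜ, Function.update d i0 e x = ∑ i ∈ Sᶜ, d i := by
          refine Finset.sum_congr rfl fun i hi => ?_
          rw [Function.update_of_ne (ne_of_mem_of_not_mem hi hni)]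
        rw [e1, e2] at this
        have e3 : n + (e + ∑ i ∈ Sᶜ, d i) = s + e := by omega
        rw [e3] at this
        linarith
      · intro i hi
        by_cases h : i = i0
        · subst h; simpa using he
        · rw [Function.update_of_ne h]; exact hd i (by simpa [h] using hi)
      · intro i hi
        by_cases h : i = i0
        · subst h; simpa using hq
        · rw [Function.update_of_ne h, Function.update_of_ne h]; exact hP i (by simpa [h] using hi)
    have k1 := key jp s (by omega) hjp Ap hAp
    have k2 := key jm s (by omega) hjm Am hAm
    have k3 : ∀ c, ((B c).card : ℝ) ≤ (∏ i ∈ Sᶜ, (d i : ℝ)) * (1 * rr (Fintype.card ι + 1) m (s + 1)) :=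
      fun c => by simpa using key (w c) 1 le_rfl (hw c) (B c) (hB c)
    have k4 := Finset.sum_le_card_nsmul (Finset.univ : Finset (Option ι)) _ _ fun c _ => k3 c
    rw [nsmul_eq_mul, Finset.card_univ, Fintype.card_option] at k4
    have hc' : (2 : ℝ) * Q.card ≤ Ap.card + Am.card + ∑ c, ((B c).card : ℝ) := by exact_mod_cast hc
    simp only [rr]
    rw [← two_mul] at k1 k2
    push_cast at k4 ⊢
    nlinarith [k1, k2, k4, hc']

/-- signed bound for a pure log system. -/
lemma count_bound_signed (p : ι → MvPolynomial σ ℝ) (hp : ∀ j, (p j).totalDegree ≤ 1)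
    (hprop : ∀ R : ℝ, Bornology.IsBounded
      {x : σ → ℝ | (∀ j, 0 ≤ eval x (p j)) ∧ ∑ j, eval x (p j) ≤ R})
    (v : σ → ι → ℝ) (κ : σ → ℝ) (n : ℕ) (hn1 : 1 ≤ n)
    (hn : Fintype.card ι = n + Fintype.card σ) (m : ℕ) (hm : Fintype.card σ = m + 1)
    (Q : Finset (σ → ℝ)) (hQ : ∀ q ∈ Q, q ∈ lpDom p ∧
      (∀ i, ∑ j, v i j * Real.log (eval q (p j)) - κ i = 0) ∧
      0 < (jac (fun i x => ∑ j, v i j * Real.log (eval x (p j)) - κ i) q).det) :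
    2 * (Q.card : ℝ) ≤ n * rr (Fintype.card ι + 1) m (2 * n) +
      (Fintype.card ι + 1) * rr (Fintype.card ι + 1) m (n + 1) := by
  have hsys : lpSys p Finset.univ v κ 0 = (fun i x => ∑ j, v i j * Real.log (eval x (p j)) - κ i) := by
    ext; simp [lpSys]
  have hpos : 0 < Fintype.card σ := by omega
  obtain ⟨i0⟩ := Fintype.card_pos_iff.1 hpos
  obtain ⟨jp, jm, w, Ap, Am, B, hjp, hjm, hw, hc, hAp, hAm, hB, he⟩ :=
    lp_step p hp hprop Finset.univ v κ 0 (fun _ => 1) (by simp) (by simp) n hn i0 (Finset.mem_univ _) Q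
      (fun q hq => ⟨(hQ q hq).1, by rw [hsys]; exact (hQ q hq).2.1, by
        rw [hsys]; exact (hQ q hq).2.2.ne'⟩)
  rw [he (by rw [hsys]; exact fun q hq => (hQ q hq).2.2)] at hc
  have hcomp : (Finset.univ.erase i0)ᶜ = {i0} := by ext; simp
  have key : ∀ (q : MvPolynomial σ ℝ) (e : ℕ) (_ : 1 ≤ e) (_ : q.totalDegree ≤ e)
      (T : Finset (σ → ℝ)) (_ : ∀ x ∈ T, NDZ p (Finset.univ.erase i0) v κ (Function.update 0 i0 q) x),
      (T.card : ℝ) ≤ e * rr (Fintype.card ι + 1) m (n + e) := by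
    intro q e he hq T hT
    have := count_bound p hp hprop v κ n hn1 hn m (Finset.univ.erase i0)
      (by rw [Finset.card_erase_of_mem (Finset.mem_univ _), Finset.card_univ]; omega)
      (Function.update 0 i0 q) (fun _ => e) (fun _ _ => he) ?_ T hT
    · simpa [hcomp] using this
    · intro i hi
      have : i = i0 := by simpa using hi
      subst this
      simpa using hq
  simp only [Finset.compl_univ, Finset.sum_empty, add_zero] at hjp
  have k1 := key jp n hn1 hjp Ap hAp
  have k3 : ∀ c, ((B c).card : ℝ) ≤ (1 * rr (Fintype.card ι + 1) m (n + 1)) :=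
      fun c => by simpa using key (w c) 1 le_rfl (hw c) (B c) (hB c)
  have k4 := Finset.sum_le_card_nsmul (Finset.univ : Finset (Option ι)) _ _ fun c _ => k3 c
  rw [nsmul_eq_mul, Finset.card_univ, Fintype.card_option] at k4
  have hc' : (2 : ℝ) * Q.card ≤ Ap.card + ∑ c, ((B c).card : ℝ) := by
    rw [Finset.card_empty] at hc; exact_mod_cast hc
  rw [← two_mul] at k1
  push_cast at k4
  linarith

end Recursion


/-! ## Gale duality -/
set_option linter.unusedSectionVars false
section Gale
open MvPolynomial Matrix

/-- both signs -/
lemma count_bound_signed' {σ ι : Type} [Fintype σ] [DecidableEq σ] [Fintype ι] [DecidableEq ι]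
    (p : ι → MvPolynomial σ ℝ) (hp : ∀ j, (p j).totalDegree ≤ 1)
    (hprop : ∀ R : ℝ, Bornology.IsBounded
      {x : σ → ℝ | (∀ j, 0 ≤ eval x (p j)) ∧ ∑ j, eval x (p j) ≤ R})
    (v : σ → ι → ℝ) (κ : σ → ℝ) (n : ℕ) (hn1 : 1 ≤ n)
    (hn : Fintype.card ι = n + Fintype.card σ) (m : ℕ) (hm : Fintype.card σ = m + 1)
    (E : ℝ) (Q : Finset (σ → ℝ)) (hQ : ∀ q ∈ Q, q ∈ lpDom p ∧
      (∀ i, ∑ j, v i j * Real.log (eval q (p j)) - κ i = 0) ∧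
      0 < E * (jac (fun i x => ∑ j, v i j * Real.log (eval x (p j)) - κ i) q).det) :
    2 * (Q.card : ℝ) ≤ n * rr (Fintype.card ι + 1) m (2 * n) +
      (Fintype.card ι + 1) * rr (Fintype.card ι + 1) m (n + 1) := by
  have hpos : 0 < Fintype.card σ := by omega
  obtain ⟨i0⟩ := Fintype.card_pos_iff.1 hpos
  have hsys : ∀ (v : σ → ι → ℝ) (κ : σ → ℝ), lpSys p Finset.univ v κ 0 =
      (fun i x => ∑ j, v i j * Real.log (eval x (p j)) - κ i) := by
    intros; ext; simp [lpSys]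
  apply count_bound_signed p hp hprop (fun i j => (if i = i0 then E else 1) * v i j)
    (fun i => (if i = i0 then E else 1) * κ i) n hn1 hn m hm Q
  intro q hq
  obtain ⟨h1, h2, h3⟩ := hQ q hq
  refine ⟨h1, fun i => ?_, ?_⟩
  · have : ∑ j, (if i = i0 then E else 1) * v i j * Real.log (eval q (p j)) -
        (if i = i0 then E else 1) * κ i =
        (if i = i0 then E else 1) * (∑ j, v i j * Real.log (eval q (p j)) - κ i) := by
      rw [mul_sub, Finset.mul_sum]; simp only [mul_assoc]
    rw [this, h2 i, mul_zero]
  · rw [← hsys] at h3 ⊢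
    have : jac (lpSys p Finset.univ (fun i j => (if i = i0 then E else 1) * v i j)
        (fun i => (if i = i0 then E else 1) * κ i) 0) q =
        Matrix.of fun i k => (if i = i0 then E else 1) * jac (lpSys p Finset.univ v κ 0) q i k := by
      ext i k
      rw [Matrix.of_apply, jac_lpSys _ _ _ _ _ _ h1, jac_lpSys _ _ _ _ _ _ h1]
      simp only [Finset.mem_univ, if_true]
      rw [Finset.mul_sum]; simp only [mul_assoc]
    rw [this, Matrix.det_mul_column]
    simpa using h3

variable {ι : Type} [Fintype ι] [DecidableEq ι] {n l : ℕ}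

/-- Sign identity between the Hessian and the dual matrix. -/
lemma gale_sign {T : Type} [Fintype T] [DecidableEq T] (hcard : Fintype.card T = (l + 1) + n)
    (b : Matrix T (Fin n) ℝ) (W : Matrix T (Fin (l + 1)) ℝ) (hbW : bᵀ * W = 0)
    (hWinj : ∀ x, W *ᵥ x = 0 → x = 0) (β : T → ℝ) (hβ : ∀ j, β j ≠ 0)
    (hH : (bᵀ * diagonal β * b).det ≠ 0) :
    0 < (Wᵀ * diagonal (fun j => (β j)⁻¹) * W).det * (bᵀ * diagonal β * b).det * ∏ j, β j := by
  obtain ⟨e⟩ : Nonempty (T ≃ Fin (l + 1) ⊕ Fin n) := by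
    rw [← Fintype.card_eq]; simp [hcard]
  set D := diagonal β with hD
  set D' := diagonal (fun j => (β j)⁻¹) with hD'
  have hDD : D * D' = 1 := by
    rw [hD, hD', diagonal_mul_diagonal]
    simp [hβ]
  have hDD' : D' * D = 1 := by
    rw [hD, hD', diagonal_mul_diagonal]
    simp [hβ]
  have hWb : Wᵀ * b = 0 := by
    have := congrArg transpose hbW
    simpa [transpose_mul] using this
  set M := fromCols W (D * b) with hM
  have h1 : Mᵀ * D' * M = fromBlocks (Wᵀ * D' * W) 0 0 (bᵀ * D * b) := by
    rw [hM, transpose_fromCols, fromRows_mul, fromRows_mul_fromCols]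
    have hDt : Dᵀ = D := by rw [hD]; exact diagonal_transpose β
    congr 1
    · rw [Matrix.mul_assoc, ← Matrix.mul_assoc D' D b, hDD', Matrix.one_mul, hWb]
    · rw [transpose_mul, hDt, Matrix.mul_assoc bᵀ D D', hDD, Matrix.mul_one, hbW]
    · rw [transpose_mul, hDt, Matrix.mul_assoc bᵀ D D', hDD, Matrix.mul_one, Matrix.mul_assoc]
  set M' := M.submatrix id e with hM'
  have h2 : M'ᵀ * D' * M' = (fromBlocks (Wᵀ * D' * W) 0 0 (bᵀ * D * b)).submatrix e e := by
    rw [← h1, hM']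
    ext i j
    simp [Matrix.mul_apply]
  have h3 : M'.det ≠ 0 := by
    intro h0
    obtain ⟨z, hz0, hz⟩ := exists_mulVec_eq_zero_iff.2 h0
    apply hz0
    have hz' : M *ᵥ (z ∘ e.symm) = 0 := by
      rw [← hz, hM']
      ext i
      simp only [mulVec, dotProduct, submatrix_apply, id]
      rw [← e.sum_comp]
      simp
    have hz'' : W *ᵥ (fun i => z (e.symm (Sum.inl i))) + (D * b) *ᵥ (fun i => z (e.symm (Sum.inr i))) = 0 := by
      rw [← hz', hM]
      rw [fromCols_mulVec]
      rfl
    have h4 : (bᵀ * D * b) *ᵥ (fun i => z (e.symm (Sum.inr i))) = 0 := by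
      have := congrArg (fun u => bᵀ *ᵥ u) hz''
      simp only [mulVec_add, mulVec_mulVec, hbW, zero_mulVec, mulVec_zero, zero_add] at this
      rw [Matrix.mul_assoc]; exact this
    have h5 : (fun i => z (e.symm (Sum.inr i))) = 0 := by
      by_contra hne
      exact hH (exists_mulVec_eq_zero_iff.1 ⟨_, hne, h4⟩)
    rw [h5, mulVec_zero, add_zero] at hz''
    have h6 := hWinj _ hz''
    ext i
    rw [← e.symm_apply_apply i]
    cases hh : e i with
    | inl k => exact congrFun h6 k
    | inr k => exact congrFun h5 k
  have h4 := congrArg Matrix.det h2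
  rw [det_submatrix_equiv_self, det_fromBlocks_zero₂₁, det_mul, det_mul, det_transpose] at h4
  rw [← h4, hD', det_diagonal, Finset.prod_inv_distrib]
  have h5 : ∏ j, β j ≠ 0 := Finset.prod_ne_zero_iff.2 fun j _ => hβ j
  have : M'.det * (∏ x, β x)⁻¹ * M'.det * ∏ x, β x = M'.det ^ 2 := by field_simp
  rw [this]; positivity

/-- The count of nondegenerate critical points with prescribed Hessian sign. -/
lemma gale_count (hn1 : 1 ≤ n) (m : ℕ) (hl : l = m + 1) (hι : Fintype.card ι = n + l)
    (b : Matrix (Option ι) (Fin n) ℝ) (W : Matrix (Option ι) (Fin (l + 1)) ℝ)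
    (hbW : bᵀ * W = 0) (hWinj : ∀ x, W *ᵥ x = 0 → x = 0)
    (hker : ∀ β, bᵀ *ᵥ β = 0 → ∃ x, β = W *ᵥ x)
    (hW0 : W none 0 = 1) (hWs : ∀ k : Fin l, W none k.succ = 0)
    (K : Matrix (Fin (l + 1)) (Fin (l + 1)) ℝ) (hK : K.det ≠ 0)
    (t : ℝ) (ht : t ≠ 0) (hKt : (K * Wᵀ) *ᵥ 1 = Pi.single 0 t)
    (hspan : ∀ y, b *ᵥ y = 0 → y = 0)
    (c : Option ι → ℝ) (hc : ∀ j, c j ≠ 0) (s0 : ℝ)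
    (Y : Finset (Fin n → ℝ))
    (hY1 : ∀ y ∈ Y, bᵀ *ᵥ (fun j => c j * Real.exp ((b *ᵥ y) j)) = 0)
    (hY2 : ∀ y ∈ Y, 0 < s0 * (bᵀ * diagonal (fun j => c j * Real.exp ((b *ᵥ y) j)) * b).det) :
    2 * (Y.card : ℝ) ≤ n * rr (n + l + 1) m (2 * n) + (n + l + 1) * rr (n + l + 1) m (n + 1) := by
  set βf : (Fin n → ℝ) → Option ι → ℝ := fun y j => c j * Real.exp ((b *ᵥ y) j) with hβf
  have hβne : ∀ y j, βf y j ≠ 0 := fun y j => mul_ne_zero (hc j) (Real.exp_pos _).ne'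
  choose! xf hxf using fun y (hy : y ∈ Y) => hker _ (hY1 y hy)
  have hx0 : ∀ y ∈ Y, xf y 0 = βf y none := by
    intro y hy
    have := congrFun (hxf y hy) none
    have h2 : (W *ᵥ xf y) none = xf y 0 := by
      rw [mulVec, dotProduct, Fin.sum_univ_succ]
      simp only [hW0, hWs, one_mul, zero_mul, Finset.sum_const_zero, add_zero]
    exact (this.trans h2).symm
  let lam : (Fin n → ℝ) → Fin l → ℝ := fun y k => xf y k.succ / xf y 0
  let ε : ι → ℝ := fun j => SignType.sign (c (some j) * c none)
  have hε : ∀ j, ε j * (c (some j) * c none) = |c (some j) * c none| := fun j => sign_mul_self _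
  have hεabs : ∀ j, |ε j| = 1 := by
    intro j
    have : c (some j) * c none ≠ 0 := mul_ne_zero (hc _) (hc _)
    rcases this.lt_or_gt with h | h
    · simp [ε, sign_neg h]
    · simp [ε, sign_pos h]
  let p : ι → MvPolynomial (Fin l) ℝ := fun j =>
    C (ε j * W (some j) 0) + ∑ k : Fin l, C (ε j * W (some j) k.succ) * X k
  have hpe : ∀ (x : Fin l → ℝ) j, eval x (p j) = ε j * (W *ᵥ (Fin.cons 1 x)) (some j) := by
    intro x j
    simp only [p, map_add, eval_C, map_sum, map_mul, eval_X, mulVec, dotProduct, Fin.sum_univ_succ,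
      Fin.cons_zero, Fin.cons_succ, mul_add, Finset.mul_sum, mul_one, mul_assoc]
  have hpd : ∀ j, (p j).totalDegree ≤ 1 := by
    intro j
    refine (totalDegree_add _ _).trans (max_le (by rw [totalDegree_C]; omega) ?_)
    refine (totalDegree_finsetSum _ _).trans (Finset.sup_le fun k _ => ?_)
    refine (totalDegree_mul _ _).trans ?_
    rw [totalDegree_C, totalDegree_X]
  have hpder : ∀ (x : Fin l → ℝ) j k, eval x (pderiv k (p j)) = ε j * W (some j) k.succ := by
    intro x j k
    simp [p, pderiv_X, Pi.single_apply]
  -- value at the dual point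
  have hWl : ∀ y ∈ Y, ∀ j, (W *ᵥ (Fin.cons 1 (lam y))) j = βf y j / βf y none := by
    intro y hy j
    have e1 : (Fin.cons 1 (lam y) : Fin (l + 1) → ℝ) = (xf y 0)⁻¹ • xf y := by
      have h0 : xf y 0 ≠ 0 := by rw [hx0 y hy]; exact hβne _ _
      ext k
      refine Fin.cases ?_ (fun k => ?_) k
      · simp [h0]
      · simp [lam]; ring
    have h1 : W *ᵥ xf y = βf y := (hxf y hy).symm
    rw [e1, mulVec_smul, h1, Pi.smul_apply, hx0 y hy, smul_eq_mul]
    ring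
  have hpl : ∀ y ∈ Y, ∀ j, eval (lam y) (p j) = |βf y (some j)| / |βf y none| := by
    intro y hy j
    rw [hpe, hWl y hy]
    have h1 : βf y (some j) / βf y none = (c (some j) * c none) *
        (Real.exp ((b *ᵥ y) (some j)) / (c none ^ 2 * Real.exp ((b *ᵥ y) none))) := by
      have := hc none
      simp only [hβf]
      field_simp
    have h0 : 0 < ε j * (βf y (some j) / βf y none) := by
      rw [h1, ← mul_assoc, hε]
      have := hc none
      have : 0 < |c (some j) * c none| := abs_pos.2 (mul_ne_zero (hc _) (hc _))
      positivity
    rw [← abs_of_pos h0, abs_mul, hεabs, one_mul, abs_div]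
  have hlDom : ∀ y ∈ Y, lam y ∈ lpDom p := by
    intro y hy j
    rw [hpl y hy]
    exact div_pos (abs_pos.2 (hβne _ _)) (abs_pos.2 (hβne _ _))
  let vv : Matrix (Fin (l + 1)) (Option ι) ℝ := K * Wᵀ
  let v : Fin l → ι → ℝ := fun i j => vv i.succ (some j)
  let κ : Fin l → ℝ := fun i => ∑ j, vv i.succ j * Real.log |c j|
  have hvb : vv * b = 0 := by
    have : Wᵀ * b = 0 := by simpa [transpose_mul] using congrArg transpose hbW
    simp only [vv, Matrix.mul_assoc, this, Matrix.mul_zero]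
  have hvsum : ∀ i, ∑ j, vv i j = (Pi.single 0 t : Fin (l + 1) → ℝ) i := by
    intro i
    rw [← hKt]; simp [mulVec, dotProduct, vv]
  -- basic log equation
  have hlog : ∀ y i, ∑ j, vv i j * Real.log |βf y j| = ∑ j, vv i j * Real.log |c j| := by
    intro y i
    have : ∀ j, Real.log |βf y j| = Real.log |c j| + (b *ᵥ y) j := by
      intro j
      simp only [hβf]
      rw [abs_mul, Real.log_mul (abs_ne_zero.2 (hc j)) (abs_ne_zero.2 (Real.exp_pos _).ne'),
        Real.abs_exp, Real.log_exp]
    simp only [this, mul_add, Finset.sum_add_distrib]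
    have h2 : ∑ j, vv i j * (b *ᵥ y) j = ((vv * b) *ᵥ y) i := by
      rw [← mulVec_mulVec]; rfl
    rw [h2, hvb, zero_mulVec]; simp
  have hlogl : ∀ y ∈ Y, ∀ i : Fin (l + 1), ∑ j : ι, vv i (some j) * Real.log (eval (lam y) (p j)) =
      ∑ j, vv i j * Real.log |c j| - (Pi.single 0 t : Fin (l + 1) → ℝ) i * Real.log |βf y none| := by
    intro y hy i
    have h1 : ∀ j, Real.log (eval (lam y) (p j)) = Real.log |βf y (some j)| - Real.log |βf y none| := by
      intro j
      rw [hpl y hy, Real.log_div (abs_ne_zero.2 (hβne _ _)) (abs_ne_zero.2 (hβne _ _))]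
    simp only [h1]
    rw [← hlog y i, ← hvsum i, Fintype.sum_option, Fintype.sum_option]
    simp only [mul_sub, Finset.sum_sub_distrib, add_mul, Finset.sum_mul]
    ring
  have hinj : Set.InjOn lam Y := by
    intro y hy y' hy' h
    have h1 := hlogl y hy 0
    have h2 := hlogl y' hy' 0
    rw [h] at h1
    have h3 : Real.log |βf y none| = Real.log |βf y' none| := by
      have h4 : t * (Real.log |βf y none| - Real.log |βf y' none|) = 0 := by
        simp only [Pi.single_eq_same] at h1 h2
        linarith
      have := (mul_eq_zero.1 h4).resolve_left ht
      linarith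
    have hsplit : ∀ y j, Real.log |βf y j| = Real.log |c j| + (b *ᵥ y) j := by
      intro y j
      simp only [hβf]
      rw [abs_mul, Real.log_mul (abs_ne_zero.2 (hc j)) (abs_ne_zero.2 (Real.exp_pos _).ne'),
        Real.abs_exp, Real.log_exp]
    have h5 : ∀ j, Real.log |βf y j| = Real.log |βf y' j| := by
      intro j
      cases j with
      | none => exact h3
      | some j =>
        have e1 := congrArg Real.log (hpl y hy j)
        have e2 := congrArg Real.log (hpl y' hy' j)
        rw [h, Real.log_div (abs_ne_zero.2 (hβne _ _)) (abs_ne_zero.2 (hβne _ _))] at e1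
        rw [Real.log_div (abs_ne_zero.2 (hβne _ _)) (abs_ne_zero.2 (hβne _ _))] at e2
        linarith
    have h6 : b *ᵥ (y - y') = 0 := by
      ext j
      have := h5 j
      rw [hsplit, hsplit] at this
      rw [mulVec_sub, Pi.sub_apply, Pi.zero_apply]
      linarith
    exact sub_eq_zero.1 (hspan _ h6)
  have hprop : ∀ R : ℝ, Bornology.IsBounded
      {x : Fin l → ℝ | (∀ j, 0 ≤ eval x (p j)) ∧ ∑ j, eval x (p j) ≤ R} := by
    intro R
    obtain ⟨Kc, hKc, hanti⟩ : ∃ Kc > 0, AntilipschitzWith Kc (Matrix.mulVecLin W) := by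
      apply LinearMap.exists_antilipschitzWith
      rw [LinearMap.ker_eq_bot']
      intro x hx
      exact hWinj x hx
    have hb : Bornology.IsBounded {u : Option ι → ℝ | ∀ j, |u j| ≤ max R 1} := by
      refine (Metric.isBounded_closedBall (x := (0 : Option ι → ℝ)) (r := max R 1)).subset ?_
      intro u hu
      rw [mem_closedBall_zero_iff, pi_norm_le_iff_of_nonneg (by positivity)]
      exact hu
    have hb2 := hanti.isBounded_preimage hb
    have hcont : ∀ x : Fin l → ℝ, x = fun k => (Fin.cons 1 x : Fin (l + 1) → ℝ) k.succ := by
      intro x; ext; simp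
    obtain ⟨ρ, hρ⟩ := hb2.exists_norm_le
    refine (Metric.isBounded_closedBall (x := (0 : Fin l → ℝ)) (r := ρ)).subset ?_
    rintro x ⟨hx0, hxR⟩
    have hmem : (Fin.cons 1 x : Fin (l + 1) → ℝ) ∈
        (Matrix.mulVecLin W) ⁻¹' {u : Option ι → ℝ | ∀ j, |u j| ≤ max R 1} := by
      rw [Set.mem_preimage]
      intro j
      rw [Matrix.mulVecLin_apply]
      cases j with
      | none =>
        rw [mulVec, dotProduct, Fin.sum_univ_succ]
        simp [hW0, hWs]
      | some j =>
        have h1 : |(W *ᵥ (Fin.cons 1 x)) (some j)| = eval x (p j) := by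
          have := hpe x j
          rw [← abs_of_nonneg (hx0 j), this, abs_mul, hεabs, one_mul]
        rw [h1]
        refine le_trans ?_ (le_max_left _ _)
        exact (Finset.single_le_sum (fun j _ => hx0 j) (Finset.mem_univ j)).trans hxR
    have h2 := hρ _ hmem
    rw [mem_closedBall_zero_iff]
    have hρ0 : 0 ≤ ρ := (norm_nonneg _).trans h2
    rw [pi_norm_le_iff_of_nonneg hρ0]
    intro k
    have := (norm_le_pi_norm (Fin.cons 1 x : Fin (l + 1) → ℝ) k.succ).trans h2
    simpa using this
  set E : ℝ := s0 * (c none ^ (l + 1) * (K.det / t) * ∏ j, c j) with hE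
  have hfin := count_bound_signed' p hpd hprop v κ n hn1 (by simpa using hι) m (by simp [hl]) E
    (Y.image lam) ?_
  · rw [Finset.card_image_of_injOn hinj] at hfin
    rw [hι] at hfin
    push_cast at hfin ⊢
    exact hfin
  intro q hq
  obtain ⟨y, hy, rfl⟩ := Finset.mem_image.1 hq
  refine ⟨hlDom y hy, fun i => ?_, ?_⟩
  · have := hlogl y hy i.succ
    rw [Pi.single_eq_of_ne (Fin.succ_ne_zero i), zero_mul, sub_zero] at this
    simp only [v, κ]
    rw [this, sub_self]
  · have hsys : lpSys p Finset.univ v κ 0 =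
        (fun i x => ∑ j, v i j * Real.log (eval x (p j)) - κ i) := by
      ext; simp [lpSys]
    rw [← hsys]
    set β := βf y with hβ
    have hβn : β none ≠ 0 := hβne _ _
    set D' := diagonal (fun j => (β j)⁻¹) with hD'
    set Φ : Matrix (Fin (l + 1)) (Fin (l + 1)) ℝ := K * (Wᵀ * D' * W) with hΦ
    have hjac : jac (lpSys p Finset.univ v κ 0) (lam y) =
        Matrix.of fun i k => β none * (Φ.submatrix Fin.succ Fin.succ) i k := by
      ext i k
      rw [jac_lpSys _ _ _ _ _ _ (hlDom y hy), if_pos (Finset.mem_univ _), Matrix.of_apply,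
        Matrix.submatrix_apply, hΦ]
      have : K * (Wᵀ * D' * W) = vv * D' * W := by simp only [vv, Matrix.mul_assoc]
      rw [this, Matrix.mul_apply, Fintype.sum_option, hWs, mul_zero, zero_add, Finset.mul_sum]
      refine Finset.sum_congr rfl fun j _ => ?_
      rw [hpder, hpe, hWl y hy, hD', Matrix.mul_diagonal]
      have h1 : ε j ≠ 0 := by rw [← abs_ne_zero, hεabs]; norm_num
      have h2 := hβne y (some j)
      rw [← hβ] at h2 ⊢
      simp only [v]
      field_simp
    have hcol : Φ *ᵥ (xf y) = Pi.single 0 t := by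
      rw [hΦ, ← hKt, ← mulVec_mulVec, ← mulVec_mulVec, ← mulVec_mulVec, ← mulVec_mulVec, ← hxf y hy]
      congr 2
      ext j
      rw [hD', mulVec_diagonal]
      exact inv_mul_cancel₀ (hβne y j)
    have hdet : t * (Φ.submatrix Fin.succ Fin.succ).det = β none * Φ.det := by
      have h1 : (Φ.updateCol 0 (Φ *ᵥ xf y)).det = β none * Φ.det := by
        rw [hβ, ← hx0 y hy]
        have : (Φ.updateCol 0 (Φ *ᵥ xf y)) = Φ * ((1 : Matrix (Fin (l + 1)) (Fin (l + 1)) ℝ).updateCol 0 (xf y)) := by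
          ext i j
          refine Fin.cases ?_ (fun j => ?_) j
          · simp [Matrix.mul_apply, mulVec, dotProduct]
          · rw [updateCol_ne (Fin.succ_ne_zero j), Matrix.mul_apply]
            simp [updateCol_ne (Fin.succ_ne_zero j), Matrix.one_apply]
        rw [this, det_mul, mul_comm]
        congr 1
        rw [← cramer_apply]
        simp
      rw [← h1, det_succ_column_zero, Fin.sum_univ_succ, Finset.sum_eq_zero]
      · simp only [hcol]
        simp only [Fin.val_zero, pow_zero, one_mul, updateCol_self, Pi.single_eq_same, add_zero]
        congr 2
      · intro i _
        rw [updateCol_self, hcol, Pi.single_eq_of_ne (Fin.succ_ne_zero i)]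
        ring
    have hsign := gale_sign (T := Option ι) (by rw [Fintype.card_option, hι]; ring) b W hbW hWinj β (hβne y)
      (fun h => by have := hY2 y hy; simp only [hβ, hβf] at h; rw [h] at this; simp at this)
    rw [hjac, det_mul_column]
    simp only [Finset.prod_const, Finset.card_univ, Fintype.card_fin]
    have h1 : (Φ.submatrix Fin.succ Fin.succ).det = β none * Φ.det / t := by
      rw [← hdet]; field_simp
    rw [h1, hΦ, det_mul]
    set A := (Wᵀ * D' * W).det
    set Hh := (bᵀ * diagonal β * b).det with hHh
    have hY2' : 0 < s0 * Hh := hY2 y hy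
    have hprodβ : ∏ j, β j = (∏ j, c j) * ∏ j, Real.exp ((b *ᵥ y) j) := by
      simp only [hβ, hβf, Finset.prod_mul_distrib]
    have hexp : 0 < ∏ j, Real.exp ((b *ᵥ y) j) := Finset.prod_pos fun j _ => Real.exp_pos _
    have hβnn : β none = c none * Real.exp ((b *ᵥ y) none) := rfl
    -- positivity
    have hE2 : 0 < (E * (β none ^ l * (β none * (K.det * A) / t))) * (Hh ^ 2 * (∏ j, Real.exp ((b *ᵥ y) j))) := by
      have : (E * (β none ^ l * (β none * (K.det * A) / t))) * (Hh ^ 2 * (∏ j, Real.exp ((b *ᵥ y) j))) =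
        (A * Hh * ∏ j, β j) * (s0 * Hh) * ((c none * β none) ^ (l + 1) * (K.det / t) ^ 2) := by
        rw [hE, hprodβ]; ring
      rw [this]
      have h2 : 0 < c none * β none := by
        rw [hβnn, ← mul_assoc]
        exact mul_pos (mul_self_pos.2 (hc none)) (Real.exp_pos _)
      have h3 : 0 < (K.det / t) ^ 2 := by positivity
      positivity
    have hH2 : 0 ≤ Hh ^ 2 * (∏ j, Real.exp ((b *ᵥ y) j)) := by positivity
    exact pos_of_mul_pos_left hE2 hH2

end Gale


/-! ## Counting maxima -/
set_option linter.unusedSectionVars false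
section Maxima
open Matrix

variable {T : Type} [Fintype T] [DecidableEq T] {n l : ℕ}

/-- exponential sum with matrix exponents -/
noncomputable def eS (b : Matrix T (Fin n) ℝ) (c : T → ℝ) (y : Fin n → ℝ) : ℝ :=
  ∑ j, c j * Real.exp ((b *ᵥ y) j)

/-- the weighted monomials -/
noncomputable def eB (b : Matrix T (Fin n) ℝ) (c : T → ℝ) (y : Fin n → ℝ) : T → ℝ :=
  fun j => c j * Real.exp ((b *ᵥ y) j)

lemma eS_line (b : Matrix T (Fin n) ℝ) (c : T → ℝ) (y z : Fin n → ℝ) (t : ℝ) :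
    eS b c (y + t • z) = ∑ j, eB b c y j * Real.exp (t * (b *ᵥ z) j) := by
  unfold eS eB
  refine Finset.sum_congr rfl fun j _ => ?_
  rw [mulVec_add, mulVec_smul, Pi.add_apply, Pi.smul_apply, Real.exp_add, smul_eq_mul]
  ring

lemma hasDerivAt_expLine (β s : T → ℝ) (t : ℝ) :
    HasDerivAt (fun t => ∑ j, β j * Real.exp (t * s j)) (∑ j, (β j * s j) * Real.exp (t * s j)) t := by
  refine HasDerivAt.fun_sum fun j _ => ?_
  have h1 : HasDerivAt (fun t => t * s j) (1 * s j) t := (hasDerivAt_id t).mul_const _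
  exact ((h1.exp).const_mul (β j)).congr_deriv (by ring)

lemma localMax_line (b : Matrix T (Fin n) ℝ) (c : T → ℝ) (y z : Fin n → ℝ)
    (h : IsLocalMax (eS b c) y) :
    IsLocalMax (fun t : ℝ => ∑ j, eB b c y j * Real.exp (t * (b *ᵥ z) j)) 0 := by
  have h1 : (fun t : ℝ => ∑ j, eB b c y j * Real.exp (t * (b *ᵥ z) j)) =
      (eS b c) ∘ fun t : ℝ => y + t • z := by
    ext t; rw [Function.comp, eS_line]
  rw [h1]
  have hc : ContinuousAt (fun t : ℝ => y + t • z) 0 := by fun_prop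
  have h2 : IsLocalMax (eS b c) ((fun t : ℝ => y + t • z) 0) := by simpa using h
  exact IsMaxFilter.comp_tendsto h2 hc

lemma localMax_crit (b : Matrix T (Fin n) ℝ) (c : T → ℝ) (y : Fin n → ℝ)
    (h : IsLocalMax (eS b c) y) : bᵀ *ᵥ (eB b c y) = 0 := by
  ext i
  have h1 := (localMax_line b c y (Pi.single i 1) h).hasDerivAt_eq_zero (hasDerivAt_expLine _ _ 0)
  simp only [zero_mul, Real.exp_zero, mul_one] at h1
  rw [Pi.zero_apply, ← h1]
  simp only [mulVec_single_one]
  simp [mulVec, dotProduct, mul_comm]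

lemma localMax_quad (b : Matrix T (Fin n) ℝ) (c : T → ℝ) (y z : Fin n → ℝ)
    (h : IsLocalMax (eS b c) y) : ∑ j, eB b c y j * ((b *ᵥ z) j) ^ 2 ≤ 0 := by
  by_contra hneg
  push Not at hneg
  set β := eB b c y
  set s := b *ᵥ z
  have hm := localMax_line b c y z h
  set φ := fun t : ℝ => ∑ j, β j * Real.exp (t * s j) with hφ
  have hd : deriv φ = fun t => ∑ j, (β j * s j) * Real.exp (t * s j) := by
    ext t; exact (hasDerivAt_expLine β s t).deriv
  have hdd : deriv (deriv φ) 0 = ∑ j, β j * s j ^ 2 := by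
    rw [hd, (hasDerivAt_expLine (fun j => β j * s j) s 0).deriv]
    refine Finset.sum_congr rfl fun j _ => ?_
    simp; ring
  have hmin : IsLocalMin φ 0 := isLocalMin_of_deriv_deriv_pos (by rw [hdd]; exact hneg)
    hm.deriv_eq_zero (hasDerivAt_expLine β s 0).continuousAt
  have heq : φ =ᶠ[nhds 0] fun _ => φ 0 := by
    filter_upwards [hm, hmin] with t h1 h2
    exact le_antisymm h1 h2
  have h3 := heq.deriv.deriv_eq
  rw [hdd] at h3
  simp at h3
  linarith

lemma quad_eq (b : Matrix T (Fin n) ℝ) (β : T → ℝ) (z : Fin n → ℝ) :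
    z ⬝ᵥ ((bᵀ * diagonal β * b) *ᵥ z) = ∑ j, β j * ((b *ᵥ z) j) ^ 2 := by
  rw [← mulVec_mulVec, ← mulVec_mulVec, dotProduct_mulVec, vecMul_transpose]
  simp only [dotProduct, mulVec_diagonal]
  refine Finset.sum_congr rfl fun j _ => ?_
  ring

lemma localMax_posDef (b : Matrix T (Fin n) ℝ) (c : T → ℝ) (y : Fin n → ℝ)
    (h : IsLocalMax (eS b c) y) (hdet : (bᵀ * diagonal (eB b c y) * b).det ≠ 0) :
    (-(bᵀ * diagonal (eB b c y) * b)).PosDef := by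
  have hs : (-(bᵀ * diagonal (eB b c y) * b)).PosSemidef := by
    refine .of_dotProduct_mulVec_nonneg ?_ (fun x => ?_)
    · rw [IsHermitian, conjTranspose_eq_transpose_of_trivial, transpose_neg, transpose_mul,
        transpose_mul, diagonal_transpose, transpose_transpose, Matrix.mul_assoc]
    · rw [star_trivial, neg_mulVec, dotProduct_neg, quad_eq]
      linarith [localMax_quad b c y x h]
  rw [hs.posDef_iff_det_ne_zero, det_neg]
  exact mul_ne_zero (pow_ne_zero _ (by norm_num)) hdet

lemma localMax_sign (b : Matrix T (Fin n) ℝ) (c : T → ℝ) (y : Fin n → ℝ)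
    (h : IsLocalMax (eS b c) y) (hdet : (bᵀ * diagonal (eB b c y) * b).det ≠ 0) :
    0 < (-1 : ℝ) ^ n * (bᵀ * diagonal (eB b c y) * b).det := by
  have := (localMax_posDef b c y h hdet).det_pos
  rwa [det_neg, Fintype.card_fin] at this

lemma localMax_neg_card (b : Matrix T (Fin n) ℝ) (c : T → ℝ) (y : Fin n → ℝ)
    (h : IsLocalMax (eS b c) y) (hdet : (bᵀ * diagonal (eB b c y) * b).det ≠ 0) :
    n ≤ (Finset.univ.filter fun j => c j < 0).card := by
  by_contra hlt
  push Not at hlt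
  set S := Finset.univ.filter fun j => c j < 0
  let f : (Fin n → ℝ) →ₗ[ℝ] (S → ℝ) := (b.submatrix (fun j : S => (j : T)) id).mulVecLin
  have hk : LinearMap.ker f ≠ ⊥ := LinearMap.ker_ne_bot_of_finrank_lt (by simpa using hlt)
  obtain ⟨z, hz, hz0⟩ := (Submodule.ne_bot_iff _).1 hk
  have hz' : ∀ j ∈ S, (b *ᵥ z) j = 0 := fun j hj => congrFun (LinearMap.mem_ker.1 hz) ⟨j, hj⟩
  have hpd := (localMax_posDef b c y h hdet).dotProduct_mulVec_pos hz0
  rw [star_trivial, neg_mulVec, dotProduct_neg, quad_eq] at hpd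
  have : 0 ≤ ∑ j, eB b c y j * ((b *ᵥ z) j) ^ 2 := by
    refine Finset.sum_nonneg fun j _ => ?_
    by_cases hj : j ∈ S
    · rw [hz' j hj]; simp
    · have : 0 ≤ c j := by simpa [S] using hj
      unfold eB
      positivity
  linarith

/-- Sard -/
lemma sard_crit (r : ℕ) (hcard : Fintype.card T = r + n)
    (b : Matrix T (Fin n) ℝ) (W : Matrix T (Fin r) ℝ)
    (hker : ∀ β, bᵀ *ᵥ β = 0 → ∃ x, β = W *ᵥ x) :
    MeasureTheory.volume {c : T → ℝ | ∃ y, bᵀ *ᵥ (eB b c y) = 0 ∧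
      (bᵀ * diagonal (eB b c y) * b).det = 0} = 0 := by
  obtain ⟨e⟩ : Nonempty (T ≃ Fin r ⊕ Fin n) := by
    rw [← Fintype.card_eq]; simp [hcard]
  let L1 : (T → ℝ) →L[ℝ] (T → ℝ) := LinearMap.toContinuousLinearMap
    ((W.submatrix id id).mulVecLin ∘ₗ LinearMap.funLeft ℝ ℝ (fun i => e.symm (Sum.inl i)))
  let L2 : (T → ℝ) →L[ℝ] (T → ℝ) := LinearMap.toContinuousLinearMap
    (b.mulVecLin ∘ₗ LinearMap.funLeft ℝ ℝ (fun i => e.symm (Sum.inr i)))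
  have hL1 : ∀ z, L1 z = W *ᵥ (fun i => z (e.symm (Sum.inl i))) := fun z => rfl
  have hL2 : ∀ z, L2 z = b *ᵥ (fun i => z (e.symm (Sum.inr i))) := fun z => rfl
  let Ψ : (T → ℝ) → (T → ℝ) := fun z j => L1 z j * Real.exp (-(L2 z j))
  let Ψ' : (T → ℝ) → (T → ℝ) →L[ℝ] (T → ℝ) := fun z => ContinuousLinearMap.pi fun j =>
    L1 z j • (Real.exp (-(L2 z j)) • (-(ContinuousLinearMap.proj j ∘L L2))) +
      Real.exp (-(L2 z j)) • (ContinuousLinearMap.proj j ∘L L1)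
  have hΨ : ∀ z, HasFDerivAt Ψ (Ψ' z) z := by
    intro z
    rw [hasFDerivAt_pi]
    intro j
    have h1 : HasFDerivAt (fun z => L1 z j) (ContinuousLinearMap.proj j ∘L L1) z :=
      (ContinuousLinearMap.proj (R := ℝ) (φ := fun _ : T => ℝ) j ∘L L1).hasFDerivAt
    have h2 : HasFDerivAt (fun z => L2 z j) (ContinuousLinearMap.proj j ∘L L2) z :=
      (ContinuousLinearMap.proj (R := ℝ) (φ := fun _ : T => ℝ) j ∘L L2).hasFDerivAt
    exact h1.mul h2.neg.exp
  have hz := MeasureTheory.addHaar_image_eq_zero_of_det_fderivWithin_eq_zero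
    (μ := MeasureTheory.volume) (f := Ψ) (f' := Ψ') (s := {z | (Ψ' z).det = 0})
    (fun z _ => (hΨ z).hasFDerivWithinAt) (fun z hz => hz)
  refine MeasureTheory.measure_mono_null ?_ hz
  rintro c ⟨y, hy1, hy2⟩
  obtain ⟨x, hx⟩ := hker _ hy1
  let z : T → ℝ := fun j => Sum.elim x y (e j)
  have hz1 : L1 z = eB b c y := by
    rw [hL1, hx]; congr 1; ext i; simp [z]
  have hz2 : L2 z = b *ᵥ y := by
    rw [hL2]; congr 1; ext i; simp [z]
  refine ⟨z, ?_, ?_⟩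
  · change LinearMap.det (Ψ' z : (T → ℝ) →ₗ[ℝ] (T → ℝ)) = 0
    rw [LinearMap.det_eq_zero_iff_ker_ne_bot, Submodule.ne_bot_iff]
    obtain ⟨u, hu0, hu⟩ := exists_mulVec_eq_zero_iff.2 hy2
    have hu' : bᵀ *ᵥ (fun j => eB b c y j * (b *ᵥ u) j) = 0 := by
      rw [← hu, ← mulVec_mulVec, ← mulVec_mulVec]
      congr 1
      ext j; rw [mulVec_diagonal]
    obtain ⟨w, hw⟩ := hker _ hu'
    let ζ : T → ℝ := fun j => Sum.elim w u (e j)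
    have hζ1 : L1 ζ = fun j => eB b c y j * (b *ᵥ u) j := by
      rw [hL1, hw]; congr 1; ext i; simp [ζ]
    have hζ2 : L2 ζ = b *ᵥ u := by
      rw [hL2]; congr 1; ext i; simp [ζ]
    refine ⟨ζ, ?_, ?_⟩
    · rw [LinearMap.mem_ker]
      ext j
      simp only [Ψ', ContinuousLinearMap.coe_coe, ContinuousLinearMap.coe_pi', _root_.add_apply,
        _root_.smul_apply, _root_.neg_apply, ContinuousLinearMap.comp_apply, ContinuousLinearMap.proj_apply,
        smul_eq_mul, hζ1, hζ2, hz1, Pi.zero_apply]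
      ring
    · intro h
      apply hu0
      ext i
      have := congrFun h (e.symm (Sum.inr i))
      simpa [ζ] using this
  · ext j
    simp only [Ψ, hz1, hz2, eB]
    rw [mul_assoc, ← Real.exp_add]
    simp

lemma exists_mat_map (r : Fin (l + 1) → ℝ) (hr : r ≠ 0) :
    ∃ A : Matrix (Fin (l + 1)) (Fin (l + 1)) ℝ, A.det ≠ 0 ∧ A *ᵥ r = Pi.single 0 1 := by
  obtain ⟨A, hA⟩ := SeparatingDual.exists_continuousLinearEquiv_apply_eq (R := ℝ) hr
    (y := Pi.single 0 1) (by intro h; simpa using congrFun h 0)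
  refine ⟨LinearMap.toMatrix' (A.toLinearEquiv : (Fin (l + 1) → ℝ) →ₗ[ℝ] _), ?_, ?_⟩
  · rw [LinearMap.det_toMatrix']
    exact (LinearEquiv.isUnit_det' A.toLinearEquiv).ne_zero
  · rw [LinearMap.toMatrix'_mulVec]; exact hA

lemma exists_kerBasis (r : ℕ) (hcard : Fintype.card T = n + r) (b : Matrix T (Fin n) ℝ)
    (hspan : ∀ y, b *ᵥ y = 0 → y = 0) :
    ∃ W : Matrix T (Fin r) ℝ, bᵀ * W = 0 ∧ (∀ x, W *ᵥ x = 0 → x = 0) ∧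
      (∀ β, bᵀ *ᵥ β = 0 → ∃ x, β = W *ᵥ x) := by
  let V := LinearMap.ker (bᵀ).mulVecLin
  have hV : Module.finrank ℝ V = r := by
    have h1 := LinearMap.finrank_range_add_finrank_ker (bᵀ).mulVecLin
    have h2 : Module.finrank ℝ (LinearMap.range (bᵀ).mulVecLin) = n := by
      have : (bᵀ).rank = n := by
        rw [rank_transpose]
        have h3 := LinearMap.finrank_range_add_finrank_ker b.mulVecLin
        have h4 : LinearMap.ker b.mulVecLin = ⊥ := by
          rw [LinearMap.ker_eq_bot']; exact hspan
        rw [h4, finrank_bot, add_zero] at h3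
        rw [Module.finrank_fintype_fun_eq_card, Fintype.card_fin] at h3
        exact h3
      exact this
    rw [h2] at h1
    rw [Module.finrank_fintype_fun_eq_card, hcard] at h1
    exact Nat.add_left_cancel h1
  let B := Module.finBasisOfFinrankEq ℝ V hV
  have hW : ∀ x : Fin r → ℝ, (Matrix.of fun j o => (B o : T → ℝ) j) *ᵥ x = ((∑ o, x o • B o : V) : T → ℝ) := by
    intro x
    ext j
    simp [mulVec, dotProduct, Finset.sum_apply, mul_comm]
  refine ⟨Matrix.of fun j o => (B o : T → ℝ) j, ?_, ?_, ?_⟩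
  · ext i o
    have := LinearMap.mem_ker.1 (B o).2
    have := congrFun this i
    rw [mulVecLin_apply] at this
    rw [Matrix.mul_apply]
    exact this
  · intro x hx
    rw [hW] at hx
    have h0 : ∑ o, x o • B o = 0 := Subtype.ext hx
    ext o
    exact Fintype.linearIndependent_iff.1 B.linearIndependent x h0 o
  · intro β hβ
    let v : V := ⟨β, hβ⟩
    refine ⟨B.repr v, ?_⟩
    rw [hW, B.sum_repr]

/-- the bound on twice the number of maxima -/
noncomputable def Mb (n : ℕ) : ℕ → ℝ
  | 0 => 2
  | m + 1 => n * rr (n + (m + 1) + 1) m (2 * n) + (n + (m + 1) + 1) * rr (n + (m + 1) + 1) m (n + 1)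

lemma crit_count (hn1 : 1 ≤ n) (hcard : Fintype.card T = n + l + 1) (b : Matrix T (Fin n) ℝ)
    (hspan : ∀ y, b *ᵥ y = 0 → y = 0) (hone : ∀ y, b *ᵥ y ≠ 1)
    (c : T → ℝ) (hc : ∀ j, c j ≠ 0) (s0 : ℝ) (Y : Finset (Fin n → ℝ))
    (hY1 : ∀ y ∈ Y, bᵀ *ᵥ (eB b c y) = 0)
    (hY2 : ∀ y ∈ Y, 0 < s0 * (bᵀ * diagonal (eB b c y) * b).det) :
    2 * (Y.card : ℝ) ≤ Mb n l := by
  obtain ⟨W, hbW, hWinj, hker⟩ := exists_kerBasis (l + 1) (by omega) b hspan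
  cases l with
  | zero =>
    have : Y.card ≤ 1 := by
      rw [Finset.card_le_one]
      intro y hy y' hy'
      obtain ⟨x, hx⟩ := hker _ (hY1 y hy)
      obtain ⟨x', hx'⟩ := hker _ (hY1 y' hy')
      obtain ⟨j0⟩ : Nonempty T := Fintype.card_pos_iff.1 (by omega)
      have e1 : ∀ j, eB b c y j = W j 0 * x 0 := fun j => by
        have := congrFun hx j
        simpa [mulVec, dotProduct] using this
      have e2 : ∀ j, eB b c y' j = W j 0 * x' 0 := fun j => by
        have := congrFun hx' j
        simpa [mulVec, dotProduct] using this
      have hx0 : x 0 ≠ 0 := by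
        intro h; have := e1 j0; rw [h, mul_zero] at this
        exact mul_ne_zero (hc j0) (Real.exp_pos _).ne' this
      have h3 : ∀ j, Real.exp ((b *ᵥ (y' - y)) j) = x' 0 / x 0 := by
        intro j
        have h1 := e1 j
        have h2 := e2 j
        unfold eB at h1 h2
        rw [mulVec_sub, Pi.sub_apply, Real.exp_sub, div_eq_div_iff (Real.exp_pos _).ne' hx0]
        have := hc j
        apply mul_left_cancel₀ this
        have hW : W j 0 * x 0 * x' 0 = W j 0 * x' 0 * x 0 := by ring
        rw [← h1, ← h2] at hW
        linarith
      set ρ := Real.log (x' 0 / x 0)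
      have h4 : b *ᵥ (y' - y) = fun _ => ρ := by
        ext j; rw [← Real.log_exp ((b *ᵥ (y' - y)) j), h3]
      have hρ : ρ = 0 := by
        by_contra hne
        apply hone (ρ⁻¹ • (y' - y))
        rw [mulVec_smul, h4]
        ext j; simp [hne]
      rw [hρ] at h4
      have := hspan _ h4
      exact (sub_eq_zero.1 this).symm
    have h2 : (Y.card : ℝ) ≤ 1 := by exact_mod_cast this
    simp only [Mb]; linarith
  | succ m =>
    rcases Y.eq_empty_or_nonempty with rfl | ⟨y0, hy0⟩
    · simp only [Finset.card_empty, Nat.cast_zero, mul_zero, Mb]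
      have hrr : ∀ N' m s, 0 ≤ rr N' m s := by
        intro N' m
        induction m with
        | zero => intro s; simp [rr]
        | succ m ih => intro s; simp only [rr]; have := ih (2 * s); have := ih (s + 1); positivity
      have h1 := hrr (n + (m + 1) + 1) m (2 * n)
      have h2 := hrr (n + (m + 1) + 1) m (n + 1)
      positivity
    obtain ⟨e⟩ : Nonempty (Option (Fin (n + (m + 1))) ≃ T) := by
      rw [← Fintype.card_eq]; simp [hcard]
    -- adjust W
    set r : Fin (m + 1 + 1) → ℝ := fun o => W (e none) o with hr
    have hr0 : r ≠ 0 := by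
      intro h
      obtain ⟨x, hx⟩ := hker _ (hY1 y0 hy0)
      have := congrFun hx (e none)
      have h2 : (W *ᵥ x) (e none) = r ⬝ᵥ x := rfl
      rw [h2, h, zero_dotProduct] at this
      exact mul_ne_zero (hc _) (Real.exp_pos _).ne' this
    obtain ⟨A, hA, hAr⟩ := exists_mat_map r hr0
    have hAu : IsUnit Aᵀ := by
      rw [isUnit_iff_isUnit_det, det_transpose]; exact hA.isUnit
    set W1 := W * Aᵀ with hW1
    have hWr : ∀ o, W1 (e none) o = (Pi.single 0 1 : Fin (m + 1 + 1) → ℝ) o := by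
      intro o
      rw [← hAr, hW1]
      simp [Matrix.mul_apply, mulVec, dotProduct, hr, mul_comm]
    have hbW1 : bᵀ * W1 = 0 := by rw [hW1, ← Matrix.mul_assoc, hbW, Matrix.zero_mul]
    have hW1inj : ∀ x, W1 *ᵥ x = 0 → x = 0 := by
      intro x hx
      rw [hW1, ← mulVec_mulVec] at hx
      have := hWinj _ hx
      by_contra hne
      exact (by simpa using hA : (Aᵀ).det ≠ 0) (exists_mulVec_eq_zero_iff.1 ⟨x, hne, this⟩)
    have hker1 : ∀ β, bᵀ *ᵥ β = 0 → ∃ x, β = W1 *ᵥ x := by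
      intro β hβ
      obtain ⟨x, hx⟩ := hker β hβ
      refine ⟨(Aᵀ)⁻¹ *ᵥ x, ?_⟩
      rw [hW1, mulVec_mulVec, Matrix.mul_assoc, mul_nonsing_inv _ ((isUnit_iff_isUnit_det _).1 hAu),
        Matrix.mul_one]
      exact hx
    -- the vector tau
    have hτ : W1ᵀ *ᵥ 1 ≠ 0 := by
      intro h
      -- then the all-one vector is in the range of b
      have hrange : (1 : T → ℝ) ∈ LinearMap.range b.mulVecLin := by
        have hsub : LinearMap.range b.mulVecLin ≤ LinearMap.ker (W1ᵀ).mulVecLin := by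
          rintro _ ⟨y, rfl⟩
          rw [LinearMap.mem_ker, mulVecLin_apply, mulVecLin_apply, mulVec_mulVec]
          have : W1ᵀ * b = 0 := by simpa [transpose_mul] using congrArg transpose hbW1
          rw [this, zero_mulVec]
        have hfin : LinearMap.range b.mulVecLin = LinearMap.ker (W1ᵀ).mulVecLin := by
          apply Submodule.eq_of_le_of_finrank_eq hsub
          have h3 := LinearMap.finrank_range_add_finrank_ker b.mulVecLin
          have h4 : LinearMap.ker b.mulVecLin = ⊥ := by
            rw [LinearMap.ker_eq_bot']; exact hspan
          rw [h4, finrank_bot, add_zero] at h3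
          have h5 := LinearMap.finrank_range_add_finrank_ker (W1ᵀ).mulVecLin
          have h6 : (W1ᵀ).rank = m + 1 + 1 := by
            rw [rank_transpose]
            have h3 := LinearMap.finrank_range_add_finrank_ker W1.mulVecLin
            have h4 : LinearMap.ker W1.mulVecLin = ⊥ := by
              rw [LinearMap.ker_eq_bot']; exact hW1inj
            rw [h4, finrank_bot, add_zero] at h3
            rw [Module.finrank_fintype_fun_eq_card, Fintype.card_fin] at h3
            exact h3
          have h7 : Module.finrank ℝ (LinearMap.range (W1ᵀ).mulVecLin) = m + 1 + 1 := h6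
          rw [h7] at h5
          simp only [Module.finrank_fintype_fun_eq_card, hcard, Fintype.card_fin] at h3 h5
          omega
        rw [hfin]; exact h
      obtain ⟨y, hy⟩ := hrange
      exact hone y hy
    obtain ⟨K, hK, hKτ⟩ := exists_mat_map _ hτ
    -- transport
    have hre : ∀ y, (b.submatrix e id) *ᵥ y = (b *ᵥ y) ∘ e := by intro y; rfl
    have heB : ∀ y, (fun j => c (e j) * Real.exp (((b.submatrix e id) *ᵥ y) j)) = (eB b c y) ∘ e := by
      intro y; rfl
    have htr : ∀ β : T → ℝ, (b.submatrix e id)ᵀ *ᵥ (β ∘ e) = bᵀ *ᵥ β := by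
      intro β
      ext i
      simp only [mulVec, dotProduct, transpose_apply, submatrix_apply, id, Function.comp]
      exact e.sum_comp (fun j => b j i * β j)
    have hmul : ∀ M : Matrix T (Fin (m + 1 + 1)) ℝ, (b.submatrix e id)ᵀ * (M.submatrix e id) = bᵀ * M := by
      intro M
      ext i o
      simp only [Matrix.mul_apply, transpose_apply, submatrix_apply, id]
      exact e.sum_comp (fun j => b j i * M j o)
    have hdiag : ∀ β : T → ℝ, (b.submatrix e id)ᵀ * diagonal (β ∘ e) * (b.submatrix e id) =
        bᵀ * diagonal β * b := by
      intro β
      ext i o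
      rw [Matrix.mul_apply, Matrix.mul_apply]
      simp only [mul_diagonal, transpose_apply, submatrix_apply, id, Function.comp]
      exact e.sum_comp (fun j => b j i * β j * b j o)
    have := gale_count (ι := Fin (n + (m + 1))) hn1 m rfl (by simp) (b.submatrix e id) (W1.submatrix e id)
      (by rw [hmul, hbW1])
      (fun x hx => hW1inj x (by
        ext j
        have := congrFun hx (e.symm j)
        simpa [mulVec, dotProduct] using this))
      (fun β hβ => by
        obtain ⟨x, hx⟩ := hker1 (β ∘ e.symm) (by
          rw [← htr, ← hβ]; congr 1; ext; simp)
        refine ⟨x, ?_⟩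
        ext j
        have := congrFun hx (e j)
        simpa [mulVec, dotProduct] using this)
      (by rw [submatrix_apply, id, hWr]; simp) (fun k => by rw [submatrix_apply, id, hWr]; simp)
      K hK 1 one_ne_zero
      (by
        rw [← mulVec_mulVec, ← hKτ]
        congr 1
        ext o
        simp only [mulVec, dotProduct, transpose_apply, submatrix_apply, id, Pi.one_apply]
        exact e.sum_comp (fun j => W1 j o * 1))
      (fun y hy => hspan y (by
        rw [hre] at hy
        ext j
        have := congrFun hy (e.symm j)
        simpa using this))
      (c ∘ e) (fun j => hc _) s0 Y
      (fun y hy => by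
        have := hY1 y hy
        simp only [Function.comp]
        rw [heB, htr]; exact this)
      (fun y hy => by
        simp only [Function.comp]
        rw [heB, hdiag]
        exact hY2 y hy)
    simp only [Mb]
    push_cast at this
    exact this

/-- final bound on maxima -/
lemma maxima_bound (hn1 : 1 ≤ n) (hcard : Fintype.card T = n + l + 1) (b : Matrix T (Fin n) ℝ)
    (hspan : ∀ y, b *ᵥ y = 0 → y = 0) (hone : ∀ y, b *ᵥ y ≠ 1) :
    ∃ Bad : Set (T → ℝ), MeasureTheory.volume Bad = 0 ∧ ∀ c ∉ Bad, (∀ j, c j ≠ 0) →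
      ∀ Y : Finset (Fin n → ℝ), (∀ y ∈ Y, IsLocalMax (eS b c) y) →
        (Y.Nonempty → n ≤ (Finset.univ.filter fun j => c j < 0).card) ∧
        2 * (Y.card : ℝ) ≤ Mb n l := by
  obtain ⟨W, hbW, hWinj, hker⟩ := exists_kerBasis (l + 1) (by omega) b hspan
  refine ⟨_, sard_crit (l + 1) (by omega) b W hker, ?_⟩
  intro c hcB hc Y hY
  have hdet : ∀ y ∈ Y, (bᵀ * diagonal (eB b c y) * b).det ≠ 0 := by
    intro y hy h0
    exact hcB ⟨y, localMax_crit b c y (hY y hy), h0⟩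
  refine ⟨?_, ?_⟩
  · rintro ⟨y, hy⟩
    exact localMax_neg_card b c y (hY y hy) (hdet y hy)
  · exact crit_count hn1 hcard b hspan hone c hc ((-1) ^ n) Y
      (fun y hy => localMax_crit b c y (hY y hy))
      (fun y hy => localMax_sign b c y (hY y hy) (hdet y hy))

end Maxima


/-! ## Numerical estimates -/
section Numerics

/-- the product appearing in the estimates -/
noncomputable def KK (τ ρ : ℝ) (m : ℕ) : ℝ := ∏ i ∈ Finset.range m, (1 + τ * ρ ^ i)

lemma KK_nonneg {τ ρ : ℝ} (hτ : 0 ≤ τ) (hρ : 0 ≤ ρ) (m : ℕ) : 0 ≤ KK τ ρ m :=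
  Finset.prod_nonneg fun i _ => by positivity

lemma rr_le (N' s0 : ℕ) (h0 : 1 ≤ s0) : ∀ (m s : ℕ), s0 ≤ s →
    rr N' m s ≤ 2 ^ (m * (m - 1) / 2) * (s : ℝ) ^ m *
      KK ((N' : ℝ) / (2 * s0)) (((s0 : ℝ) + 1) / (2 * s0)) m := by
  intro m
  induction m with
  | zero => intro s _; simp [rr, KK]
  | succ m ih =>
    intro s hs
    have h1 := ih (2 * s) (by omega)
    have h2 := ih (s + 1) (by omega)
    set K := KK ((N' : ℝ) / (2 * s0)) (((s0 : ℝ) + 1) / (2 * s0)) m with hK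
    have hs0 : (0 : ℝ) < s0 := by exact_mod_cast h0
    have hss : (s0 : ℝ) ≤ s := by exact_mod_cast hs
    have hKn : 0 ≤ K := KK_nonneg (by positivity) (by positivity) m
    have hKs : KK ((N' : ℝ) / (2 * s0)) (((s0 : ℝ) + 1) / (2 * s0)) (m + 1) =
        K * (1 + (N' : ℝ) / (2 * s0) * (((s0 : ℝ) + 1) / (2 * s0)) ^ m) := by
      rw [KK, Finset.prod_range_succ]; rfl
    rw [hKs]
    have hexp : (2 : ℝ) ^ ((m + 1) * (m + 1 - 1) / 2) = 2 ^ (m * (m - 1) / 2) * 2 ^ m := by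
      rw [← pow_add]; congr 1
      have := Nat.triangle_succ m
      simpa using this
    rw [hexp]
    have h3 : ((s : ℝ) + 1) ^ m ≤ (2 * s) ^ m * (((s0 : ℝ) + 1) / (2 * s0)) ^ m := by
      rw [← mul_pow]
      apply pow_le_pow_left₀ (by positivity)
      rw [mul_div_assoc', le_div_iff₀ (by positivity)]
      nlinarith
    have h4 : (N' : ℝ) / 2 ≤ (N' : ℝ) / (2 * s0) * s := by
      rw [div_mul_eq_mul_div, div_le_div_iff₀ (by norm_num) (by positivity)]
      have : (0 : ℝ) ≤ N' := by positivity
      nlinarith [mul_le_mul_of_nonneg_left hss this]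
    simp only [rr]
    push_cast at h1 h2 ⊢
    set E : ℝ := 2 ^ (m * (m - 1) / 2)
    have hE : 0 ≤ E := by positivity
    calc _ ≤ (s : ℝ) * (E * (2 * s) ^ m * K) + (N' : ℝ) / 2 * (E * ((s : ℝ) + 1) ^ m * K) := by
            gcongr
      _ ≤ (s : ℝ) * (E * (2 * s) ^ m * K) + ((N' : ℝ) / (2 * s0) * s) *
            (E * ((2 * s) ^ m * (((s0 : ℝ) + 1) / (2 * s0)) ^ m) * K) := by
            gcongr
      _ = _ := by rw [mul_pow]; ring

/-- the normalised bound -/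
noncomputable def QQ (n m : ℕ) : ℝ :=
  (n : ℝ) ^ (m + 1) * KK (((n + m + 2 : ℕ) : ℝ) / (4 * n)) ((2 * (n : ℝ) + 1) / (4 * n)) m +
  ((n + m + 2 : ℕ) : ℝ) * (((n : ℝ) + 1) / 2) ^ m *
    KK (((n + m + 2 : ℕ) : ℝ) / (2 * n + 2)) (((n : ℝ) + 2) / (2 * n + 2)) m

lemma Mb_le_QQ (n m : ℕ) (hn : 1 ≤ n) :
    Mb n (m + 1) ≤ 2 ^ ((m + 1) * m / 2) * QQ n m := by
  have h1 := rr_le (n + (m + 1) + 1) (2 * n) (by omega) m (2 * n) le_rfl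
  have h2 := rr_le (n + (m + 1) + 1) (n + 1) (by omega) m (n + 1) le_rfl
  have hexp : (2 : ℝ) ^ ((m + 1) * m / 2) = 2 ^ (m * (m - 1) / 2) * 2 ^ m := by
    rw [← pow_add]; congr 1
    have := Nat.triangle_succ m
    simpa using this
  rw [hexp]
  simp only [Mb, QQ]
  have e1 : (n + (m + 1) + 1 : ℕ) = n + m + 2 := by ring
  rw [e1] at h1 h2 ⊢
  have e2 : (2 * ((2 * n : ℕ) : ℝ)) = 4 * n := by push_cast; ring
  have e3 : (2 * ((n + 1 : ℕ) : ℝ)) = 2 * n + 2 := by push_cast; ring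
  have e4 : (((2 * n : ℕ) : ℝ)) = 2 * n := by push_cast; ring
  have e5 : (((n + 1 : ℕ) : ℝ)) = n + 1 := by push_cast; ring
  rw [e2, e4] at h1
  rw [e3, e5, add_assoc (n:ℝ), one_add_one_eq_two] at h2
  set K1 := KK (((n + m + 2 : ℕ) : ℝ) / (4 * n)) ((2 * (n : ℝ) + 1) / (4 * n)) m
  set K2 := KK (((n + m + 2 : ℕ) : ℝ) / (2 * n + 2)) (((n : ℝ) + 2) / (2 * n + 2)) m
  set E : ℝ := 2 ^ (m * (m - 1) / 2)
  calc _ ≤ (n : ℝ) * (E * (2 * n) ^ m * K1) + ((n + m + 2 : ℕ) : ℝ) * (E * ((n : ℝ) + 1) ^ m * K2) := by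
          have ec : ((n : ℝ) + (m + 1) + 1) = ((n + m + 2 : ℕ) : ℝ) := by push_cast; ring
          push_cast at ec ⊢
          rw [ec]
          push_cast at h1 h2
          gcongr
    _ = _ := by rw [mul_pow, div_pow]; field_simp; ring

lemma KK_le_exp {τ ρ : ℝ} (hτ : 0 ≤ τ) (hρ : 0 ≤ ρ) (hρ1 : ρ < 1) (m : ℕ) :
    KK τ ρ m ≤ Real.exp (τ / (1 - ρ)) := by
  have h1 : KK τ ρ m ≤ Real.exp (∑ i ∈ Finset.range m, τ * ρ ^ i) := by
    rw [Real.exp_sum]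
    apply Finset.prod_le_prod
    · intro i _; positivity
    · intro i _; rw [add_comm]; exact Real.add_one_le_exp _
  refine h1.trans (Real.exp_le_exp.2 ?_)
  rw [← Finset.mul_sum, div_eq_mul_inv]
  refine mul_le_mul_of_nonneg_left ?_ hτ
  rw [← tsum_geometric_of_lt_one hρ hρ1]
  exact (summable_geometric_of_lt_one hρ hρ1).sum_le_tsum _ (fun i _ => by positivity)

/-- first term -/
lemma first_term (n m : ℕ) (hn : 1 ≤ n) :
    (n : ℝ) ^ (m + 1) * KK (((n + m + 2 : ℕ) : ℝ) / (4 * n)) ((2 * (n : ℝ) + 1) / (4 * n)) m ≤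
      ((n : ℝ) + 2) ^ (m + 1) * Real.exp (((n : ℝ) + m + 2) / (2 * n - 1) - 2 * (m + 1) / (n + 2)) := by
  have hn' : (1 : ℝ) ≤ n := by exact_mod_cast hn
  have h1 := KK_le_exp (τ := ((n + m + 2 : ℕ) : ℝ) / (4 * n)) (ρ := (2 * (n : ℝ) + 1) / (4 * n))
    (by positivity) (by positivity) (by rw [div_lt_one (by positivity)]; linarith) m
  have e1 : ((n + m + 2 : ℕ) : ℝ) / (4 * n) / (1 - (2 * (n : ℝ) + 1) / (4 * n)) =
      ((n : ℝ) + m + 2) / (2 * n - 1) := by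
    have : (2 * (n : ℝ) - 1) ≠ 0 := by linarith
    have h2 : 1 - (2 * (n : ℝ) + 1) / (4 * n) = (2 * n - 1) / (4 * n) := by field_simp; ring
    rw [h2]; push_cast; field_simp
  rw [e1] at h1
  have h2 : (n : ℝ) ^ (m + 1) ≤ ((n : ℝ) + 2) ^ (m + 1) * Real.exp (-(2 * (m + 1) / (n + 2))) := by
    have h3 : (n : ℝ) ≤ (n + 2) * Real.exp (-(2 / (n + 2))) := by
      have := Real.add_one_le_exp (-(2 / ((n : ℝ) + 2)))
      have h4 : (n : ℝ) = (n + 2) * (-(2 / ((n : ℝ) + 2)) + 1) := by field_simp; ring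
      calc (n : ℝ) = (n + 2) * (-(2 / ((n : ℝ) + 2)) + 1) := h4
        _ ≤ _ := by gcongr
    calc (n : ℝ) ^ (m + 1) ≤ ((n + 2) * Real.exp (-(2 / (n + 2)))) ^ (m + 1) := by gcongr
      _ = _ := by
        rw [mul_pow, ← Real.exp_nat_mul]; congr 2; push_cast; ring
  calc _ ≤ (((n : ℝ) + 2) ^ (m + 1) * Real.exp (-(2 * (m + 1) / (n + 2)))) *
        Real.exp (((n : ℝ) + m + 2) / (2 * n - 1)) := by
          apply mul_le_mul h2 h1 (KK_nonneg (by positivity) (by positivity) m) (by positivity)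
    _ = _ := by rw [mul_assoc, ← Real.exp_add]; congr 2; ring

lemma exp_half_lt : Real.exp (1 / 2) < 1.65 := by
  have h := Real.exp_one_lt_d9
  have h2 : Real.exp (1 / 2) ^ 2 = Real.exp 1 := by rw [← Real.exp_nat_mul]; norm_num
  by_contra hc
  push Not at hc
  nlinarith

lemma exp_neg_half_lt : Real.exp (-(1 / 2)) < 0.61 := by
  have h := Real.exp_one_gt_d9
  have h2 : Real.exp (1 / 2) ^ 2 = Real.exp 1 := by rw [← Real.exp_nat_mul]; norm_num
  have h3 : 1.648 < Real.exp (1 / 2) := by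
    by_contra hc
    push Not at hc
    nlinarith [Real.exp_pos (1 / 2)]
  rw [Real.exp_neg, inv_lt_comm₀ (Real.exp_pos _) (by norm_num)]
  refine lt_trans ?_ h3
  norm_num

/-- large n -/
lemma QQ_large_n (n m : ℕ) (hm : 6 ≤ m) (hn : m + 2 ≤ n) : QQ n m / 2 ≤ ((n : ℝ) + 2) ^ (m + 1) := by
  have h1 := first_term n m (by omega)
  have hm' : (6 : ℝ) ≤ m := by exact_mod_cast hm
  have hn' : (m : ℝ) + 2 ≤ n := by exact_mod_cast hn
  have h2 : Real.exp (((n : ℝ) + m + 2) / (2 * n - 1) - 2 * (m + 1) / (n + 2)) ≤ Real.exp (1 / 2) := by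
    apply Real.exp_le_exp.2
    rw [sub_le_iff_le_add, div_add_div _ _ (by norm_num) (by positivity),
      div_le_div_iff₀ (by linarith) (by positivity)]
    nlinarith
  have h3 : (((n : ℝ) + 1) / 2) ^ m *
    KK (((n + m + 2 : ℕ) : ℝ) / (2 * n + 2)) (((n : ℝ) + 2) / (2 * n + 2)) m ≤
      0.1 * ((n : ℝ) + 2) ^ m := by
    have h4 : KK (((n + m + 2 : ℕ) : ℝ) / (2 * n + 2)) (((n : ℝ) + 2) / (2 * n + 2)) m ≤
        ∏ i ∈ Finset.range m, (1 + (5 / 9 : ℝ) ^ i) := by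
      apply Finset.prod_le_prod
      · intro i _; positivity
      · intro i _
        have h5 : ((n + m + 2 : ℕ) : ℝ) / (2 * n + 2) ≤ 1 := by
          rw [div_le_one (by positivity)]; push_cast; linarith
        have h6 : ((n : ℝ) + 2) / (2 * n + 2) ≤ 5 / 9 := by
          rw [div_le_div_iff₀ (by positivity) (by norm_num)]; linarith
        have h7 : (((n : ℝ) + 2) / (2 * n + 2)) ^ i ≤ (5 / 9) ^ i :=
          pow_le_pow_left₀ (by positivity) h6 i
        have h8 : (0 : ℝ) ≤ (((n : ℝ) + 2) / (2 * n + 2)) ^ i := by positivity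
        nlinarith
    have h5 : ∀ m : ℕ, 6 ≤ m → ∏ i ∈ Finset.range m, (1 + (5 / 9 : ℝ) ^ i) ≤ 0.1 * 2 ^ m := by
      intro m hm
      induction m, hm using Nat.le_induction with
      | base => norm_num [Finset.prod_range_succ]
      | succ m hm ih =>
        rw [Finset.prod_range_succ, pow_succ, ← mul_assoc]
        have : (5 / 9 : ℝ) ^ m ≤ 1 := pow_le_one₀ (by norm_num) (by norm_num)
        have h9 : (0 : ℝ) ≤ (5 / 9 : ℝ) ^ m := by positivity
        apply mul_le_mul ih (by linarith) (by positivity) (by positivity)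
    calc _ ≤ (((n : ℝ) + 2) / 2) ^ m * (0.1 * 2 ^ m) := by
          apply mul_le_mul _ (h4.trans (h5 m hm)) (KK_nonneg (by positivity) (by positivity) m)
            (by positivity)
          gcongr
          norm_num
      _ = _ := by rw [div_pow]; field_simp
  have h4 : ((n + m + 2 : ℕ) : ℝ) ≤ 2 * (n + 2) := by push_cast; linarith
  have h5 := exp_half_lt
  unfold QQ
  rw [mul_assoc ((n + m + 2 : ℕ) : ℝ)]
  have hpos : (0 : ℝ) < ((n : ℝ) + 2) ^ m := by positivity
  have h6 : ((n + m + 2 : ℕ) : ℝ) * ((((n : ℝ) + 1) / 2) ^ m *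
    KK (((n + m + 2 : ℕ) : ℝ) / (2 * n + 2)) (((n : ℝ) + 2) / (2 * n + 2)) m) ≤
      (2 * (n + 2)) * (0.1 * ((n : ℝ) + 2) ^ m) := by
    apply mul_le_mul h4 h3 _ (by positivity)
    have := KK_nonneg (τ := ((n + m + 2 : ℕ) : ℝ) / (2 * n + 2)) (ρ := ((n : ℝ) + 2) / (2 * n + 2))
      (by positivity) (by positivity) m
    positivity
  have h7 : ((n : ℝ) + 2) ^ (m + 1) * Real.exp (((n : ℝ) + m + 2) / (2 * n - 1) - 2 * (m + 1) / (n + 2)) ≤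
      ((n : ℝ) + 2) ^ (m + 1) * 1.65 := by gcongr; exact (h2.trans h5.le)
  have h8 : ((n : ℝ) + 2) ^ (m + 1) = ((n : ℝ) + 2) ^ m * (n + 2) := pow_succ _ _
  nlinarith

/-- n small compared to m -/
lemma QQ_small_n (n m : ℕ) (hm : 9 ≤ m) (hn : n ≤ m + 1) (hn2 : 2 ≤ n) :
    QQ n m ≤ ((n : ℝ) + 2) ^ (m + 1) := by
  have h1 := first_term n m (by omega)
  have hm' : (9 : ℝ) ≤ m := by exact_mod_cast hm
  have hn' : (n : ℝ) ≤ m + 1 := by exact_mod_cast hn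
  have hn2' : (2 : ℝ) ≤ n := by exact_mod_cast hn2
  have h2 : Real.exp (((n : ℝ) + m + 2) / (2 * n - 1) - 2 * (m + 1) / (n + 2)) ≤ Real.exp (-(1 / 2)) := by
    apply Real.exp_le_exp.2
    rw [sub_le_iff_le_add, neg_add_eq_sub, div_sub_div _ _ (by positivity) (by norm_num),
      div_le_div_iff₀ (by linarith) (by positivity)]
    rcases le_total (n : ℝ) 10 with h | h
    · nlinarith [mul_nonneg (sub_nonneg.2 h) (sub_nonneg.2 hn2'), mul_nonneg (sub_nonneg.2 hm') (sub_nonneg.2 hn2')]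
    · nlinarith [mul_nonneg (sub_nonneg.2 h) (sub_nonneg.2 hn'), mul_nonneg (sub_nonneg.2 h) (sub_nonneg.2 h)]
  have hK := KK_le_exp (τ := ((n + m + 2 : ℕ) : ℝ) / (2 * n + 2)) (ρ := ((n : ℝ) + 2) / (2 * n + 2))
    (by positivity) (by positivity) (by rw [div_lt_one (by positivity)]; linarith) m
  have e1 : ((n + m + 2 : ℕ) : ℝ) / (2 * n + 2) / (1 - ((n : ℝ) + 2) / (2 * n + 2)) =
      (1 + 2 / n) + m * (1 / n) := by
    have h2 : 1 - ((n : ℝ) + 2) / (2 * n + 2) = n / (2 * n + 2) := by field_simp; ring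
    rw [h2]; push_cast; field_simp; ring
  rw [e1, Real.exp_add, Real.exp_nat_mul] at hK
  have hq : ((n : ℝ) + 1) / 2 * Real.exp (1 / n) ≤ 0.62 * (n + 2) := by
    rcases eq_or_lt_of_le hn2' with h | h
    · rw [← h]; have := exp_half_lt; norm_num at this ⊢; linarith
    · have h3 : 3 ≤ n := by have : 2 < n := by exact_mod_cast h
                            omega
      have h3' : (3 : ℝ) ≤ n := by exact_mod_cast h3
      have h4 : Real.exp (1 / (n : ℝ)) ≤ n / (n - 1) := by
        have := Real.add_one_le_exp (-(1 / (n : ℝ)))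
        rw [Real.exp_neg] at this
        have h5 : (0 : ℝ) < -(1 / (n : ℝ)) + 1 := by
          have : 1 / (n : ℝ) < 1 := by rw [div_lt_one (by positivity)]; linarith
          linarith
        have h6 := inv_anti₀ h5 this
        rw [inv_inv] at h6
        refine h6.trans (le_of_eq ?_)
        have : (n : ℝ) - 1 ≠ 0 := by linarith
        have h7 : -(1 / (n : ℝ)) + 1 = (n - 1) / n := by field_simp; ring
        rw [h7, inv_div]
      calc ((n : ℝ) + 1) / 2 * Real.exp (1 / n) ≤ ((n : ℝ) + 1) / 2 * (n / (n - 1)) := by gcongr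
        _ ≤ _ := by
          rw [div_mul_div_comm, div_le_iff₀ (by linarith)]
          nlinarith
  have he2 : Real.exp (1 + 2 / n) ≤ 7.39 := by
    have : (1 : ℝ) + 2 / n ≤ 1 + 1 := by
      have : 2 / (n : ℝ) ≤ 1 := by rw [div_le_one (by positivity)]; exact hn2'
      linarith
    refine (Real.exp_le_exp.2 this).trans ?_
    rw [Real.exp_add]
    have := Real.exp_one_lt_d9
    nlinarith [Real.exp_pos 1]
  have hmm : ∀ m : ℕ, 9 ≤ m → ((m : ℝ) + 4) * 0.62 ^ m ≤ 0.18 := by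
    intro m hm
    induction m, hm using Nat.le_induction with
    | base => norm_num
    | succ m hm ih =>
      have : (9 : ℝ) ≤ m := by exact_mod_cast hm
      have h0 : (0 : ℝ) < 0.62 ^ m := by positivity
      rw [pow_succ]; push_cast
      nlinarith
  have hN : ((n + m + 2 : ℕ) : ℝ) ≤ (n + 2) * ((m + 4) / 4) := by
    push_cast; nlinarith
  have h3 : ((n + m + 2 : ℕ) : ℝ) * (((n : ℝ) + 1) / 2) ^ m *
    KK (((n + m + 2 : ℕ) : ℝ) / (2 * n + 2)) (((n : ℝ) + 2) / (2 * n + 2)) m ≤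
      0.35 * ((n : ℝ) + 2) ^ (m + 1) := by
    calc _ ≤ ((n + 2) * ((m + 4) / 4)) * (((n : ℝ) + 1) / 2) ^ m *
          (Real.exp (1 + 2 / n) * Real.exp (1 / n) ^ m) := by
            apply mul_le_mul _ hK (KK_nonneg (by positivity) (by positivity) m) (by positivity)
            gcongr
      _ = ((n + 2) * ((m + 4) / 4)) * Real.exp (1 + 2 / n) *
          (((n : ℝ) + 1) / 2 * Real.exp (1 / n)) ^ m := by rw [mul_pow]; ring
      _ ≤ ((n + 2) * ((m + 4) / 4)) * 7.39 * (0.62 * (n + 2)) ^ m := by gcongr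
      _ = (((m : ℝ) + 4) * 0.62 ^ m) * (7.39 / 4 * ((n : ℝ) + 2) ^ (m + 1)) := by
          rw [mul_pow]; ring
      _ ≤ 0.18 * (7.39 / 4 * ((n : ℝ) + 2) ^ (m + 1)) := by
          gcongr; exact hmm m hm
      _ ≤ _ := by
          have : (0 : ℝ) < ((n : ℝ) + 2) ^ (m + 1) := by positivity
          nlinarith
  have h5 := exp_neg_half_lt
  have h7 : ((n : ℝ) + 2) ^ (m + 1) * Real.exp (((n : ℝ) + m + 2) / (2 * n - 1) - 2 * (m + 1) / (n + 2)) ≤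
      ((n : ℝ) + 2) ^ (m + 1) * 0.61 := by gcongr; exact (h2.trans h5.le)
  have : (0 : ℝ) < ((n : ℝ) + 2) ^ (m + 1) := by positivity
  unfold QQ
  linarith

lemma one_add_le_tangent (x : ℝ) : 1 + x ≤ 1.2136 * Real.exp (x / 2) := by
  have h := Real.add_one_le_exp ((x - 1) / 2)
  have h1 : Real.exp ((x - 1) / 2) = Real.exp (x / 2) * Real.exp (-(1 / 2)) := by
    rw [← Real.exp_add]; congr 1; ring
  have h2 : Real.exp (-(1 / 2)) ≤ 0.6068 := by
    have h := Real.exp_one_gt_d9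
    have h2 : Real.exp (1 / 2) ^ 2 = Real.exp 1 := by rw [← Real.exp_nat_mul]; norm_num
    have h3 : 1.6485 < Real.exp (1 / 2) := by
      by_contra hc
      push Not at hc
      nlinarith [Real.exp_pos (1 / 2)]
    rw [Real.exp_neg, inv_le_comm₀ (Real.exp_pos _) (by norm_num)]
    refine le_trans ?_ h3.le
    norm_num
  rw [h1] at h
  nlinarith [Real.exp_pos (x / 2)]

lemma QQ_one (m : ℕ) (hm : 9 ≤ m) : QQ 1 m ≤ 3 ^ (m + 1) := by
  have hm' : (9 : ℝ) ≤ m := by exact_mod_cast hm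
  have e : QQ 1 m = ((m : ℝ) + 4) * KK (((m : ℝ) + 3) / 4) (3 / 4) m := by
    unfold QQ
    have : ((1 + m + 2 : ℕ) : ℝ) = m + 3 := by push_cast; ring
    rw [this]; norm_num; ring
  rw [e]
  set τ : ℝ := ((m : ℝ) + 3) / 4 with hτ
  have hK : KK τ (3 / 4) m ≤ 1.2136 ^ 8 * Real.exp (2.203 * τ) := by
    obtain ⟨r, rfl⟩ : ∃ r, m = 8 + r := ⟨m - 8, by omega⟩
    have hτ0 : 0 ≤ τ := by positivity
    have h1 : KK τ (3 / 4) (8 + r) = KK τ (3 / 4) 8 * KK (τ * (3 / 4) ^ 8) (3 / 4) r := by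
      unfold KK
      rw [Finset.prod_range_add]
      congr 1
      apply Finset.prod_congr rfl
      intro i _; rw [pow_add]; ring
    have h2 := KK_le_exp (τ := τ * (3 / 4) ^ 8) (ρ := 3 / 4) (by positivity) (by norm_num) (by norm_num) r
    have h3 : KK τ (3 / 4) 8 ≤ 1.2136 ^ 8 * Real.exp (∑ i ∈ Finset.range 8, τ * (3 / 4) ^ i / 2) := by
      rw [Real.exp_sum]
      have : (1.2136 : ℝ) ^ 8 = ∏ i ∈ Finset.range 8, (1.2136 : ℝ) := by simp
      rw [this, ← Finset.prod_mul_distrib]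
      apply Finset.prod_le_prod
      · intro i _; positivity
      · intro i _; exact one_add_le_tangent _
    rw [h1]
    calc _ ≤ (1.2136 ^ 8 * Real.exp (∑ i ∈ Finset.range 8, τ * (3 / 4) ^ i / 2)) *
          Real.exp (τ * (3 / 4) ^ 8 / (1 - 3 / 4)) := by
            gcongr
            exact KK_nonneg (by positivity) (by norm_num) _
      _ = 1.2136 ^ 8 * Real.exp ((∑ i ∈ Finset.range 8, τ * (3 / 4) ^ i / 2) +
          τ * (3 / 4) ^ 8 / (1 - 3 / 4)) := by rw [mul_assoc, ← Real.exp_add]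
      _ ≤ _ := by
          gcongr
          norm_num [Finset.sum_range_succ]
          linarith
  have hexp : Real.exp (2.203 * τ) ≤ 1.7372 ^ (m + 3) := by
    have h1 : Real.exp (2.203 * τ) = Real.exp (0.55075) ^ (m + 3) := by
      rw [← Real.exp_nat_mul]; congr 1; rw [hτ]; push_cast; ring
    rw [h1]
    apply pow_le_pow_left₀ (Real.exp_pos _).le
    have h2 : Real.exp (0.55075) = Real.exp (1 / 2) * Real.exp (0.05075) := by
      rw [← Real.exp_add]; norm_num
    have h3 : Real.exp (1 / 2) ≤ 1.6488 := by
      have h := Real.exp_one_lt_d9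
      have h2 : Real.exp (1 / 2) ^ 2 = Real.exp 1 := by rw [← Real.exp_nat_mul]; norm_num
      by_contra hc
      push Not at hc
      nlinarith
    have h4 : Real.exp (0.05075) ≤ 1.0535 := by
      have := Real.add_one_le_exp (-(0.05075) : ℝ)
      rw [Real.exp_neg] at this
      have h6 := inv_anti₀ (by norm_num) this
      rw [inv_inv] at h6
      refine h6.trans ?_
      norm_num
    rw [h2]
    have := mul_le_mul h3 h4 (Real.exp_pos _).le (by norm_num)
    refine this.trans ?_
    norm_num
  have hfin : ∀ m : ℕ, 9 ≤ m → ((m : ℝ) + 4) * (1.2136 ^ 8 * 1.7372 ^ (m + 3)) ≤ 3 ^ (m + 1) := by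
    intro m hm
    induction m, hm using Nat.le_induction with
    | base => norm_num
    | succ m hm ih =>
      have : (9 : ℝ) ≤ m := by exact_mod_cast hm
      have h0 : (0 : ℝ) < 1.2136 ^ 8 * 1.7372 ^ (m + 3) := by positivity
      rw [pow_succ (3 : ℝ) (m + 1), show m + 1 + 3 = (m + 3) + 1 by ring, pow_succ (1.7372 : ℝ)]
      push_cast
      nlinarith
  calc _ ≤ ((m : ℝ) + 4) * (1.2136 ^ 8 * 1.7372 ^ (m + 3)) := by
        gcongr
        refine hK.trans ?_
        gcongr
    _ ≤ _ := hfin m hm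


/-- the target quantity -/
noncomputable def TT (n l : ℕ) : ℝ :=
  ((n : ℝ) + l + 1) * (n + l) / 2 + 2 ^ (l * (l - 1) / 2) * ((n : ℝ) + 2) ^ l

lemma TT_ge (n m : ℕ) (x : ℝ) (h : x ≤ ((n : ℝ) + 2) ^ (m + 1)) :
    2 ^ ((m + 1) * m / 2) * x ≤ TT n (m + 1) := by
  unfold TT
  have : (2 : ℝ) ^ ((m + 1) * m / 2) * x ≤ 2 ^ ((m + 1) * m / 2) * ((n : ℝ) + 2) ^ (m + 1) := by
    gcongr
  have h2 : (0 : ℝ) ≤ ((n : ℝ) + (m + 1 : ℕ) + 1) * (n + (m + 1 : ℕ)) / 2 := by positivity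
  simp only [Nat.add_sub_cancel]
  linarith

lemma num_large (n l : ℕ) (hn : l + 1 ≤ n) : Mb n l / 2 ≤ TT n l := by
  rcases l with _ | m
  · simp only [Mb, TT]; norm_num
    positivity
  rcases le_or_gt 6 m with hm | hm
  · have h1 := Mb_le_QQ n m (by omega)
    have h2 := QQ_large_n n m hm (by omega)
    have h3 := TT_ge n m _ h2
    linarith
  · obtain ⟨t, rfl⟩ : ∃ t, n = m + 2 + t := ⟨n - (m + 2), by omega⟩
    rw [← sub_nonneg]
    interval_cases m <;> simp only [Mb, TT, rr] <;> push_cast <;> ring_nf <;> positivity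

lemma num_small_mid (n m : ℕ) (h1n : 1 ≤ n) (hn : n ≤ m + 1) (hm : m < 9) (hm3 : 3 ≤ m) :
    QQ n m ≤ ((n : ℝ) + 2) ^ (m + 1) := by
  unfold QQ KK
  interval_cases m <;> interval_cases n <;> norm_num [Finset.prod_range_succ]

lemma num_small (n l : ℕ) (h1n : 1 ≤ n) (hn : n ≤ l) : Mb n l ≤ TT n l := by
  rcases l with _ | m
  · omega
  rcases le_or_gt 3 m with hm3 | hm3
  · have h1 := Mb_le_QQ n m (by omega)
    refine h1.trans (TT_ge n m _ ?_)
    rcases le_or_gt 9 m with hm | hm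
    · rcases Nat.lt_or_ge n 2 with h | h
      · have : n = 1 := by omega
        subst this
        have := QQ_one m hm
        norm_num
        exact this
      · exact QQ_small_n n m hm hn h
    · exact num_small_mid n m h1n hn hm hm3
  · interval_cases m <;> interval_cases n <;> norm_num [Mb, TT, rr]

end Numerics


/-! ## Topology: components of the zero set -/
section Topo
open Set Filter Topology

variable {n : ℕ}

lemma isDiscrete_range_int : IsDiscrete (Set.range ((↑) : ℤ → ℝ)) := by
  refine ⟨?_⟩
  exact (Int.isClosedEmbedding_coe_real.toIsEmbedding.toHomeomorph).symm.isEmbedding.discreteTopology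

lemma int_eq_of_close {x y : ℝ} (hx : ∃ k : ℤ, x = k) (hy : ∃ k : ℤ, y = k) (h : |x - y| < 1) : x = y := by
  obtain ⟨a, rfl⟩ := hx
  obtain ⟨b, rfl⟩ := hy
  have : |a - b| < 1 := by exact_mod_cast h
  have := Int.abs_lt_one_iff.1 this
  have : a = b := by omega
  rw [this]

lemma jump_fun {g : (Fin n → ℝ) → ℝ} (hg : Continuous g) {A B : Set (Fin n → ℝ)}
    (hA : IsClosed A) (hB : IsClosed B) (hAn : A.Nonempty) (hBn : B.Nonempty)
    (hAB : Disjoint A B) (hU : ∀ y, g y = 0 ↔ y ∈ A ∨ y ∈ B) :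
    ∃ H : (Fin n → ℝ) → ℝ,
      (∀ S : Set (Fin n → ℝ), IsPreconnected S → (S ⊆ {y | 0 < g y} ∨ S ⊆ {y | g y < 0}) →
        ∀ x ∈ S, ∀ y ∈ S, H x = H y) ∧
      (∀ z ∈ A, ∃ U ∈ 𝓝 z, ∀ u ∈ U, ∀ v ∈ U, g u < 0 → 0 < g v → H v = H u + 1) ∧
      (∀ z ∈ B, ∃ U ∈ 𝓝 z, ∀ u ∈ U, ∀ v ∈ U, g u < 0 → 0 < g v → H v = H u) := by
  classical
  set d1 : (Fin n → ℝ) → ℝ := fun y => Metric.infDist y A with hd1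
  set d2 : (Fin n → ℝ) → ℝ := fun y => Metric.infDist y B with hd2
  have hd1c : Continuous d1 := Metric.continuous_infDist_pt A
  have hd2c : Continuous d2 := Metric.continuous_infDist_pt B
  have hA1 : ∀ y ∈ A, d1 y = 0 := fun y hy => Metric.infDist_zero_of_mem hy
  have hB1 : ∀ y ∈ B, d2 y = 0 := fun y hy => Metric.infDist_zero_of_mem hy
  have hA2 : ∀ y ∈ A, 0 < d2 y := fun y hy =>
    (hB.notMem_iff_infDist_pos hBn).1 (disjoint_left.1 hAB hy)
  have hB2 : ∀ y ∈ B, 0 < d1 y := fun y hy =>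
    (hA.notMem_iff_infDist_pos hAn).1 (disjoint_right.1 hAB hy)
  set D : (Fin n → ℝ) → ℝ := fun y => |g y| + max (d2 y - d1 y) 0 with hD
  have hDc : Continuous D := by fun_prop
  set r : (Fin n → ℝ) → ℝ := fun y => 1 / 2 + g y / (2 * D y) with hr
  have hDpos1 : ∀ y, g y ≠ 0 → 0 < D y := fun y hy => by
    have := abs_pos.2 hy
    have := le_max_right (d2 y - d1 y) 0
    simp only [hD]; linarith
  have hDpos2 : ∀ y, d1 y ≤ d2 y → 0 < D y := fun y hy => by
    by_cases h0 : g y = 0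
    · rcases (hU y).1 h0 with h | h
      · have h1 := hA1 y h
        have h2 := hA2 y h
        have := le_max_left (d2 y - d1 y) 0
        have := abs_nonneg (g y)
        simp only [hD]; linarith
      · have h1 := hB1 y h
        have h2 := hB2 y h
        linarith
    · exact hDpos1 y h0
  have hrc : ∀ y, 0 < D y → ContinuousAt r y := fun y hy => by
    apply ContinuousAt.add continuousAt_const
    apply ContinuousAt.div hg.continuousAt (by fun_prop)
    linarith
  have hr1 : ∀ y, d2 y ≤ d1 y → 0 < g y → r y = 1 := fun y h1 h2 => by
    simp only [hr, hD]
    rw [max_eq_right (by linarith), abs_of_pos h2]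
    field_simp; ring
  have hr0 : ∀ y, d2 y ≤ d1 y → g y < 0 → r y = 0 := fun y h1 h2 => by
    simp only [hr, hD]
    rw [max_eq_right (by linarith), abs_of_neg h2]
    have : g y ≠ 0 := h2.ne
    rw [add_zero, mul_neg, div_neg]
    field_simp; ring
  set θ : (Fin n → ℝ) → AddCircle (1 : ℝ) := fun y => if d1 y ≤ d2 y then ((r y : ℝ) : AddCircle (1 : ℝ)) else 0 with hθ
  have hcoe1 : ((1 : ℝ) : AddCircle (1 : ℝ)) = 0 := AddCircle.coe_period 1
  have hcoe : ∀ y, g y ≠ 0 → d2 y ≤ d1 y → ((r y : ℝ) : AddCircle (1 : ℝ)) = 0 := fun y h0 h1 => by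
    rcases lt_or_gt_of_ne h0 with h | h
    · rw [hr0 y h1 h]; rfl
    · rw [hr1 y h1 h]; exact hcoe1
  have hθc : Continuous θ := by
    apply continuous_if_le hd1c hd2c
    · intro y hy
      exact ((AddCircle.continuous_mk' (1 : ℝ)).continuousAt.comp (hrc y (hDpos2 y hy))).continuousWithinAt
    · exact continuousOn_const
    · intro y hy
      apply hcoe y _ hy.ge
      intro h0
      rcases (hU y).1 h0 with h | h
      · have h1 := hA1 y h
        have h2 := hA2 y h
        linarith
      · have h1 := hB1 y h
        have h2 := hB2 y h
        linarith
  have hθr : ∀ y, g y ≠ 0 → θ y = ((r y : ℝ) : AddCircle (1 : ℝ)) := fun y h0 => by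
    simp only [hθ]
    split_ifs with h
    · rfl
    · exact (hcoe y h0 (by linarith)).symm
  obtain ⟨e0, he0⟩ := QuotientAddGroup.mk_surjective (θ 0)
  obtain ⟨F, ⟨-, hF⟩, -⟩ := (AddCircle.isCoveringMap_coe (1 : ℝ)).existsUnique_continuousMap_lifts
    ⟨θ, hθc⟩ 0 e0 he0
  have hFθ : ∀ y, ((F y : ℝ) : AddCircle (1 : ℝ)) = θ y := fun y => congrFun hF y
  have hgInt : ∀ y, g y ≠ 0 → ∃ k : ℤ, F y - r y = k := fun y h0 => by
    have h1 : ((F y - r y : ℝ) : AddCircle (1 : ℝ)) = 0 := by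
      rw [AddCircle.coe_sub, hFθ, hθr y h0, sub_self]
    obtain ⟨k, hk⟩ := (AddCircle.coe_eq_zero_iff (1 : ℝ)).1 h1
    exact ⟨k, by rw [← hk]; simp⟩
  have hFc : Continuous F := F.continuous
  refine ⟨fun y => F y - r y + if 0 < g y then 1 else 0, ?_, ?_, ?_⟩
  · intro S hS hSg x hx y hy
    have hne : ∀ z ∈ S, g z ≠ 0 := fun z hz => by
      rcases hSg with h | h
      · exact (h hz).ne'
      · exact (h hz).ne
    have h1 : F x - r x = F y - r y := by
      refine hS.constant_of_mapsTo isDiscrete_range_int (f := fun z => F z - r z) ?_ ?_ hx hy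
      · intro z hz
        exact (hFc.continuousAt.sub (hrc z (hDpos1 z (hne z hz)))).continuousWithinAt
      · intro z hz
        obtain ⟨k, hk⟩ := hgInt z (hne z hz)
        exact ⟨k, hk.symm⟩
    simp only [h1]
    congr 1
    rcases hSg with h | h
    · have h1 : 0 < g x := h hx
      have h2 : 0 < g y := h hy
      simp [h1, h2]
    · have h1 : g x < 0 := h hx
      have h2 : g y < 0 := h hy
      simp [h1.not_gt, h2.not_gt]
  · intro z hz
    have hcont : ContinuousAt (fun y => F y - r y) z :=
      hFc.continuousAt.sub (hrc z (hDpos2 z (by rw [hA1 z hz]; exact (hA2 z hz).le)))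
    refine ⟨_, Metric.continuousAt_iff'.1 hcont (1 / 2) (by norm_num), ?_⟩
    intro u hu v hv hgu hgv
    have hu' : |F u - r u - (F z - r z)| < 1 / 2 := hu
    have hv' : |F v - r v - (F z - r z)| < 1 / 2 := hv
    have : F v - r v = F u - r u := by
      apply int_eq_of_close (hgInt v hgv.ne') (hgInt u hgu.ne)
      rw [abs_lt] at hu' hv' ⊢
      constructor <;> linarith
    simp [this, hgv, hgu.not_gt]
  · intro z hz
    have h1 : ∀ᶠ y in 𝓝 z, d2 y < d1 y := by
      apply hd2c.continuousAt.eventually_lt hd1c.continuousAt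
      rw [hB1 z hz]; exact hB2 z hz
    refine ⟨_, (Metric.continuousAt_iff'.1 hFc.continuousAt (1 / 2) (by norm_num)).and h1, ?_⟩
    intro u hu v hv hgu hgv
    have hu' : |F u - F z| < 1 / 2 := hu.1
    have hv' : |F v - F z| < 1 / 2 := hv.1
    have e1 := hr0 u hu.2.le hgu
    have e2 := hr1 v hv.2.le hgv
    have : F v = F u := by
      apply int_eq_of_close
      · obtain ⟨k, hk⟩ := hgInt v hgv.ne'
        exact ⟨k + 1, by rw [e2] at hk; push_cast; linarith⟩
      · obtain ⟨k, hk⟩ := hgInt u hgu.ne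
        exact ⟨k, by rw [e1] at hk; linarith⟩
      · rw [abs_lt] at hu' hv' ⊢
        constructor <;> linarith
    simp [this, hgv, hgu.not_gt, e1, e2]

/-- at most `P` components -/
def CompLe (Ω : Set (Fin n → ℝ)) (P : ℕ) : Prop :=
  ∀ W : Finset (Fin n → ℝ), (∀ w ∈ W, w ∈ Ω) →
    Set.InjOn (fun w => connectedComponentIn Ω w) (W : Set (Fin n → ℝ)) → W.card ≤ P

lemma exists_reps (Ω : Set (Fin n → ℝ)) (V : Finset (Fin n → ℝ)) :
    ∃ W ⊆ V, Set.InjOn (fun w => connectedComponentIn Ω w) (W : Set (Fin n → ℝ)) ∧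
      ∀ v ∈ V, ∃ w ∈ W, connectedComponentIn Ω w = connectedComponentIn Ω v := by
  classical
  obtain ⟨W, hW, hinj, him⟩ := Finset.exists_subset_injOn_image_eq_of_surjOn
    (f := fun w => connectedComponentIn Ω w) V (V.image fun w => connectedComponentIn Ω w)
    (by intro x hx; simpa using hx)
  refine ⟨W, hW, hinj, fun v hv => ?_⟩
  have : connectedComponentIn Ω v ∈ W.image (fun w => connectedComponentIn Ω w) := by
    rw [him]; exact Finset.mem_image_of_mem _ hv
  exact Finset.mem_image.1 this

lemma top_bound {g : (Fin n → ℝ) → ℝ} (hg : Continuous g)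
    (hsc : ∀ z, g z = 0 → ∀ U ∈ 𝓝 z, (∃ u ∈ U, g u < 0) ∧ ∃ v ∈ U, 0 < g v)
    (P Q : ℕ) (hP : CompLe {y | 0 < g y} P) (hQ : CompLe {y | g y < 0} Q)
    {ι : Type} [Fintype ι] [DecidableEq ι] [Nonempty ι] (Zi : ι → Set (Fin n → ℝ))
    (hcl : ∀ i, IsClosed (Zi i)) (hne : ∀ i, (Zi i).Nonempty)
    (hdisj : ∀ i j, i ≠ j → Disjoint (Zi i) (Zi j))
    (hU : ∀ y, g y = 0 ↔ ∃ i, y ∈ Zi i) : Fintype.card ι + 1 ≤ P + Q := by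
  classical
  choose z hz using hne
  have hgz : ∀ i, g (z i) = 0 := fun i => (hU _).2 ⟨i, hz i⟩
  rcases subsingleton_or_nontrivial ι with hsub | hnt
  · have h1 : Fintype.card ι ≤ 1 := Fintype.card_le_one_iff_subsingleton.2 hsub
    obtain ⟨⟨u, -, hu⟩, v, -, hv⟩ := hsc _ (hgz (Classical.arbitrary ι)) Set.univ univ_mem
    have h2 := hP {v} (by simpa using hv) (by simp)
    have h3 := hQ {u} (by simpa using hu) (by simp)
    simp at h2 h3
    omega
  have hH : ∀ i, _ := fun i => jump_fun hg (A := Zi i) (B := ⋃ j : {j // j ≠ i}, Zi j) (hcl i)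
    (isClosed_iUnion_of_finite fun j => hcl j) ⟨z i, hz i⟩ (by
      obtain ⟨j, hj⟩ := exists_ne i
      exact ⟨z j, mem_iUnion.2 ⟨⟨j, hj⟩, hz j⟩⟩)
    (by
      rw [disjoint_iUnion_right]
      intro j; exact hdisj _ _ j.2.symm)
    (by
      intro y
      rw [hU]
      constructor
      · rintro ⟨j, hj⟩
        by_cases h : j = i
        · left; rwa [← h]
        · right; exact mem_iUnion.2 ⟨⟨j, h⟩, hj⟩
      · rintro (h | h)
        · exact ⟨i, h⟩
        · obtain ⟨j, hj⟩ := mem_iUnion.1 h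
          exact ⟨j, hj⟩)
  choose H hconst hjA hjB using hH
  have huv : ∀ j, ∃ u v, g u < 0 ∧ 0 < g v ∧ ∀ i, H i v = H i u + if i = j then 1 else 0 := by
    intro j
    have : ∀ i, ∃ U ∈ 𝓝 (z j), ∀ u ∈ U, ∀ v ∈ U, g u < 0 → 0 < g v →
        H i v = H i u + if i = j then 1 else 0 := by
      intro i
      by_cases h : i = j
      · subst h
        simpa using hjA i (z i) (hz i)
      · simpa [h] using hjB i (z j) (mem_iUnion.2 ⟨⟨j, fun h' => h h'.symm⟩, hz j⟩)
    choose U hUn hUj using this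
    obtain ⟨⟨u, hu, hgu⟩, v, hv, hgv⟩ := hsc _ (hgz j) (⋂ i, U i) (iInter_mem.2 hUn)
    rw [mem_iInter] at hu hv
    exact ⟨u, v, hgu, hgv, fun i => hUj i u (hu i) v (hv i) hgu hgv⟩
  choose u v hgu hgv huv using huv
  obtain ⟨Wp, hWp, hWpinj, hWpr⟩ := exists_reps {y | 0 < g y} (Finset.univ.image v)
  obtain ⟨Wm, hWm, hWminj, hWmr⟩ := exists_reps {y | g y < 0} (Finset.univ.image u)
  have hcp : Wp.card ≤ P := hP Wp (fun w hw => by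
    obtain ⟨j, -, rfl⟩ := Finset.mem_image.1 (hWp hw); exact hgv j) hWpinj
  have hcm : Wm.card ≤ Q := hQ Wm (fun w hw => by
    obtain ⟨j, -, rfl⟩ := Finset.mem_image.1 (hWm hw); exact hgu j) hWminj
  -- the linear algebra
  let vec : Option ι → (Wp ⊕ Wm → ℝ) := fun o => match o with
    | none => fun _ => 1
    | some i => Sum.elim (fun w => H i w) (fun w => H i w)
  have hLI : LinearIndependent ℝ vec := by
    rw [Fintype.linearIndependent_iff]
    intro c hc
    rw [Fintype.sum_option] at hc
    have hp : ∀ j, c none + ∑ i, c (some i) * H i (v j) = 0 := by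
      intro j
      obtain ⟨w, hw, hwe⟩ := hWpr (v j) (Finset.mem_image_of_mem _ (Finset.mem_univ j))
      have := congrFun hc (Sum.inl ⟨w, hw⟩)
      simp only [vec, Pi.add_apply, Pi.smul_apply, Finset.sum_apply, Sum.elim_inl, smul_eq_mul, mul_one,
        Pi.zero_apply] at this
      rw [← this]
      congr 1
      apply Finset.sum_congr rfl
      intro i _
      congr 1
      have hwm : w ∈ {y | 0 < g y} := by
        obtain ⟨j, -, rfl⟩ := Finset.mem_image.1 (hWp hw); exact hgv j
      refine hconst i (connectedComponentIn {y | 0 < g y} w) isPreconnected_connectedComponentIn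
        (Or.inl (connectedComponentIn_subset _ _)) _ ?_ _ (mem_connectedComponentIn hwm)
      rw [hwe]; exact mem_connectedComponentIn (hgv j)
    have hm : ∀ j, c none + ∑ i, c (some i) * H i (u j) = 0 := by
      intro j
      obtain ⟨w, hw, hwe⟩ := hWmr (u j) (Finset.mem_image_of_mem _ (Finset.mem_univ j))
      have := congrFun hc (Sum.inr ⟨w, hw⟩)
      simp only [vec, Pi.add_apply, Pi.smul_apply, Finset.sum_apply, Sum.elim_inr, smul_eq_mul, mul_one,
        Pi.zero_apply] at this
      rw [← this]
      congr 1
      apply Finset.sum_congr rfl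
      intro i _
      congr 1
      have hwm : w ∈ {y | g y < 0} := by
        obtain ⟨j, -, rfl⟩ := Finset.mem_image.1 (hWm hw); exact hgu j
      refine hconst i (connectedComponentIn {y | g y < 0} w) isPreconnected_connectedComponentIn
        (Or.inr (connectedComponentIn_subset _ _)) _ ?_ _ (mem_connectedComponentIn hwm)
      rw [hwe]; exact mem_connectedComponentIn (hgu j)
    have hs : ∀ j, c (some j) = 0 := by
      intro j
      have h1 := hp j
      simp only [huv j, mul_add, Finset.sum_add_distrib] at h1
      simp only [mul_ite, mul_one, mul_zero, Finset.sum_ite_eq', Finset.mem_univ, if_true] at h1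
      have h2 := hm j
      linarith
    intro o
    rcases o with _ | j
    · have := hp (Classical.arbitrary ι)
      simpa [hs] using this
    · exact hs j
  have := hLI.fintype_card_le_finrank
  rw [Module.finrank_fintype_fun_eq_card, Fintype.card_sum, Fintype.card_option, Fintype.card_coe,
    Fintype.card_coe] at this
  omega

lemma components_of_locConst {X : Type*} [TopologicalSpace X] (K : ℕ)
    (h : ∀ f : X → ℕ, IsLocallyConstant f → ∀ s : Finset ℕ, (s : Set ℕ) ⊆ range f → s.card ≤ K) :
    Finite (ConnectedComponents X) ∧ Nat.card (ConnectedComponents X) ≤ K := by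
  classical
  have hfin : ∀ f : X → ℕ, IsLocallyConstant f → (range f).Finite ∧ (range f).ncard ≤ K := by
    intro f hf
    have : (range f).Finite := by
      by_contra hc
      obtain ⟨s, hs, hs2⟩ := (show (range f).Infinite from hc).exists_subset_card_eq (K + 1)
      have := h f hf s hs
      omega
    refine ⟨this, ?_⟩
    rw [Set.ncard_eq_toFinset_card _ this]
    exact h f hf _ (by simp)
  let S : Set ℕ := {m | ∃ f : X → ℕ, IsLocallyConstant f ∧ (range f).ncard = m}
  have hSne : S.Nonempty := ⟨_, fun _ => 0, IsLocallyConstant.const 0, rfl⟩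
  have hSb : BddAbove S := ⟨K, by rintro m ⟨f, hf, rfl⟩; exact (hfin f hf).2⟩
  obtain ⟨f, hf, hfm⟩ := Nat.sSup_mem hSne hSb
  have hmax : ∀ f' : X → ℕ, IsLocallyConstant f' → (range f').ncard ≤ (range f).ncard := by
    intro f' hf'
    rw [hfm]; exact le_csSup hSb ⟨f', hf', rfl⟩
  have hpre : ∀ i, IsPreconnected (f ⁻¹' {i}) := by
    intro i u v hu hv huv hnu hnv
    by_contra hemp
    rw [not_nonempty_iff_eq_empty] at hemp
    have hFo : IsOpen (f ⁻¹' {i}) := hf.isOpen_fiber i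
    obtain ⟨M, hM⟩ := Infinite.exists_notMem_finset (hfin f hf).1.toFinset
    rw [Set.Finite.mem_toFinset] at hM
    have hAo : IsOpen (f ⁻¹' {i} ∩ v) := hFo.inter hv
    have hAc : IsClosed (f ⁻¹' {i} ∩ v) := by
      have : (f ⁻¹' {i} ∩ v)ᶜ = (f ⁻¹' {i})ᶜ ∪ (f ⁻¹' {i} ∩ u) := by
        ext x
        have h1 : x ∉ f ⁻¹' {i} ∩ (u ∩ v) := by rw [hemp]; simp
        have h2 := @huv x
        simp only [mem_compl_iff, mem_inter_iff, mem_union] at *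
        tauto
      rw [← isOpen_compl_iff, this]
      exact (hf.isClosed_fiber i).isOpen_compl.union (hFo.inter hu)
    let f' : X → ℕ := fun x => if x ∈ f ⁻¹' {i} ∩ v then M else f x
    have hf' : IsLocallyConstant f' := by
      rw [IsLocallyConstant.iff_eventually_eq]
      intro x
      by_cases hx : x ∈ f ⁻¹' {i} ∩ v
      · filter_upwards [hAo.mem_nhds hx] with y hy
        simp only [f', if_pos hx, if_pos hy]
      · filter_upwards [hAc.isOpen_compl.mem_nhds hx, (IsLocallyConstant.iff_eventually_eq f).1 hf x] with y hy hy2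
        simp only [f', if_neg hx, if_neg hy, hy2]
    have hsub : insert M (range f) ⊆ range f' := by
      rintro m (rfl | ⟨x, rfl⟩)
      · obtain ⟨x, hx⟩ := hnv
        exact ⟨x, by simp only [f', if_pos hx]⟩
      · by_cases hx : x ∈ f ⁻¹' {i} ∩ v
        · obtain ⟨x', hx'⟩ := hnu
          refine ⟨x', ?_⟩
          have h1 : x' ∉ f ⁻¹' {i} ∩ v := fun h3 => by
            have : x' ∈ f ⁻¹' {i} ∩ (u ∩ v) := ⟨h3.1, hx'.2, h3.2⟩
            rw [hemp] at this; exact this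
          simp only [f', if_neg h1]
          have e1 : f x' = i := hx'.1
          have e2 : f x = i := hx.1
          rw [e1, e2]
        · exact ⟨x, by simp only [f', if_neg hx]⟩
    have h1 := Set.ncard_le_ncard hsub (hfin f' hf').1
    rw [Set.ncard_insert_of_notMem hM (hfin f hf).1] at h1
    have := hmax f' hf'
    omega
  have : Finite (range f) := (hfin f hf).1
  have hc : Continuous f := hf.continuous
  let F : ConnectedComponents X → range f := fun q =>
    ⟨hc.connectedComponentsLift q, by
      obtain ⟨x, rfl⟩ := ConnectedComponents.surjective_coe q
      exact ⟨x, rfl⟩⟩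
  have hF : Function.Injective F := by
    intro p q hpq
    obtain ⟨x, rfl⟩ := ConnectedComponents.surjective_coe p
    obtain ⟨y, rfl⟩ := ConnectedComponents.surjective_coe q
    have hxy : f x = f y := congrArg Subtype.val hpq
    rw [ConnectedComponents.coe_eq_coe']
    exact (hpre (f y)).subset_connectedComponent (by simp) (by simpa using hxy)
  refine ⟨Finite.of_injective F hF, (Nat.card_le_card_of_injective F hF).trans ?_⟩
  exact (hfin f hf).2

theorem comps_bound {g : (Fin n → ℝ) → ℝ} (hg : Continuous g)
    (hsc : ∀ z, g z = 0 → ∀ U ∈ 𝓝 z, (∃ u ∈ U, g u < 0) ∧ ∃ v ∈ U, 0 < g v)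
    (P Q K : ℕ) (hP : CompLe {y | 0 < g y} P) (hQ : CompLe {y | g y < 0} Q) (hK : P + Q ≤ K + 1) :
    Finite (ConnectedComponents {y : Fin n → ℝ // g y = 0}) ∧
      Nat.card (ConnectedComponents {y : Fin n → ℝ // g y = 0}) ≤ K := by
  classical
  apply components_of_locConst
  intro f hf s hs
  rcases s.eq_empty_or_nonempty with rfl | ⟨i0, hi0⟩
  · simp
  -- use all values outside `s` together with `i0`
  let f' : {y : Fin n → ℝ // g y = 0} → ℕ := fun x => if f x ∈ s then f x else i0
  have hf' : IsLocallyConstant f' := hf.comp (fun m => if m ∈ s then m else i0)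
  have : Nonempty s := ⟨⟨i0, hi0⟩⟩
  have hZc : IsClosed {y : Fin n → ℝ | g y = 0} := isClosed_eq hg continuous_const
  have := top_bound hg hsc P Q hP hQ (ι := s) (fun i => Subtype.val '' (f' ⁻¹' {(i : ℕ)}))
    (fun i => hZc.isClosedEmbedding_subtypeVal.isClosedMap _ (hf'.isClosed_fiber _))
    (fun i => by
      obtain ⟨x, hx⟩ := hs i.2
      refine ⟨x.1, x, ?_, rfl⟩
      simp [f', hx])
    (fun i j hij => by
      rw [disjoint_left]
      rintro _ ⟨x, hx, rfl⟩ ⟨y, hy, hxy⟩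
      have : x = y := Subtype.ext hxy.symm
      subst this
      apply hij
      ext
      have e1 : f' x = i := hx
      have e2 : f' x = j := hy
      rw [← e1, ← e2])
    (fun y => by
      constructor
      · intro hy
        refine ⟨⟨f' ⟨y, hy⟩, ?_⟩, ⟨y, hy⟩, rfl, rfl⟩
        simp only [f']; split_ifs with h
        · exact h
        · exact hi0
      · rintro ⟨i, x, -, rfl⟩
        exact x.2)
  rw [Fintype.card_coe] at this
  omega

end Topo


/-! ## Generic coefficients -/
section Generic
open Set Filter Topology Matrix

variable {n N : ℕ}

/-- normalised monomials -/
noncomputable def nX (a : Fin N → Fin n → ℝ) (y : Fin n → ℝ) : Fin N → ℝ :=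
  fun j => Real.exp (∑ i, a j i * y i) / ∑ j', Real.exp (∑ i, a j' i * y i)

/-- homogenised exponent matrix restricted to a subset of the monomials -/
noncomputable def hM (a : Fin N → Fin n → ℝ) (Γ : Finset (Fin N)) : Matrix (Fin N) (Option (Fin n)) ℝ :=
  fun j o => if j ∈ Γ then (match o with
    | none => 1
    | some i => a j i) else 0

lemma hM_mulVec (a : Fin N → Fin n → ℝ) (Γ : Finset (Fin N)) (p : Option (Fin n) → ℝ) (j : Fin N) :
    (hM a Γ *ᵥ p) j = if j ∈ Γ then p none + ∑ i, a j i * p (some i) else 0 := by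
  simp only [mulVec, dotProduct, hM]
  split_ifs with h
  · rw [Fintype.sum_option]; simp
  · simp

lemma hMT_mulVec_eq_zero (a : Fin N → Fin n → ℝ) (Γ : Finset (Fin N)) (β : Fin N → ℝ)
    (h0 : ∑ j ∈ Γ, β j = 0) (h1 : ∀ i, ∑ j ∈ Γ, β j * a j i = 0) : (hM a Γ)ᵀ *ᵥ β = 0 := by
  ext o
  simp only [mulVec, dotProduct, hM, transpose_apply, ite_mul, zero_mul, Pi.zero_apply]
  rw [Finset.sum_ite_mem, Finset.univ_inter]
  rcases o with _ | i
  · simpa using h0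
  · simpa [mul_comm] using h1 i

lemma dim_strat (a : Fin N → Fin n → ℝ) (Γ : Finset (Fin N)) (hΓ : Γ.Nonempty) :
    dimH {c : Fin N → ℝ | ∃ y : Fin n → ℝ, (∑ j ∈ Γ, c j * Real.exp (∑ i, a j i * y i) = 0) ∧
      ∀ i', ∑ j ∈ Γ, c j * Real.exp (∑ i, a j i * y i) * a j i' = 0} ≤ ((N - 1 : ℕ) : ENNReal) := by
  classical
  set M := hM a Γ with hMdef
  set R := LinearMap.range M.mulVecLin with hR
  set Ke := LinearMap.ker (Mᵀ).mulVecLin with hKe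
  let one : Fin N → ℝ := fun j => if j ∈ Γ then 1 else 0
  have hone0 : one ≠ 0 := by
    obtain ⟨j, hj⟩ := hΓ
    intro h
    have := congrFun h j
    simp [one, hj] at this
  have honeR : one ∈ R := by
    refine ⟨fun o => match o with | none => 1 | some _ => 0, ?_⟩
    ext j
    rw [mulVecLin_apply, hMdef, hM_mulVec]
    simp [one]
  obtain ⟨R3, hR3⟩ := Submodule.exists_isCompl (Submodule.span ℝ {one})
  set R2 := R3 ⊓ R with hR2
  have hdimR : Module.finrank ℝ R2 + 1 ≤ Module.finrank ℝ R := by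
    have h1 := Submodule.finrank_sup_add_finrank_inf_eq R2 (Submodule.span ℝ {one})
    have h2 : R2 ⊓ Submodule.span ℝ {one} = ⊥ := by
      rw [eq_bot_iff]
      rintro x ⟨hx1, hx2⟩
      have : x ∈ Submodule.span ℝ {one} ⊓ R3 := ⟨hx2, hx1.1⟩
      rwa [hR3.inf_eq_bot] at this
    rw [h2, finrank_bot, add_zero, finrank_span_singleton hone0] at h1
    rw [← h1]
    apply Submodule.finrank_mono
    apply sup_le inf_le_right
    rw [Submodule.span_singleton_le_iff_mem]; exact honeR
  have hdimK : Module.finrank ℝ Ke + Module.finrank ℝ R = N := by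
    have h1 := LinearMap.finrank_range_add_finrank_ker (Mᵀ).mulVecLin
    have h2 : Module.finrank ℝ (LinearMap.range (Mᵀ).mulVecLin) = Module.finrank ℝ R := by
      have : (Mᵀ).rank = M.rank := rank_transpose M
      exact this
    rw [h2, Module.finrank_fintype_fun_eq_card, Fintype.card_fin] at h1
    rw [add_comm]; exact h1
  let Φ : Ke × R2 → (Fin N → ℝ) := fun p j => (p.1 : Fin N → ℝ) j * Real.exp (-((p.2 : Fin N → ℝ) j))
  have hΦ : ContDiff ℝ 1 Φ := by
    rw [contDiff_pi]
    intro j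
    have h1 : ContDiff ℝ 1 (fun p : Ke × R2 => (p.1 : Fin N → ℝ) j) :=
      (contDiff_apply ℝ ℝ j).comp (Ke.subtypeL.contDiff.comp contDiff_fst)
    have h2 : ContDiff ℝ 1 (fun p : Ke × R2 => (p.2 : Fin N → ℝ) j) :=
      (contDiff_apply ℝ ℝ j).comp (R2.subtypeL.contDiff.comp contDiff_snd)
    exact h1.mul h2.neg.exp
  have hle := hΦ.dimH_range_le
  have hfin : Module.finrank ℝ (Ke × R2) ≤ N - 1 := by
    rw [Module.finrank_prod]; omega
  refine (dimH_mono ?_).trans (hle.trans (by exact_mod_cast hfin))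
  rintro c ⟨y, hy0, hy1⟩
  -- the exponent vector
  let w : Fin N → ℝ := fun j => if j ∈ Γ then ∑ i, a j i * y i else 0
  have hw : w ∈ R := by
    refine ⟨fun o => match o with | none => 0 | some i => y i, ?_⟩
    ext j
    rw [mulVecLin_apply, hMdef, hM_mulVec]
    simp [w]
  have : w ∈ Submodule.span ℝ {one} ⊔ R3 := by rw [hR3.sup_eq_top]; trivial
  obtain ⟨x, hx, w3, hw3, hxw⟩ := Submodule.mem_sup.1 this
  obtain ⟨t, rfl⟩ := Submodule.mem_span_singleton.1 hx
  have hw3R : w3 ∈ R := by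
    have : w3 = w - t • one := by rw [← hxw]; simp
    rw [this]; exact R.sub_mem hw (R.smul_mem _ honeR)
  let β : Fin N → ℝ := fun j => c j * Real.exp (w3 j)
  have hw3j : ∀ j ∈ Γ, w3 j = (∑ i, a j i * y i) - t := by
    intro j hj
    have := congrFun hxw j
    simp [one, w, hj] at this
    linarith
  have hβj : ∀ j ∈ Γ, β j = c j * Real.exp (∑ i, a j i * y i) * Real.exp (-t) := by
    intro j hj
    simp only [β]
    rw [hw3j j hj, sub_eq_add_neg, Real.exp_add]; ring
  have hβ : β ∈ Ke := by
    rw [hKe, LinearMap.mem_ker, mulVecLin_apply]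
    apply hMT_mulVec_eq_zero
    · rw [Finset.sum_congr rfl hβj, ← Finset.sum_mul, hy0, zero_mul]
    · intro i
      have : ∀ j ∈ Γ, β j * a j i = c j * Real.exp (∑ i, a j i * y i) * a j i * Real.exp (-t) := by
        intro j hj; rw [hβj j hj]; ring
      rw [Finset.sum_congr rfl this, ← Finset.sum_mul, hy1, zero_mul]
  refine ⟨(⟨β, hβ⟩, ⟨w3, hw3, hw3R⟩), ?_⟩
  ext j
  simp only [Φ, β]
  rw [mul_assoc, ← Real.exp_add]; simp

lemma nX_mem (a : Fin N → Fin n → ℝ) (hN : 0 < N) (y : Fin n → ℝ) : nX a y ∈ stdSimplex ℝ (Fin N) := by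
  have : Nonempty (Fin N) := ⟨⟨0, hN⟩⟩
  have hpos : 0 < ∑ j', Real.exp (∑ i, a j' i * y i) :=
    Finset.sum_pos (fun j _ => Real.exp_pos _) Finset.univ_nonempty
  refine ⟨fun j => by unfold nX; positivity, ?_⟩
  unfold nX
  rw [← Finset.sum_div, div_self hpos.ne']

/-- limits of normalised monomials are again monomials on their support -/
lemma nX_limit (a : Fin N → Fin n → ℝ) (hN : 0 < N) (X : Fin N → ℝ) (hX : X ∈ closure (range (nX a))) :
    ∃ (s : ℝ) (y : Fin n → ℝ), ∀ j, X j ≠ 0 → X j = Real.exp (s + ∑ i, a j i * y i) := by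
  classical
  have : Nonempty (Fin N) := ⟨⟨0, hN⟩⟩
  set Γ : Finset (Fin N) := Finset.univ.filter fun j => X j ≠ 0 with hΓ
  set R := LinearMap.range (hM a Γ).mulVecLin with hR
  have hRc : IsClosed (R : Set (Fin N → ℝ)) := R.closed_of_finiteDimensional
  have hXs : X ∈ stdSimplex ℝ (Fin N) :=
    closure_minimal (range_subset_iff.2 (nX_mem a hN)) (isClosed_stdSimplex ℝ (Fin N)) hX
  obtain ⟨u, hu, hlim⟩ := mem_closure_iff_seq_limit.1 hX
  choose y hy using hu
  have hmem : (fun j => if j ∈ Γ then Real.log (X j) else 0) ∈ (R : Set (Fin N → ℝ)) := by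
    refine hRc.mem_of_tendsto (b := atTop) (f := fun k j => if j ∈ Γ then Real.log (u k j) else 0) ?_ ?_
    · rw [tendsto_pi_nhds]
      intro j
      by_cases hj : j ∈ Γ
      · simp only [if_pos hj]
        have hj' : X j ≠ 0 := by simpa [hΓ] using hj
        exact ((tendsto_pi_nhds.1 hlim j).log hj')
      · simp only [if_neg hj]; exact tendsto_const_nhds
    · refine Eventually.of_forall fun k => ?_
      have hpos : 0 < ∑ j', Real.exp (∑ i, a j' i * y k i) :=
        Finset.sum_pos (fun j _ => Real.exp_pos _) Finset.univ_nonempty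
      refine ⟨fun o => match o with
        | none => - Real.log (∑ j', Real.exp (∑ i, a j' i * y k i)) | some i => y k i, ?_⟩
      ext j
      rw [mulVecLin_apply, hM_mulVec]
      split_ifs with hj
      · rw [← hy k, nX, Real.log_div (Real.exp_pos _).ne' hpos.ne', Real.log_exp]; ring
      · rfl
  obtain ⟨p, hp⟩ := hmem
  refine ⟨p none, fun i => p (some i), fun j hj => ?_⟩
  have hjΓ : j ∈ Γ := by simpa [hΓ] using hj
  have := congrFun hp j
  rw [mulVecLin_apply, hM_mulVec] at this
  simp only [if_pos hjΓ] at this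
  rw [this, Real.exp_log]
  exact lt_of_le_of_ne (hXs.1 j) hj.symm

theorem exists_generic (a : Fin N → Fin n → ℝ) (hN : 0 < N) :
    ∃ U : Set (Fin N → ℝ), IsOpen U ∧ Dense U ∧ ∀ c ∈ U, (∀ j, c j ≠ 0) ∧
      ∀ y : Fin n → ℝ, ∑ j, c j * Real.exp (∑ i, a j i * y i) = 0 →
        ∃ i', ∑ j, c j * Real.exp (∑ i, a j i * y i) * a j i' ≠ 0 := by
  classical
  have hNe : Nonempty (Fin N) := ⟨⟨0, hN⟩⟩
  set Xb := closure (range (nX a)) with hXb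
  have hXbs : Xb ⊆ stdSimplex ℝ (Fin N) :=
    closure_minimal (range_subset_iff.2 (nX_mem a hN)) (isClosed_stdSimplex ℝ (Fin N))
  have hXbc : IsCompact Xb := (isCompact_stdSimplex ℝ (Fin N)).of_isClosed_subset isClosed_closure hXbs
  have : CompactSpace Xb := isCompact_iff_compactSpace.1 hXbc
  let S' : Set ((Fin N → ℝ) × Xb) := {p | ∑ j, p.1 j * (p.2 : Fin N → ℝ) j = 0 ∧
    ∀ i', ∑ j, p.1 j * (p.2 : Fin N → ℝ) j * a j i' = 0}
  have hcj : ∀ j, Continuous fun p : (Fin N → ℝ) × Xb => p.1 j * (p.2 : Fin N → ℝ) j := by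
    intro j
    have h2 : Continuous fun p : (Fin N → ℝ) × Xb => (p.2 : Fin N → ℝ) j :=
      (continuous_apply j).comp (continuous_subtype_val.comp continuous_snd)
    have h1 : Continuous fun p : (Fin N → ℝ) × Xb => p.1 j := (continuous_apply j).comp continuous_fst
    exact h1.mul h2
  have hS'c : IsClosed S' := by
    have : S' = {p | ∑ j, p.1 j * (p.2 : Fin N → ℝ) j = 0} ∩
      ⋂ i', {p | ∑ j, p.1 j * (p.2 : Fin N → ℝ) j * a j i' = 0} := by
      ext p; simp [S']
    rw [this]
    apply IsClosed.inter
    · exact isClosed_eq (continuous_finsetSum _ fun j _ => hcj j) continuous_const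
    · apply isClosed_iInter
      intro i'
      exact isClosed_eq (continuous_finsetSum _ fun j _ => (hcj j).mul continuous_const) continuous_const
  set S := Prod.fst '' S' with hS
  have hSc : IsClosed S := isClosedMap_fst_of_compactSpace _ hS'c
  have hSsub : S ⊆ ⋃ Γ : {Γ : Finset (Fin N) // Γ.Nonempty}, {c : Fin N → ℝ | ∃ y : Fin n → ℝ,
      (∑ j ∈ Γ.1, c j * Real.exp (∑ i, a j i * y i) = 0) ∧
      ∀ i', ∑ j ∈ Γ.1, c j * Real.exp (∑ i, a j i * y i) * a j i' = 0} := by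
    rintro c ⟨⟨c', X⟩, ⟨h0, h1⟩, rfl⟩
    obtain ⟨s, y, hy⟩ := nX_limit a hN X X.2
    simp only at h0 h1 ⊢
    set Γ : Finset (Fin N) := Finset.univ.filter fun j => (X : Fin N → ℝ) j ≠ 0 with hΓ
    have hXΓ : ∀ j, (X : Fin N → ℝ) j = if j ∈ Γ then Real.exp s * Real.exp (∑ i, a j i * y i) else 0 := by
      intro j
      split_ifs with hj
      · rw [hy j (by simpa [hΓ] using hj), Real.exp_add]
      · simpa [hΓ] using hj
    have hΓn : Γ.Nonempty := by
      by_contra hc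
      rw [Finset.not_nonempty_iff_eq_empty] at hc
      have := (hXbs X.2).2
      rw [Finset.sum_eq_zero] at this
      · norm_num at this
      · intro j _; rw [hXΓ j, hc]; simp
    refine mem_iUnion.2 ⟨⟨Γ, hΓn⟩, y, ?_, ?_⟩
    · have : ∑ j, c' j * (X : Fin N → ℝ) j = Real.exp s * ∑ j ∈ Γ, c' j * Real.exp (∑ i, a j i * y i) := by
        rw [Finset.mul_sum, ← Finset.univ_inter Γ, ← Finset.sum_ite_mem]
        apply Finset.sum_congr rfl
        intro j _
        rw [hXΓ j]; split_ifs <;> ring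
      rw [this] at h0
      exact (mul_eq_zero.1 h0).resolve_left (Real.exp_pos _).ne'
    · intro i'
      have : ∑ j, c' j * (X : Fin N → ℝ) j * a j i' =
          Real.exp s * ∑ j ∈ Γ, c' j * Real.exp (∑ i, a j i * y i) * a j i' := by
        rw [Finset.mul_sum, ← Finset.univ_inter Γ, ← Finset.sum_ite_mem]
        apply Finset.sum_congr rfl
        intro j _
        rw [hXΓ j]; split_ifs <;> ring
      have h2 := h1 i'
      rw [this] at h2
      exact (mul_eq_zero.1 h2).resolve_left (Real.exp_pos _).ne'
  have hdim : dimH S < Module.finrank ℝ (Fin N → ℝ) := by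
    rw [Module.finrank_fintype_fun_eq_card, Fintype.card_fin]
    refine lt_of_le_of_lt ((dimH_mono hSsub).trans ?_) (b := ((N - 1 : ℕ) : ENNReal)) ?_
    · rw [dimH_iUnion]
      exact iSup_le fun Γ => dim_strat a Γ.1 Γ.2
    · exact_mod_cast (by omega : N - 1 < N)
  have hSd : Dense Sᶜ := dense_compl_of_dimH_lt_finrank hdim
  have hVo : IsOpen (Set.pi univ fun _ : Fin N => ({0}ᶜ : Set ℝ)) :=
    isOpen_set_pi finite_univ fun _ _ => isOpen_compl_singleton
  have hVd : Dense (Set.pi univ fun _ : Fin N => ({0}ᶜ : Set ℝ)) :=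
    dense_pi _ fun _ _ => dense_compl_singleton 0
  refine ⟨Sᶜ ∩ Set.pi univ fun _ : Fin N => ({0}ᶜ : Set ℝ), hSc.isOpen_compl.inter hVo,
    hSd.inter_of_isOpen_left hVd hSc.isOpen_compl, ?_⟩
  rintro c ⟨hcS, hcV⟩
  refine ⟨fun j => hcV j trivial, fun y hy => ?_⟩
  by_contra hcon
  push Not at hcon
  apply hcS
  refine ⟨(c, ⟨nX a y, subset_closure ⟨y, rfl⟩⟩), ⟨?_, ?_⟩, rfl⟩
  · simp only [nX, mul_div_assoc']
    rw [← Finset.sum_div, hy, zero_div]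
  · intro i'
    simp only [nX, mul_div_assoc', div_mul_eq_mul_div]
    rw [← Finset.sum_div, hcon i', zero_div]

end Generic


/-! ## Components of the positive set, exponents in general position -/
section GenPos
open Set Filter Topology Matrix

variable {n N : ℕ}

/-- general position: no `n+1` of the points lie on an affine hyperplane -/
def GP (a : Fin N → Fin n → ℝ) : Prop :=
  ∀ S : Finset (Fin N), n + 1 ≤ S.card → ∀ (w : Fin n → ℝ) (b : ℝ),
    (∀ j ∈ S, a j ⬝ᵥ w = b) → w = 0

lemma gp_dual (a : Fin N → Fin n → ℝ) (hN : n + 1 ≤ N) (ha : GP a) (Γ : Finset (Fin N))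
    (hΓ : Γ.card ≤ n + 1) (j : Fin N) (hj : j ∈ Γ) :
    ∃ (w : Fin n → ℝ) (b : ℝ), a j ⬝ᵥ w - b = 1 ∧ ∀ i ∈ Γ, i ≠ j → a i ⬝ᵥ w - b = 0 := by
  classical
  obtain ⟨S, hΓS, -, hS⟩ := Finset.exists_subsuperset_card_eq (Finset.subset_univ Γ) hΓ
    (by simpa using hN)
  let L : ((Fin n → ℝ) × ℝ) →ₗ[ℝ] (S → ℝ) :=
    { toFun := fun p i => a i ⬝ᵥ p.1 - p.2
      map_add' := by intro p q; ext i; simp [dotProduct_add]; ring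
      map_smul' := by intro r p; ext i; simp [dotProduct_smul]; ring }
  have hinj : Function.Injective L := by
    rw [← LinearMap.ker_eq_bot, LinearMap.ker_eq_bot']
    rintro ⟨w, b⟩ h
    have h' : ∀ i ∈ S, a i ⬝ᵥ w = b := fun i hi => by
      have := congrFun h ⟨i, hi⟩
      simpa [L, sub_eq_zero] using this
    have hw := ha S hS.ge w b h'
    have hb := h' j (hΓS hj)
    rw [hw, dotProduct_zero] at hb
    rw [hw, ← hb]; rfl
  have hsurj : Function.Surjective L := by
    refine (LinearMap.injective_iff_surjective_of_finrank_eq_finrank ?_).1 hinj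
    simp [hS]
  obtain ⟨⟨w, b⟩, hwb⟩ := hsurj (Pi.single ⟨j, hΓS hj⟩ 1)
  refine ⟨w, b, ?_, ?_⟩
  · have := congrFun hwb ⟨j, hΓS hj⟩
    simpa [L] using this
  · intro i hi hij
    have := congrFun hwb ⟨i, hΓS hi⟩
    rw [Pi.single_eq_of_ne (by simpa using hij)] at this
    simpa [L] using this

lemma expSum_cont (a : Fin N → Fin n → ℝ) (c : Fin N → ℝ) : Continuous (expSum a c) := by
  unfold expSum; fun_prop

/-- the region where the monomial `j` dominates -/
def domR (a : Fin N → Fin n → ℝ) (c : Fin N → ℝ) (j : Fin N) : Set (Fin n → ℝ) :=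
  {y | ∑ m ∈ Finset.univ.erase j, |c m| * Real.exp (a m ⬝ᵥ y - a j ⬝ᵥ y) < c j}

lemma domR_convex (a : Fin N → Fin n → ℝ) (c : Fin N → ℝ) (j : Fin N) : Convex ℝ (domR a c j) := by
  have h : ConvexOn ℝ univ (fun y : Fin n → ℝ =>
      ∑ m ∈ Finset.univ.erase j, |c m| * Real.exp (a m ⬝ᵥ y - a j ⬝ᵥ y)) := by
    refine ⟨convex_univ, ?_⟩
    intro y _ z _ s t hs ht hst
    simp only [smul_eq_mul, Finset.mul_sum]
    rw [← Finset.sum_add_distrib]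
    refine Finset.sum_le_sum fun m _ => ?_
    have h1 := convexOn_exp.2 (mem_univ (a m ⬝ᵥ y - a j ⬝ᵥ y)) (mem_univ (a m ⬝ᵥ z - a j ⬝ᵥ z))
      hs ht hst
    simp only [smul_eq_mul] at h1
    have h2 : a m ⬝ᵥ (s • y + t • z) - a j ⬝ᵥ (s • y + t • z) =
        s * (a m ⬝ᵥ y - a j ⬝ᵥ y) + t * (a m ⬝ᵥ z - a j ⬝ᵥ z) := by
      simp only [dotProduct_add, dotProduct_smul, smul_eq_mul]; ring
    rw [h2]
    nlinarith [mul_le_mul_of_nonneg_left h1 (abs_nonneg (c m))]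
  have := h.convex_lt (c j)
  simpa [domR] using this

lemma domR_subset (a : Fin N → Fin n → ℝ) (c : Fin N → ℝ) (j : Fin N) :
    domR a c j ⊆ {y | 0 < expSum a c y} := by
  intro y hy
  have hy' : ∑ m ∈ Finset.univ.erase j, |c m| * Real.exp (a m ⬝ᵥ y - a j ⬝ᵥ y) < c j := hy
  show 0 < ∑ m, c m * Real.exp (a m ⬝ᵥ y)
  have h1 : ∑ m, c m * Real.exp (a m ⬝ᵥ y) =
      Real.exp (a j ⬝ᵥ y) * (c j + ∑ m ∈ Finset.univ.erase j, c m * Real.exp (a m ⬝ᵥ y - a j ⬝ᵥ y)) := by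
    rw [← Finset.add_sum_erase _ _ (Finset.mem_univ j), mul_add, Finset.mul_sum]
    congr 1
    · ring
    · refine Finset.sum_congr rfl fun m _ => ?_
      rw [Real.exp_sub]; field_simp
  rw [h1]
  refine mul_pos (Real.exp_pos _) ?_
  have h2 : -∑ m ∈ Finset.univ.erase j, |c m| * Real.exp (a m ⬝ᵥ y - a j ⬝ᵥ y) ≤
      ∑ m ∈ Finset.univ.erase j, c m * Real.exp (a m ⬝ᵥ y - a j ⬝ᵥ y) := by
    rw [← Finset.sum_neg_distrib]
    refine Finset.sum_le_sum fun m _ => ?_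
    nlinarith [neg_abs_le (c m), Real.exp_pos (a m ⬝ᵥ y - a j ⬝ᵥ y)]
  linarith

lemma abs_exp_sub_one_le' (s : ℝ) : |Real.exp s - 1| ≤ |s| * Real.exp |s| := by
  have h0 := Real.add_one_le_exp s
  have h1 := Real.add_one_le_exp (-s)
  have hp := Real.exp_pos s
  have h2 : Real.exp s * (-s + 1) ≤ 1 := by
    have := mul_le_mul_of_nonneg_left h1 hp.le
    rwa [← Real.exp_add, add_neg_cancel, Real.exp_zero] at this
  rcases le_total 0 s with hs | hs
  · rw [abs_of_nonneg hs, abs_of_nonneg (by linarith)]; linarith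
  · rw [abs_of_nonpos hs, abs_of_nonpos (by have := Real.exp_le_one_iff.2 hs; linarith)]
    have : 1 ≤ Real.exp (-s) := Real.one_le_exp (by linarith)
    nlinarith

lemma tendsto_quot {x : ℕ → ℝ} {r : ℕ → ℝ} {L : ℝ} (hx : Tendsto x atTop (𝓝 L))
    (hr : Tendsto r atTop atTop) : Tendsto (fun k => (r k)⁻¹ * x k) atTop (𝓝 0) := by
  simpa using hr.inv_tendsto_atTop.mul hx

lemma unbounded_dom (a : Fin N → Fin n → ℝ) (hN : n + 1 ≤ N) (ha : GP a) (c : Fin N → ℝ)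
    (hc : ∀ j, c j ≠ 0) (D : Set (Fin n → ℝ)) (hD : D ⊆ {y | 0 < expSum a c y})
    (hDb : ¬ Bornology.IsBounded D) :
    ∃ j, 0 < c j ∧ ∃ y ∈ D, ∃ z ∈ domR a c j, segment ℝ y z ⊆ {y | 0 < expSum a c y} := by
  classical
  have hN0 : 0 < N := by omega
  have hNe : Nonempty (Fin N) := ⟨⟨0, hN0⟩⟩
  -- a divergent sequence
  have hseq : ∀ k : ℕ, ∃ y ∈ D, (k : ℝ) + 1 < ‖y‖ := by
    intro k
    by_contra hcon
    push Not at hcon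
    exact hDb (isBounded_iff_forall_norm_le.2 ⟨_, hcon⟩)
  choose y0 hy0D hy0 using hseq
  have hcpt : IsCompact (stdSimplex ℝ (Fin N) ×ˢ Metric.sphere (0 : Fin n → ℝ) 1) :=
    (isCompact_stdSimplex ℝ (Fin N)).prod (isCompact_sphere _ _)
  obtain ⟨⟨X, w⟩, ⟨hX, hw⟩, φ, hφ, hlim⟩ := hcpt.tendsto_subseq
    (x := fun k => (nX a (y0 k), (‖y0 k‖)⁻¹ • y0 k)) (fun k => ⟨nX_mem a hN0 _, by
      have : 0 < ‖y0 k‖ := lt_trans (by positivity) (hy0 k)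
      simp [norm_smul, this.ne']⟩)
  set y : ℕ → Fin n → ℝ := fun k => y0 (φ k) with hy
  have hXlim : ∀ m, Tendsto (fun k => nX a (y k) m) atTop (𝓝 (X m)) := fun m =>
    tendsto_pi_nhds.1 ((continuous_fst.tendsto _).comp hlim) m
  have hwlim : Tendsto (fun k => (‖y k‖)⁻¹ • y k) atTop (𝓝 w) := (continuous_snd.tendsto _).comp hlim
  have hyinf : Tendsto (fun k => ‖y k‖) atTop atTop := by
    refine tendsto_atTop_mono (f := fun k : ℕ => (φ k : ℝ)) (fun k => ?_)
      (tendsto_natCast_atTop_atTop.comp hφ.tendsto_atTop)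
    have := hy0 (φ k); simp only [hy]; linarith
  have hw0 : w ≠ 0 := by
    intro h; simp [h] at hw
  set Γ : Finset (Fin N) := Finset.univ.filter fun m => X m ≠ 0 with hΓ
  have hmemΓ : ∀ m, m ∈ Γ ↔ X m ≠ 0 := by simp [hΓ]
  have hXpos : ∀ m ∈ Γ, 0 < X m := fun m hm => lt_of_le_of_ne (hX.1 m) ((hmemΓ m).1 hm).symm
  have hS : ∀ z : Fin n → ℝ, 0 < ∑ j', Real.exp (∑ i, a j' i * z i) := fun z =>
    Finset.sum_pos (fun j _ => Real.exp_pos _) Finset.univ_nonempty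
  have hflat : ∀ m ∈ Γ, ∀ m' ∈ Γ, a m ⬝ᵥ w = a m' ⬝ᵥ w := by
    intro m hm m' hm'
    have h1 : Tendsto (fun k => Real.log (nX a (y k) m) - Real.log (nX a (y k) m')) atTop
        (𝓝 (Real.log (X m) - Real.log (X m'))) :=
      ((hXlim m).log ((hmemΓ m).1 hm)).sub ((hXlim m').log ((hmemΓ m').1 hm'))
    have h2 := tendsto_quot h1 hyinf
    have h3 : Tendsto (fun k => (a m - a m') ⬝ᵥ ((‖y k‖)⁻¹ • y k)) atTop (𝓝 ((a m - a m') ⬝ᵥ w)) := by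
      have : Continuous fun z : Fin n → ℝ => (a m - a m') ⬝ᵥ z := by unfold dotProduct; fun_prop
      exact (this.tendsto w).comp hwlim
    have h4 : (a m - a m') ⬝ᵥ w = 0 := by
      refine tendsto_nhds_unique h3 (h2.congr fun k => ?_)
      rw [dotProduct_smul, smul_eq_mul, nX, nX, Real.log_div (Real.exp_pos _).ne' (hS _).ne',
        Real.log_div (Real.exp_pos _).ne' (hS _).ne', Real.log_exp, Real.log_exp, sub_dotProduct]
      simp only [dotProduct]; ring
    rw [sub_dotProduct] at h4; linarith
  obtain ⟨m0, hm0⟩ : Γ.Nonempty := by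
    by_contra hcon
    rw [Finset.not_nonempty_iff_eq_empty] at hcon
    have h1 := hX.2
    rw [Finset.sum_eq_zero fun m _ => by
      by_contra h; have := (hmemΓ m).2 h; simp [hcon] at this] at h1
    norm_num at h1
  have hΓcard : Γ.card ≤ n := by
    by_contra hcon
    exact hw0 (ha Γ (by omega) w (a m0 ⬝ᵥ w) fun j hj => hflat j hj m0 hm0)
  have hlin : ∀ k, 0 < ∑ m, c m * nX a (y k) m := by
    intro k
    have h1 : 0 < expSum a c (y k) := hD (hy0D _)
    have h2 : ∑ m, c m * nX a (y k) m = expSum a c (y k) / ∑ j', Real.exp (∑ i, a j' i * y k i) := by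
      unfold expSum nX
      rw [Finset.sum_div]
      exact Finset.sum_congr rfl fun m _ => by ring
    rw [h2]; exact div_pos h1 (hS _)
  have hlim0 : 0 ≤ ∑ m, c m * X m := by
    refine ge_of_tendsto' (tendsto_finsetSum _ fun m _ => (hXlim m).const_mul (c m)) fun k => (hlin k).le
  obtain ⟨j, hjΓ, hjc⟩ : ∃ j ∈ Γ, 0 < c j := by
    by_contra hcon
    push Not at hcon
    have : ∑ m, c m * X m < 0 := by
      refine Finset.sum_neg' (fun m _ => ?_) ⟨m0, Finset.mem_univ _, ?_⟩
      · by_cases hm : m ∈ Γ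
        · exact mul_nonpos_of_nonpos_of_nonneg (hcon m hm) (hX.1 m)
        · rw [hmemΓ] at hm; push Not at hm; simp [hm]
      · exact mul_neg_of_neg_of_pos (lt_of_le_of_ne (hcon m0 hm0) (hc m0)) (hXpos m0 hm0)
    linarith
  obtain ⟨u, b, hub, hub'⟩ := gp_dual a hN ha Γ (by omega) j hjΓ
  set δ : Fin N → ℝ := fun m => a m ⬝ᵥ u - b with hδ
  -- the time T
  obtain ⟨T, hT0, hT⟩ : ∃ T : ℝ, 0 < T ∧
      ∑ m ∈ Finset.univ.erase j, |c m| * X m < c j * X j * Real.exp T := by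
    set R := ∑ m ∈ Finset.univ.erase j, |c m| * X m with hR
    have hR0 : 0 ≤ R := Finset.sum_nonneg fun m _ => mul_nonneg (abs_nonneg _) (hX.1 m)
    have hq : 0 < c j * X j := mul_pos hjc (hXpos j hjΓ)
    refine ⟨R / (c j * X j) + 1, by positivity, ?_⟩
    have := Real.add_one_le_exp (R / (c j * X j) + 1)
    calc R = c j * X j * (R / (c j * X j)) := by
          rw [mul_div_assoc']; exact (mul_div_cancel_left₀ R hq.ne').symm
      _ < c j * X j * Real.exp (R / (c j * X j) + 1) := by
        apply mul_lt_mul_of_pos_left _ hq; linarith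
  have hδj : δ j = 1 := hub
  have hδΓ : ∀ m ∈ Γ, m ≠ j → δ m = 0 := hub'
  -- eventual inequalities
  have hE1 : ∀ᶠ k in atTop, ∑ m ∈ Finset.univ.erase j, |c m| * nX a (y k) m * (|δ m| * Real.exp (T * |δ m|))
      < c j * nX a (y k) j := by
    have hl : Tendsto (fun k => ∑ m ∈ Finset.univ.erase j, |c m| * nX a (y k) m * (|δ m| * Real.exp (T * |δ m|)))
        atTop (𝓝 (∑ m ∈ Finset.univ.erase j, |c m| * X m * (|δ m| * Real.exp (T * |δ m|)))) :=
      tendsto_finsetSum _ fun m _ => ((hXlim m).const_mul _).mul_const _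
    refine hl.eventually_lt ((hXlim j).const_mul (c j)) ?_
    rw [Finset.sum_eq_zero]
    · exact mul_pos hjc (hXpos j hjΓ)
    · intro m hm
      by_cases hmΓ : m ∈ Γ
      · simp [hδΓ m hmΓ (Finset.ne_of_mem_erase hm)]
      · rw [hmemΓ] at hmΓ; push Not at hmΓ; simp [hmΓ]
  have hE2 : ∀ᶠ k in atTop, ∑ m ∈ Finset.univ.erase j, |c m| * nX a (y k) m * Real.exp (T * δ m)
      < c j * nX a (y k) j * Real.exp T := by
    have hl : Tendsto (fun k => ∑ m ∈ Finset.univ.erase j, |c m| * nX a (y k) m * Real.exp (T * δ m))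
        atTop (𝓝 (∑ m ∈ Finset.univ.erase j, |c m| * X m * Real.exp (T * δ m))) :=
      tendsto_finsetSum _ fun m _ => ((hXlim m).const_mul _).mul_const _
    refine hl.eventually_lt (((hXlim j).const_mul (c j)).mul_const _) ?_
    refine lt_of_le_of_lt (Finset.sum_le_sum fun m hm => ?_) hT
    by_cases hmΓ : m ∈ Γ
    · simp [hδΓ m hmΓ (Finset.ne_of_mem_erase hm)]
    · rw [hmemΓ] at hmΓ; push Not at hmΓ; simp [hmΓ]
  obtain ⟨k, hk1, hk2⟩ := (hE1.and hE2).exists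
  have hnpos : ∀ m, 0 ≤ nX a (y k) m := (nX_mem a hN0 (y k)).1
  have hnX : ∀ (m) (t : ℝ), Real.exp (a m ⬝ᵥ (y k + t • u)) =
      nX a (y k) m * Real.exp (t * δ m) * ((∑ j', Real.exp (∑ i, a j' i * y k i)) * Real.exp (t * b)) := by
    intro m t
    have : a m ⬝ᵥ (y k + t • u) = (∑ i, a m i * y k i) + t * δ m + t * b := by
      rw [dotProduct_add, dotProduct_smul, smul_eq_mul]; simp only [hδ]; simp only [dotProduct]; ring
    rw [this, Real.exp_add, Real.exp_add, nX]
    have := (hS (y k)).ne'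
    field_simp
  set Q : ℝ → ℝ := fun t => (∑ j', Real.exp (∑ i, a j' i * y k i)) * Real.exp (t * b) with hQ
  have hQpos : ∀ t, 0 < Q t := fun t => mul_pos (hS _) (Real.exp_pos _)
  have hpath : ∀ t, 0 ≤ t → t ≤ T → 0 < expSum a c (y k + t • u) := by
    intro t ht0 htT
    have h1 : expSum a c (y k + t • u) = (∑ m, c m * nX a (y k) m * Real.exp (t * δ m)) * Q t := by
      show ∑ m, c m * Real.exp (a m ⬝ᵥ (y k + t • u)) = _
      rw [Finset.sum_mul]
      refine Finset.sum_congr rfl fun m _ => ?_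
      rw [hnX]; ring
    rw [h1]
    refine mul_pos ?_ (hQpos t)
    have h2 : ∑ m, c m * nX a (y k) m * Real.exp (t * δ m) =
        ∑ m, c m * nX a (y k) m + ∑ m, c m * nX a (y k) m * (Real.exp (t * δ m) - 1) := by
      rw [← Finset.sum_add_distrib]; exact Finset.sum_congr rfl fun m _ => by ring
    rw [h2]
    refine add_pos_of_pos_of_nonneg (hlin k) ?_
    rw [← Finset.add_sum_erase _ _ (Finset.mem_univ j), hδj, mul_one]
    have het : t ≤ Real.exp t - 1 := by linarith [Real.add_one_le_exp t]
    have h3 : ∀ m ∈ Finset.univ.erase j, -(|c m| * nX a (y k) m * (|δ m| * Real.exp (T * |δ m|)) *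
        (Real.exp t - 1)) ≤ c m * nX a (y k) m * (Real.exp (t * δ m) - 1) := by
      intro m _
      have h4 : |Real.exp (t * δ m) - 1| ≤ (|δ m| * Real.exp (T * |δ m|)) * (Real.exp t - 1) := by
        refine (abs_exp_sub_one_le' _).trans ?_
        rw [abs_mul, abs_of_nonneg ht0]
        have : Real.exp (t * |δ m|) ≤ Real.exp (T * |δ m|) := by gcongr
        calc t * |δ m| * Real.exp (t * |δ m|) ≤ (Real.exp t - 1) * |δ m| * Real.exp (T * |δ m|) := by
              exact mul_le_mul (mul_le_mul_of_nonneg_right het (abs_nonneg _)) this (Real.exp_pos _).le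
                (mul_nonneg (ht0.trans het) (abs_nonneg _))
          _ = _ := by ring
      have h5 : |c m * nX a (y k) m * (Real.exp (t * δ m) - 1)| ≤
          |c m| * nX a (y k) m * ((|δ m| * Real.exp (T * |δ m|)) * (Real.exp t - 1)) := by
        rw [abs_mul, abs_mul, abs_of_nonneg (hnpos m)]
        exact mul_le_mul_of_nonneg_left h4 (mul_nonneg (abs_nonneg _) (hnpos m))
      have := (abs_le.1 h5).1
      linarith
    have h6 := Finset.sum_le_sum h3
    rw [Finset.sum_neg_distrib, ← Finset.sum_mul] at h6
    have h7 : 0 ≤ Real.exp t - 1 := ht0.trans het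
    nlinarith [mul_le_mul_of_nonneg_right hk1.le h7]
  refine ⟨j, hjc, y k, hy0D _, y k + T • u, ?_, ?_⟩
  · show ∑ m ∈ Finset.univ.erase j, |c m| * Real.exp (a m ⬝ᵥ (y k + T • u) - a j ⬝ᵥ (y k + T • u)) < c j
    have h1 : ∑ m ∈ Finset.univ.erase j, |c m| * Real.exp (a m ⬝ᵥ (y k + T • u) - a j ⬝ᵥ (y k + T • u))
        = (∑ m ∈ Finset.univ.erase j, |c m| * nX a (y k) m * Real.exp (T * δ m)) * Q T /
          Real.exp (a j ⬝ᵥ (y k + T • u)) := by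
      rw [Finset.sum_mul, Finset.sum_div]
      refine Finset.sum_congr rfl fun m _ => ?_
      rw [Real.exp_sub, hnX m]; ring
    rw [h1, div_lt_iff₀ (Real.exp_pos _), hnX j, hδj, mul_one]
    calc _ < c j * nX a (y k) j * Real.exp T * Q T := mul_lt_mul_of_pos_right hk2 (hQpos T)
      _ = _ := by ring
  · rw [segment_eq_image']
    rintro _ ⟨θ, hθ, rfl⟩
    have : y k + θ • (y k + T • u - y k) = y k + (θ * T) • u := by
      rw [add_sub_cancel_left, smul_smul]
    show 0 < expSum a c (y k + θ • (y k + T • u - y k))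
    rw [this]
    exact hpath _ (mul_nonneg hθ.1 hT0.le) (by nlinarith [hθ.2])

end GenPos


/-! ## Counting the components of the positive set in general position -/
section GenPosCount
open Set Filter Topology Matrix

variable {n N : ℕ}

/-- exponents relative to a reference one -/
def bmat (a : Fin N → Fin n → ℝ) (r : Fin N) : Matrix {j : Fin N // j ≠ r} (Fin n) ℝ :=
  fun j i => a j i - a r i

lemma bmat_mulVec (a : Fin N → Fin n → ℝ) (r : Fin N) (y : Fin n → ℝ) (j : {j : Fin N // j ≠ r}) :
    (bmat a r *ᵥ y) j = a j ⬝ᵥ y - a r ⬝ᵥ y := by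
  rw [← sub_dotProduct]; rfl

lemma eS_bmat (a : Fin N → Fin n → ℝ) (c : Fin N → ℝ) (r : Fin N) (y : Fin n → ℝ) :
    eS (bmat a r) (fun j => c j) y + c r = expSum a c y * Real.exp (-(a r ⬝ᵥ y)) := by
  classical
  have h1 : expSum a c y * Real.exp (-(a r ⬝ᵥ y)) = ∑ j, c j * Real.exp (a j ⬝ᵥ y - a r ⬝ᵥ y) := by
    show (∑ j, c j * Real.exp (a j ⬝ᵥ y)) * _ = _
    rw [Finset.sum_mul]
    refine Finset.sum_congr rfl fun j _ => ?_
    rw [mul_assoc, ← Real.exp_add, sub_eq_add_neg]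
  rw [h1, ← Finset.sum_erase_add _ _ (Finset.mem_univ r), sub_self, Real.exp_zero, mul_one]
  congr 1
  unfold eS
  rw [Finset.sum_subtype (p := fun j => j ≠ r) (Finset.univ.erase r) (by simp)
    (fun j => c j * Real.exp (a j ⬝ᵥ y - a r ⬝ᵥ y))]
  refine Finset.sum_congr rfl fun j _ => ?_
  rw [bmat_mulVec]

lemma bounded_max (a : Fin N → Fin n → ℝ) (c : Fin N → ℝ) (r : Fin N) (w : Fin n → ℝ)
    (hw : 0 < expSum a c w) (hcr : c r < 0)
    (hb : Bornology.IsBounded (connectedComponentIn {y | 0 < expSum a c y} w)) :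
    ∃ z ∈ connectedComponentIn {y | 0 < expSum a c y} w,
      IsLocalMax (eS (bmat a r) (fun j => c j)) z := by
  set Ω := {y | 0 < expSum a c y} with hΩ
  have hΩo : IsOpen Ω := isOpen_lt continuous_const (expSum_cont a c)
  set D := connectedComponentIn Ω w with hD
  have hwD : w ∈ D := mem_connectedComponentIn hw
  have hDo : IsOpen D := hΩo.connectedComponentIn
  have hcont : Continuous (eS (bmat a r) (fun j => c j)) := by
    unfold eS mulVec dotProduct; fun_prop
  obtain ⟨z, hz, hmax⟩ := hb.isCompact_closure.exists_isMaxOn ⟨w, subset_closure hwD⟩ hcont.continuousOn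
  have hzΩ : z ∈ Ω := by
    have h1 := hmax (subset_closure hwD)
    have h1' : eS (bmat a r) (fun j => c j) w ≤ eS (bmat a r) (fun j => c j) z := h1
    have h2 := eS_bmat a c r w
    have h3 := eS_bmat a c r z
    have h4 : 0 < expSum a c w * Real.exp (-(a r ⬝ᵥ w)) := mul_pos hw (Real.exp_pos _)
    have h5 : 0 < expSum a c z * Real.exp (-(a r ⬝ᵥ z)) := by linarith
    exact (pos_iff_pos_of_mul_pos h5).2 (Real.exp_pos _)
  have hzD : z ∈ D := by
    have hn : connectedComponentIn Ω z ∈ 𝓝 z := connectedComponentIn_mem_nhds (hΩo.mem_nhds hzΩ)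
    obtain ⟨x, hx1, hx2⟩ := mem_closure_iff_nhds.1 hz _ hn
    have e1 := connectedComponentIn_eq hx1
    have e2 := connectedComponentIn_eq hx2
    rw [hD, e2, ← e1]
    exact mem_connectedComponentIn hzΩ
  refine ⟨z, hzD, ?_⟩
  exact (hmax.on_subset subset_closure).isLocalMax (hDo.mem_nhds hzD)

/-- the bound for the number of components of the positive set -/
noncomputable def posB (n k p q : ℕ) : ℝ :=
  p + if n + 1 ≤ q ∧ 2 ≤ k then Mb n (k - 2) / 2 else 0

lemma pos_count (a : Fin N → Fin n → ℝ) (hN : n + 1 ≤ N) (ha : GP a) (c : Fin N → ℝ)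
    (hc : ∀ j, c j ≠ 0) (r : Fin N) (hcr : c r < 0) (M : ℝ)
    (hM : ∀ Y : Finset (Fin n → ℝ), (∀ y ∈ Y, IsLocalMax (eS (bmat a r) (fun j => c j)) y) →
      (Y.card : ℝ) ≤ M)
    (W : Finset (Fin n → ℝ)) (hW : ∀ w ∈ W, 0 < expSum a c w)
    (hinj : Set.InjOn (fun w => connectedComponentIn {y | 0 < expSum a c y} w) (W : Set (Fin n → ℝ))) :
    (W.card : ℝ) ≤ (Finset.univ.filter fun j => 0 < c j).card + M := by
  classical
  set Ω := {y | 0 < expSum a c y} with hΩ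
  have hNe : Nonempty (Fin N) := ⟨r⟩
  set W1 := W.filter fun w => ¬ Bornology.IsBounded (connectedComponentIn Ω w) with hW1
  set W2 := W.filter fun w => Bornology.IsBounded (connectedComponentIn Ω w) with hW2
  have hsplit : W2.card + W1.card = W.card := Finset.card_filter_add_card_filter_not _
  have h1 : W1.card ≤ (Finset.univ.filter fun j => 0 < c j).card := by
    have hex : ∀ w ∈ W1, ∃ j, 0 < c j ∧ ∃ z ∈ connectedComponentIn Ω w, z ∈ domR a c j := by
      intro w hw
      rw [hW1, Finset.mem_filter] at hw
      obtain ⟨j, hj, y, hy, z, hz, hseg⟩ := unbounded_dom a hN ha c hc _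
        (connectedComponentIn_subset Ω w) hw.2
      refine ⟨j, hj, z, ?_, hz⟩
      have h2 := (convex_segment y z).isPreconnected.subset_connectedComponentIn
        (left_mem_segment ℝ y z) hseg
      rw [connectedComponentIn_eq hy]
      exact h2 (right_mem_segment ℝ y z)
    choose! f hf1 hf2 using hex
    refine Finset.card_le_card_of_injOn f (fun w hw => by simpa using hf1 w hw) ?_
    intro w hw w' hw' hff
    obtain ⟨z, hz, hzd⟩ := hf2 w hw
    obtain ⟨z', hz', hzd'⟩ := hf2 w' hw'
    rw [← hff] at hzd'
    apply hinj (Finset.filter_subset _ _ hw) (Finset.filter_subset _ _ hw')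
    have h2 := (domR_convex a c (f w)).isPreconnected.subset_connectedComponentIn hzd
      (domR_subset a c (f w)) hzd'
    show connectedComponentIn Ω w = connectedComponentIn Ω w'
    rw [connectedComponentIn_eq hz, connectedComponentIn_eq hz', connectedComponentIn_eq h2]
  have h2 : (W2.card : ℝ) ≤ M := by
    have hex : ∀ w ∈ W2, ∃ z ∈ connectedComponentIn Ω w, IsLocalMax (eS (bmat a r) (fun j => c j)) z := by
      intro w hw
      rw [hW2, Finset.mem_filter] at hw
      exact bounded_max a c r w (hW w hw.1) hcr hw.2
    choose! f hf1 hf2 using hex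
    have hcard : (W2.image f).card = W2.card := by
      apply Finset.card_image_of_injOn
      intro w hw w' hw' hff
      apply hinj (Finset.filter_subset _ _ hw) (Finset.filter_subset _ _ hw')
      show connectedComponentIn Ω w = connectedComponentIn Ω w'
      have hff' : f w = f w' := hff
      rw [connectedComponentIn_eq (hf1 w hw), hff', ← connectedComponentIn_eq (hf1 w' hw')]
    rw [← hcard]
    apply hM
    intro y hy
    obtain ⟨w, hw, rfl⟩ := Finset.mem_image.1 hy
    exact hf2 w hw
  have h1' : (W1.card : ℝ) ≤ (Finset.univ.filter fun j => 0 < c j).card := by exact_mod_cast h1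
  have : (W.card : ℝ) = W2.card + W1.card := by exact_mod_cast hsplit.symm
  linarith

lemma bmat_span (a : Fin N → Fin n → ℝ) (hN : n + 1 ≤ N) (ha : GP a) (r : Fin N) (y : Fin n → ℝ)
    (h : bmat a r *ᵥ y = 0) : y = 0 := by
  refine ha Finset.univ (by simpa using hN) y (a r ⬝ᵥ y) fun j _ => ?_
  by_cases hj : j = r
  · rw [hj]
  · have := congrFun h ⟨j, hj⟩
    rw [bmat_mulVec] at this
    simpa [sub_eq_zero] using this

lemma bmat_one (a : Fin N → Fin n → ℝ) (hN : n + 2 ≤ N) (ha : GP a) (r : Fin N) (y : Fin n → ℝ) :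
    bmat a r *ᵥ y ≠ 1 := by
  classical
  intro h
  have hy : y = 0 := by
    refine ha (Finset.univ.erase r) ?_ y (a r ⬝ᵥ y + 1) fun j hj => ?_
    · rw [Finset.card_erase_of_mem (Finset.mem_univ r), Finset.card_univ, Fintype.card_fin]; omega
    · have := congrFun h ⟨j, Finset.ne_of_mem_erase hj⟩
      rw [bmat_mulVec] at this
      simp only [Pi.one_apply] at this
      linarith
  obtain ⟨j, hj⟩ : (Finset.univ.erase r : Finset (Fin N)).Nonempty := by
    rw [← Finset.card_pos, Finset.card_erase_of_mem (Finset.mem_univ r), Finset.card_univ,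
      Fintype.card_fin]; omega
  have := congrFun h ⟨j, Finset.ne_of_mem_erase hj⟩
  rw [hy, mulVec_zero] at this
  simp at this

/-- no critical point in the simplex case -/
lemma no_max_simplex (hn1 : 1 ≤ n) (a : Fin N → Fin n → ℝ) (hN : N = n + 1) (ha : GP a) (c : Fin N → ℝ)
    (hc : ∀ j, c j ≠ 0) (r : Fin N) (z : Fin n → ℝ)
    (h : IsLocalMax (eS (bmat a r) (fun j => c j)) z) : False := by
  classical
  have hcrit := localMax_crit _ _ _ h
  obtain ⟨j, hj⟩ : (Finset.univ.erase r : Finset (Fin N)).Nonempty := by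
    rw [← Finset.card_pos, Finset.card_erase_of_mem (Finset.mem_univ r), Finset.card_univ,
      Fintype.card_fin]; omega
  have hjr := Finset.ne_of_mem_erase hj
  obtain ⟨w, b, hw1, hw2⟩ := gp_dual a hN.ge ha Finset.univ (by simp [hN]) j (Finset.mem_univ j)
  have h1 : (bmat a r *ᵥ w) ⬝ᵥ (eB (bmat a r) (fun j => c j) z) = 0 := by
    have h2 : w ⬝ᵥ ((bmat a r)ᵀ *ᵥ (eB (bmat a r) (fun j => c j) z)) = 0 := by
      rw [hcrit, dotProduct_zero]
    rwa [dotProduct_mulVec, vecMul_transpose] at h2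
  have h3 : bmat a r *ᵥ w = Pi.single ⟨j, hjr⟩ 1 := by
    ext i
    rw [bmat_mulVec]
    have hr := hw2 r (Finset.mem_univ r) (Ne.symm hjr)
    by_cases hij : i = ⟨j, hjr⟩
    · subst hij; simp only [Pi.single_eq_same]; linarith
    · rw [Pi.single_eq_of_ne hij]
      have := hw2 i (Finset.mem_univ _) (fun hh => hij (Subtype.ext hh))
      linarith
  rw [h3, single_dotProduct, one_mul] at h1
  exact mul_ne_zero (hc j) (Real.exp_pos _).ne' h1

lemma exists_good (r : Fin N) (O : Set (Fin N → ℝ)) (hO : IsOpen O) (hOn : O.Nonempty)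
    (Bad : Set ({j : Fin N // j ≠ r} → ℝ)) (hBad : MeasureTheory.volume Bad = 0) :
    ∃ c ∈ O, (fun j : {j : Fin N // j ≠ r} => c j) ∉ Bad := by
  classical
  let L : (Fin N → ℝ) →ₗ[ℝ] ({j : Fin N // j ≠ r} → ℝ) := LinearMap.funLeft ℝ ℝ Subtype.val
  have hLs : Function.Surjective L := LinearMap.funLeft_surjective_of_injective ℝ ℝ _ Subtype.val_injective
  have hopen : IsOpen (L '' O) := L.isOpenMap_of_finiteDimensional hLs O hO
  by_contra hcon
  push Not at hcon
  have hsub : L '' O ⊆ Bad := by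
    rintro _ ⟨c, hc, rfl⟩
    exact hcon c hc
  exact (hopen.measure_pos MeasureTheory.volume (hOn.image _)).ne'
    (MeasureTheory.measure_mono_null hsub hBad)

theorem gp_bound (k : ℕ) (hn1 : 1 ≤ n) (hk : 1 ≤ k) (hN : N = n + k) (a : Fin N → Fin n → ℝ) (ha : GP a)
    (c0 : Fin N → ℝ) (O : Set (Fin N → ℝ)) (hO : IsOpen O) (hOn : O.Nonempty)
    (hsign : ∀ c ∈ O, ∀ j, c j ≠ 0 ∧ (0 < c j ↔ 0 < c0 j) ∧ (c j < 0 ↔ c0 j < 0)) :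
    ∃ c ∈ O, ∀ W : Finset (Fin n → ℝ), (∀ w ∈ W, 0 < expSum a c w) →
      Set.InjOn (fun w => connectedComponentIn {y | 0 < expSum a c y} w) (W : Set (Fin n → ℝ)) →
      (W.card : ℝ) ≤ posB n k (Finset.univ.filter fun j => 0 < c0 j).card
        (Finset.univ.filter fun j => c0 j < 0).card := by
  classical
  have hp : ∀ c ∈ O, (Finset.univ.filter fun j => 0 < c j) = Finset.univ.filter fun j => 0 < c0 j :=
    fun c hc => Finset.filter_congr fun j _ => (hsign c hc j).2.1
  have hq : ∀ c ∈ O, (Finset.univ.filter fun j => c j < 0) = Finset.univ.filter fun j => c0 j < 0 :=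
    fun c hc => Finset.filter_congr fun j _ => (hsign c hc j).2.2
  by_cases hneg : ∃ r, c0 r < 0
  · obtain ⟨r, hr⟩ := hneg
    by_cases hk2 : 2 ≤ k
    · obtain ⟨Bad, hB0, hB⟩ := maxima_bound (T := {j : Fin N // j ≠ r}) (l := k - 2) hn1
        (by simp [Fintype.card_subtype_compl]; omega) (bmat a r)
        (bmat_span a (by omega) ha r) (bmat_one a (by omega) ha r)
      obtain ⟨c, hcO, hcB⟩ := exists_good r O hO hOn Bad hB0
      refine ⟨c, hcO, fun W hW hinj => ?_⟩
      have hcn : ∀ j, c j ≠ 0 := fun j => (hsign c hcO j).1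
      have hB' := hB _ hcB (fun j => hcn j)
      rw [posB, ← hp c hcO]
      refine pos_count a (by omega) ha c hcn r ((hsign c hcO r).2.2.2 hr) _ ?_ W hW hinj
      intro Y hY
      obtain ⟨h1, h2⟩ := hB' Y hY
      split_ifs with hif
      · linarith
      · rcases Y.eq_empty_or_nonempty with rfl | hYn
        · simp
        · exfalso
          apply hif
          refine ⟨?_, hk2⟩
          have h3 := h1 hYn
          have h4 : (Finset.univ.filter fun j : {j : Fin N // j ≠ r} => c j < 0).card + 1 ≤
              (Finset.univ.filter fun j => c0 j < 0).card := by
            have h5 : ((Finset.univ.filter fun j : {j : Fin N // j ≠ r} => c j < 0).map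
                (Function.Embedding.subtype _)) ⊆ (Finset.univ.filter fun j => c0 j < 0).erase r := by
              intro j hj
              rw [Finset.mem_map] at hj
              obtain ⟨i, hi, rfl⟩ := hj
              simp only [Finset.mem_filter, Finset.mem_univ, true_and] at hi
              simp only [Function.Embedding.subtype_apply, Finset.mem_erase, Finset.mem_filter,
                Finset.mem_univ, true_and]
              exact ⟨i.2, (hsign c hcO i).2.2.1 hi⟩
            have h6 := Finset.card_le_card h5
            have hrm : r ∈ (Finset.univ.filter fun j => c0 j < 0) := by simpa using hr
            rw [Finset.card_map, Finset.card_erase_of_mem hrm] at h6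
            have := Finset.card_pos.2 ⟨r, hrm⟩
            omega
          omega
    · obtain ⟨c, hcO⟩ := hOn
      refine ⟨c, hcO, fun W hW hinj => ?_⟩
      have hcn : ∀ j, c j ≠ 0 := fun j => (hsign c hcO j).1
      rw [posB, ← hp c hcO, if_neg (by tauto)]
      refine pos_count a (by omega) ha c hcn r ((hsign c hcO r).2.2.2 hr) _ ?_ W hW hinj
      intro Y hY
      rcases Y.eq_empty_or_nonempty with rfl | ⟨y, hy⟩
      · simp
      · exact (no_max_simplex hn1 a (by omega) ha c hcn r y (hY y hy)).elim
  · push Not at hneg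
    obtain ⟨c, hcO⟩ := hOn
    refine ⟨c, hcO, fun W hW hinj => ?_⟩
    have hcp : ∀ j, 0 < c j := fun j => by
      rcases lt_or_gt_of_ne (hsign c hcO j).1 with h | h
      · exact absurd ((hsign c hcO j).2.2.1 h) (not_lt.2 (hneg j))
      · exact h
    have hq0 : (Finset.univ.filter fun j => c0 j < 0).card = 0 := by
      rw [Finset.card_eq_zero, Finset.filter_eq_empty_iff]
      intro j _; exact not_lt.2 (hneg j)
    have hp0 : (Finset.univ.filter fun j => 0 < c0 j).card = N := by
      rw [← hp c hcO, Finset.filter_true_of_mem fun j _ => hcp j]; simp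
    rw [posB, hq0, hp0, if_neg (by omega), add_zero]
    have hNe : Nonempty (Fin N) := ⟨⟨0, by omega⟩⟩
    have hall : {y | 0 < expSum a c y} = univ := by
      ext y
      simp only [mem_univ, iff_true]
      exact Finset.sum_pos (fun j _ => mul_pos (hcp j) (Real.exp_pos _)) Finset.univ_nonempty
    have hW1 : W.card ≤ 1 := by
      rw [Finset.card_le_one]
      intro x hx y hy
      apply hinj hx hy
      simp only [hall]
      rw [connectedComponentIn_univ, connectedComponentIn_univ]
      rw [PreconnectedSpace.connectedComponent_eq_univ, PreconnectedSpace.connectedComponent_eq_univ]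
    have : W.card ≤ N := by omega
    exact_mod_cast this

end GenPosCount


/-! ## Perturbation to general position -/
section Perturb
open Set Filter Topology Matrix

variable {n N : ℕ}

/-- moment curve -/
def mom (n N : ℕ) (j : Fin N) (q : Fin n) : ℝ := ((j : ℕ) : ℝ) ^ ((q : ℕ) + 1)

/-- the pencil of matrices -/
def penc (a0 : Fin N → Fin n → ℝ) (e : Fin (n + 1) → Fin N) : Matrix (Fin (n + 1)) (Fin (n + 1)) ℝ :=
  fun i q => Fin.cases 0 (fun q' => a0 (e i) q') q

lemma penc_finite (a0 : Fin N → Fin n → ℝ) (e : Fin (n + 1) → Fin N) (he : Function.Injective e) :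
    {τ : ℝ | (τ • penc a0 e + vandermonde fun i => ((e i : ℕ) : ℝ)).det = 0}.Finite := by
  set V := vandermonde fun i => ((e i : ℕ) : ℝ) with hV
  have hV0 : V.det ≠ 0 := by
    rw [hV, det_vandermonde_ne_zero_iff]
    intro i i' h
    apply he
    apply Fin.ext
    have h' : ((e i : ℕ) : ℝ) = ((e i' : ℕ) : ℝ) := h
    exact_mod_cast h'
  set P : Polynomial ℝ := ((Polynomial.X : Polynomial ℝ) • (penc a0 e).map Polynomial.C +
    V.map Polynomial.C).det with hP
  have hev : ∀ τ, P.eval τ = (τ • penc a0 e + V).det := by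
    intro τ
    have h1 := (Polynomial.evalRingHom τ).map_det ((Polynomial.X : Polynomial ℝ) • (penc a0 e).map Polynomial.C +
      V.map Polynomial.C)
    rw [Polynomial.coe_evalRingHom] at h1
    rw [hP, h1]
    congr 1
    ext i q
    simp
    try ring
  have hP0 : P ≠ 0 := by
    intro h
    have := hev 0
    rw [h, zero_smul, zero_add, Polynomial.eval_zero] at this
    exact hV0 this.symm
  refine (P.roots.toFinset.finite_toSet).subset ?_
  intro τ hτ
  have hτ' : (τ • penc a0 e + V).det = 0 := hτ
  simp [hP0, Polynomial.IsRoot, hev, hτ']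

lemma gp_exists (a0 : Fin N → Fin n → ℝ) (r : ℝ) (hr : 0 < r) :
    ∃ t, 0 < t ∧ t < r ∧ GP (fun j q => a0 j q + t * mom n N j q) := by
  classical
  have hfin : (⋃ e : {e : Fin (n + 1) → Fin N // Function.Injective e},
      {τ : ℝ | (τ • penc a0 e.1 + vandermonde fun i => ((e.1 i : ℕ) : ℝ)).det = 0}).Finite :=
    finite_iUnion fun e => penc_finite a0 e.1 e.2
  obtain ⟨τ, hτr, hτ⟩ := ((Ioi_infinite r⁻¹).sdiff hfin).nonempty
  have hτr' : r⁻¹ < τ := hτr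
  have hτ0 : 0 < τ := (inv_pos.2 hr).trans hτr'
  refine ⟨τ⁻¹, inv_pos.2 hτ0, inv_lt_of_inv_lt₀ hr hτr', ?_⟩
  intro S hS w b hw
  obtain ⟨S', hS'S, hS'⟩ := Finset.exists_subset_card_eq hS
  let e : Fin (n + 1) → Fin N := S'.orderEmbOfFin hS'
  have he : Function.Injective e := (S'.orderEmbOfFin hS').injective
  have heS : ∀ i, e i ∈ S := fun i => hS'S (S'.orderEmbOfFin_mem hS' i)
  have hdet : (τ • penc a0 e + vandermonde fun i => ((e i : ℕ) : ℝ)).det ≠ 0 := by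
    intro h
    exact hτ (mem_iUnion.2 ⟨⟨e, he⟩, h⟩)
  set p : Fin (n + 1) → ℝ := Fin.cons (-b) (τ⁻¹ • w) with hp
  have hp0 : (τ • penc a0 e + vandermonde fun i => ((e i : ℕ) : ℝ)) *ᵥ p = 0 := by
    ext i
    have h1 := hw (e i) (heS i)
    simp only [mulVec, dotProduct, Fin.sum_univ_succ, Pi.zero_apply]
    simp only [dotProduct, mom] at h1
    simp only [hp, Fin.cons_zero, Fin.cons_succ, Matrix.add_apply, Matrix.smul_apply, penc, Fin.cases_zero, Fin.cases_succ,
      vandermonde_apply, Fin.val_zero, pow_zero, smul_eq_mul, Pi.smul_apply, Fin.val_succ]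
    have h2 : ∑ q : Fin n, (τ * a0 (e i) q + ((e i : ℕ) : ℝ) ^ ((q : ℕ) + 1)) * (τ⁻¹ * w q) = b := by
      rw [← h1]
      refine Finset.sum_congr rfl fun q _ => ?_
      field_simp
    rw [h2]; ring
  have hpz := eq_zero_of_mulVec_eq_zero hdet hp0
  ext q
  have := congrFun hpz q.succ
  simp only [hp, Fin.cons_succ, Pi.smul_apply, smul_eq_mul, Pi.zero_apply] at this
  exact (mul_eq_zero.1 this).resolve_left (inv_ne_zero hτ0.ne')

lemma jensen_exp (μ v : Fin N → ℝ) (μ0 v0 : ℝ) (hμ : ∀ i, 0 ≤ μ i) (hμ0 : 0 ≤ μ0)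
    (hsum : μ0 + ∑ i, μ i = 1) :
    Real.exp (μ0 * v0 + ∑ i, μ i * v i) ≤ μ0 * Real.exp v0 + ∑ i, μ i * Real.exp (v i) := by
  set s := μ0 * v0 + ∑ i, μ i * v i with hs
  have key : ∀ x, Real.exp s * (1 + x - s) ≤ Real.exp x := by
    intro x
    have h1 := Real.add_one_le_exp (x - s)
    have h2 : Real.exp x = Real.exp s * Real.exp (x - s) := by rw [← Real.exp_add]; ring_nf
    rw [h2]
    exact mul_le_mul_of_nonneg_left (by linarith) (Real.exp_pos _).le
  have h1 : μ0 * (Real.exp s * (1 + v0 - s)) + ∑ i, μ i * (Real.exp s * (1 + v i - s)) ≤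
      μ0 * Real.exp v0 + ∑ i, μ i * Real.exp (v i) :=
    add_le_add (mul_le_mul_of_nonneg_left (key _) hμ0)
      (Finset.sum_le_sum fun i _ => mul_le_mul_of_nonneg_left (key _) (hμ i))
  have h2 : ∑ i, μ i * (Real.exp s * (1 + v i - s)) =
      Real.exp s * ((1 - s) * ∑ i, μ i + ∑ i, μ i * v i) := by
    rw [mul_add, Finset.mul_sum, Finset.mul_sum, Finset.mul_sum, ← Finset.sum_add_distrib]
    exact Finset.sum_congr rfl fun i _ => by ring
  rw [h2] at h1
  have h3 : ∑ i, μ i = 1 - μ0 := by linarith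
  have h4 : ∑ i, μ i * v i = s - μ0 * v0 := by rw [hs]; ring
  rw [h3, h4] at h1
  calc Real.exp s = _ := by ring
    _ ≤ _ := h1

lemma shift_pos (v ζ : Fin N → ℝ) (hN : 1 ≤ N) (ε t : ℝ) (hε : 0 < ε) (hε1 : ε ≤ 1) (hζ0 : ∑ i, ζ i = 0)
    (hζ : ∀ i, |t * ζ i| ≤ ε / N) (j : Fin N) :
    Real.exp ((1 - ε) * v j + ∑ i, (ε / N + t * ζ i) * v i) ≤
      Real.exp (v j) + 2 * ε * ∑ i, Real.exp (v i) := by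
  have hN' : (1 : ℝ) ≤ N := by exact_mod_cast hN
  have hN0 : (N : ℝ) ≠ 0 := by positivity
  refine (jensen_exp (fun i => ε / N + t * ζ i) v (1 - ε) (v j)
    (fun i => by have := (abs_le.1 (hζ i)).1; linarith) (by linarith) ?_).trans ?_
  · rw [Finset.sum_add_distrib, ← Finset.mul_sum, hζ0]
    simp only [Finset.sum_const, Finset.card_univ, Fintype.card_fin, nsmul_eq_mul]
    field_simp; ring
  · refine add_le_add ?_ ?_
    · have := Real.exp_pos (v j); nlinarith
    · rw [Finset.mul_sum]
      refine Finset.sum_le_sum fun i _ => mul_le_mul_of_nonneg_right ?_ (Real.exp_pos _).le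
      have h1 := (abs_le.1 (hζ i)).2
      have h2 : ε / N ≤ ε := div_le_self hε.le hN'
      linarith

lemma shift_neg (v ζ : Fin N → ℝ) (hN : 1 ≤ N) (ε t : ℝ) (hε : 0 < ε) (hζ0 : ∑ i, ζ i = 0)
    (hζ : ∀ i, |t * ζ i| ≤ ε / N) (j : Fin N) :
    Real.exp (v j) ≤ Real.exp ((1 + ε) * v j + ∑ i, (-(ε / N) + t * ζ i) * v i) +
      2 * ε * ∑ i, Real.exp (v i) := by
  have hN' : (1 : ℝ) ≤ N := by exact_mod_cast hN
  have hN0 : (N : ℝ) ≠ 0 := by positivity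
  have hε1 : 0 < 1 + ε := by linarith
  set e := (1 + ε) * v j + ∑ i, (-(ε / N) + t * ζ i) * v i with he
  have h0 := jensen_exp (fun i => (ε / N - t * ζ i) / (1 + ε)) v (1 / (1 + ε)) e
    (fun i => div_nonneg (by have := (abs_le.1 (hζ i)).2; linarith) hε1.le) (by positivity) (by
      rw [← Finset.sum_div, Finset.sum_sub_distrib, ← Finset.mul_sum, hζ0]
      simp only [Finset.sum_const, Finset.card_univ, Fintype.card_fin, nsmul_eq_mul]
      field_simp; ring)
  have h1 : 1 / (1 + ε) * e + ∑ i, (ε / N - t * ζ i) / (1 + ε) * v i = v j := by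
    have h2 : ∑ i, (ε / N - t * ζ i) / (1 + ε) * v i =
        - (1 / (1 + ε)) * ∑ i, (-(ε / N) + t * ζ i) * v i := by
      rw [Finset.mul_sum]; exact Finset.sum_congr rfl fun i _ => by ring
    rw [h2, he]; field_simp; ring
  rw [h1] at h0
  refine h0.trans (add_le_add ?_ ?_)
  · refine mul_le_of_le_one_left (Real.exp_pos _).le ?_
    rw [div_le_one hε1]; linarith
  · rw [Finset.mul_sum]
    refine Finset.sum_le_sum fun i _ => mul_le_mul_of_nonneg_right ?_ (Real.exp_pos _).le
    have h1 := (abs_le.1 (hζ i)).1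
    have h2 : ε / N ≤ ε := div_le_self hε.le hN'
    rw [div_le_iff₀ hε1]
    nlinarith

lemma exists_zeta (a : Fin N → Fin n → ℝ) (hN : 1 ≤ N) (ha : NotAllInAffineHyperplane a) (m : Fin n → ℝ) :
    ∃ ζ : Fin N → ℝ, ∑ i, ζ i = 0 ∧ ∀ q, ∑ i, ζ i * a i q = m q := by
  classical
  let i0 : Fin N := ⟨0, by omega⟩
  let L : (Fin N → ℝ) →ₗ[ℝ] (Fin n → ℝ) := Fintype.linearCombination ℝ (fun i => a i - a i0)
  have hL : LinearMap.range L = ⊤ := by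
    by_contra hne
    obtain ⟨f, hf, hle⟩ := Submodule.exists_le_ker_of_lt_top _ (lt_top_iff_ne_top.2 hne)
    have hfx : ∀ x : Fin n → ℝ, f x = ∑ q, x q * f (Pi.single q 1) := by
      intro x
      conv_lhs => rw [pi_eq_sum_univ' x]
      simp [map_sum]
    apply ha
    refine ⟨fun q => f (Pi.single q 1), f (a i0), ?_, fun j => ?_⟩
    · intro h0
      apply hf
      ext q
      have := congrFun h0 q
      simpa using this
    · have h1 : a j - a i0 ∈ LinearMap.range L := by
        refine ⟨Pi.single j 1, ?_⟩
        simp only [L, Fintype.linearCombination_apply_single, one_smul]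
      have h2 : f (a j - a i0) = 0 := hle h1
      rw [map_sub, sub_eq_zero] at h2
      rw [← h2, hfx (a j)]
      exact Finset.sum_congr rfl fun q _ => mul_comm _ _
  obtain ⟨ζ, hζ⟩ := LinearMap.range_eq_top.1 hL m
  refine ⟨fun i => ζ i - if i = i0 then ∑ i', ζ i' else 0, ?_, fun q => ?_⟩
  · rw [Finset.sum_sub_distrib]; simp
  · have h1 := congrFun hζ q
    simp only [L, Fintype.linearCombination_apply, Finset.sum_apply, Pi.smul_apply, Pi.sub_apply,
      smul_eq_mul, mul_sub, Finset.sum_sub_distrib] at h1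
    simp only [sub_mul, Finset.sum_sub_distrib, ite_mul, zero_mul, Finset.sum_ite_eq', Finset.mem_univ, if_true]
    rw [← h1, Finset.sum_mul]

theorem perturb (a : Fin N → Fin n → ℝ) (hN : 1 ≤ N) (ha : NotAllInAffineHyperplane a) (c : Fin N → ℝ)
    (hc : ∀ j, c j ≠ 0) (W : Finset (Fin n → ℝ)) (hW : ∀ w ∈ W, 0 < expSum a c w) :
    ∃ a' : Fin N → Fin n → ℝ, GP a' ∧ ∃ O : Set (Fin N → ℝ), IsOpen O ∧ O.Nonempty ∧
      (∀ c' ∈ O, ∀ j, c' j ≠ 0 ∧ (0 < c' j ↔ 0 < c j) ∧ (c' j < 0 ↔ c j < 0)) ∧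
      ∀ c' ∈ O, (∀ y, expSum a' c' y ≤ expSum a c y) ∧ ∀ w ∈ W, 0 < expSum a' c' w := by
  classical
  have hNe : Nonempty (Fin N) := ⟨⟨0, by omega⟩⟩
  have hN' : (1 : ℝ) ≤ N := by exact_mod_cast hN
  have hN0 : (0 : ℝ) < N := by positivity
  choose ζ hζ0 hζ using fun j => exists_zeta a hN ha (mom n N j)
  set σ : Fin N → ℝ := fun j => if 0 < c j then 1 else -1 with hσ
  have hσabs : ∀ j, |σ j| = 1 := fun j => by simp only [hσ]; split_ifs <;> simp
  set o : Fin n → ℝ := fun q => ∑ i, (1 / N : ℝ) * a i q with ho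
  set B : ℝ := ∑ j, ∑ q, (|o q - a j q| + |mom n N j q|) + 1 with hB
  set K : ℝ := ∑ j, (|c j| + 1) with hK
  set Z : ℝ := ∑ j, ∑ i, |ζ j i| + 1 with hZ
  have hKpos : 0 < K := Finset.sum_pos (fun j _ => by positivity) Finset.univ_nonempty
  have hBpos : 0 < B := by
    have : 0 ≤ ∑ j, ∑ q, (|o q - a j q| + |mom n N j q|) :=
      Finset.sum_nonneg fun j _ => Finset.sum_nonneg fun q _ => by positivity
    linarith
  have hZpos : 0 < Z := by
    have : 0 ≤ ∑ j, ∑ i, |ζ j i| :=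
      Finset.sum_nonneg fun j _ => Finset.sum_nonneg fun q _ => by positivity
    linarith
  have hBle : ∀ j q, |o q - a j q| + |mom n N j q| ≤ B := by
    intro j q
    have h1 := Finset.single_le_sum (f := fun q => |o q - a j q| + |mom n N j q|)
      (fun q _ => by positivity) (Finset.mem_univ q)
    have h2 := Finset.single_le_sum (f := fun j => ∑ q, (|o q - a j q| + |mom n N j q|))
      (fun j _ => Finset.sum_nonneg fun q _ => by positivity) (Finset.mem_univ j)
    linarith
  have hZle : ∀ j i, |ζ j i| ≤ Z := by
    intro j i
    have h1 := Finset.single_le_sum (f := fun i => |ζ j i|)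
      (fun q _ => by positivity) (Finset.mem_univ i)
    have h2 := Finset.single_le_sum (f := fun j => ∑ i, |ζ j i|)
      (fun j _ => Finset.sum_nonneg fun q _ => by positivity) (Finset.mem_univ j)
    linarith
  -- continuity at W
  obtain ⟨η, hη, hηW⟩ : ∃ η > 0, ∀ (a' : Fin N → Fin n → ℝ) (c' : Fin N → ℝ),
      (∀ j q, |a' j q - a j q| < η) → (∀ j, |c' j - c j| < η) → ∀ w ∈ W, 0 < expSum a' c' w := by
    have h1 : ∀ᶠ p : (Fin N → Fin n → ℝ) × (Fin N → ℝ) in 𝓝 (a, c), ∀ w ∈ W, 0 < expSum p.1 p.2 w := by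
      rw [Filter.eventually_all_finset]
      intro w hw
      have hcont : Continuous fun p : (Fin N → Fin n → ℝ) × (Fin N → ℝ) => expSum p.1 p.2 w := by
        unfold expSum; fun_prop
      exact hcont.continuousAt.eventually (lt_mem_nhds (hW w hw))
    obtain ⟨η, hη, hb⟩ := Metric.eventually_nhds_iff.1 h1
    refine ⟨η, hη, fun a' c' h1 h2 => hb (y := (a', c')) ?_⟩
    rw [Prod.dist_eq, max_lt_iff]
    refine ⟨?_, ?_⟩
    · rw [dist_pi_lt_iff hη]
      intro j
      rw [dist_pi_lt_iff hη]
      intro q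
      exact h1 j q
    · rw [dist_pi_lt_iff hη]
      exact h2
  -- choice of ε
  obtain ⟨ε, hε, hε1, hεc, hεK1, hεKη, hεB⟩ : ∃ ε : ℝ, 0 < ε ∧ ε < 1 ∧ (∀ j, 4 * ε * K < |c j|) ∧
      4 * ε * K < 1 ∧ 4 * ε * K < η ∧ ε * B < η := by
    have t1 : Tendsto (fun ε : ℝ => ε) (𝓝[>] 0) (𝓝 0) := tendsto_nhdsWithin_of_tendsto_nhds tendsto_id
    have t2 : Tendsto (fun ε : ℝ => 4 * ε * K) (𝓝[>] 0) (𝓝 0) := by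
      simpa using (t1.const_mul 4).mul_const K
    have t3 : Tendsto (fun ε : ℝ => ε * B) (𝓝[>] 0) (𝓝 0) := by simpa using t1.mul_const B
    have e0 : ∀ᶠ ε : ℝ in 𝓝[>] 0, 0 < ε := eventually_mem_nhdsWithin
    have e1 := t1.eventually (gt_mem_nhds (zero_lt_one' ℝ))
    have e2 : ∀ᶠ ε : ℝ in 𝓝[>] 0, ∀ j, 4 * ε * K < |c j| :=
      eventually_all.2 fun j => t2.eventually (gt_mem_nhds (abs_pos.2 (hc j)))
    have e3 := t2.eventually (gt_mem_nhds (zero_lt_one' ℝ))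
    have e4 := t2.eventually (gt_mem_nhds hη)
    have e5 := t3.eventually (gt_mem_nhds hη)
    obtain ⟨ε, h⟩ := (e0.and (e1.and (e2.and (e3.and (e4.and e5))))).exists
    exact ⟨ε, h.1, h.2.1, h.2.2.1, h.2.2.2.1, h.2.2.2.2.1, h.2.2.2.2.2⟩
  set a0 : Fin N → Fin n → ℝ := fun j q => (1 - ε * σ j) * a j q + ε * σ j * o q with ha0
  obtain ⟨t, ht0, htr, hGP⟩ := gp_exists a0 (min ε (ε / N / Z)) (lt_min hε (by positivity))
  have htε : t < ε := htr.trans_le (min_le_left _ _)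
  have htZ : t * Z ≤ ε / N := by
    have := htr.trans_le (min_le_right _ _)
    rw [lt_div_iff₀ hZpos] at this
    exact this.le
  have hζs : ∀ j i, |t * ζ j i| ≤ ε / N := by
    intro j i
    rw [abs_mul, abs_of_pos ht0]
    exact (mul_le_mul_of_nonneg_left (hZle j i) ht0.le).trans htZ
  set a' : Fin N → Fin n → ℝ := fun j q => a0 j q + t * mom n N j q with ha'
  have hdot : ∀ j y, a' j ⬝ᵥ y = (1 - ε * σ j) * (a j ⬝ᵥ y) +
      ∑ i, (ε * σ j / N + t * ζ j i) * (a i ⬝ᵥ y) := by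
    intro j y
    have h1 : ∀ q, a' j q = (1 - ε * σ j) * a j q + ∑ i, (ε * σ j / N + t * ζ j i) * a i q := by
      intro q
      simp only [ha', ha0, ho]
      rw [← hζ j q, Finset.mul_sum, Finset.mul_sum, add_assoc, ← Finset.sum_add_distrib]
      congr 1
      exact Finset.sum_congr rfl fun i _ => by ring
    simp only [dotProduct, Finset.mul_sum]
    rw [Finset.sum_comm, ← Finset.sum_add_distrib]
    refine Finset.sum_congr rfl fun q _ => ?_
    rw [h1, add_mul, Finset.sum_mul]
    congr 1
    · ring
    · exact Finset.sum_congr rfl fun i _ => by ring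
  refine ⟨a', hGP, Set.pi univ fun j => Ioo (c j - 4 * ε * K) (c j - 2 * ε * K),
    isOpen_set_pi finite_univ fun _ _ => isOpen_Ioo,
    ⟨fun j => c j - 3 * ε * K, fun j _ => ⟨by nlinarith [mul_pos hε hKpos], by nlinarith [mul_pos hε hKpos]⟩⟩, ?_, ?_⟩
  · intro c' hc' j
    obtain ⟨h1, h2⟩ := hc' j trivial
    have h3 := hεc j
    have h4 := mul_pos hε hKpos
    rcases lt_or_gt_of_ne (hc j) with h | h
    · rw [abs_of_neg h] at h3
      have h5 : c' j < 0 := by linarith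
      exact ⟨h5.ne, ⟨fun h' => absurd h' (not_lt.2 h5.le), fun h' => absurd h' (not_lt.2 h.le)⟩,
        ⟨fun _ => h, fun _ => h5⟩⟩
    · rw [abs_of_pos h] at h3
      have h5 : 0 < c' j := by linarith
      exact ⟨h5.ne', ⟨fun _ => h, fun _ => h5⟩,
        ⟨fun h' => absurd h' (not_lt.2 h5.le), fun h' => absurd h' (not_lt.2 h.le)⟩⟩
  · intro c' hc'
    have h4 := mul_pos hε hKpos
    have hdiff : ∀ j, |c' j - c j| ≤ 4 * ε * K := fun j => by
      obtain ⟨h1, h2⟩ := hc' j trivial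
      rw [abs_le]; constructor <;> linarith
    refine ⟨fun y => ?_, ?_⟩
    · set S := ∑ i, Real.exp (a i ⬝ᵥ y) with hS
      have hSpos : 0 ≤ S := Finset.sum_nonneg fun i _ => (Real.exp_pos _).le
      have hterm : ∀ j, c' j * Real.exp (a' j ⬝ᵥ y) ≤ c' j * Real.exp (a j ⬝ᵥ y) + |c' j| * (2 * ε * S) := by
        intro j
        obtain ⟨h1, h2⟩ := hc' j trivial
        have h3 := hεc j
        rw [hdot j y]
        by_cases hj : 0 < c j
        · have hσj : σ j = 1 := by simp [hσ, hj]
          rw [abs_of_pos hj] at h3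
          have h5 : 0 < c' j := by linarith
          have h6 := shift_pos (fun i => a i ⬝ᵥ y) (ζ j) hN ε t hε hε1.le (hζ0 j) (hζs j) j
          rw [hσj, mul_one, abs_of_pos h5]
          have := mul_le_mul_of_nonneg_left h6 h5.le
          linarith
        · have hσj : σ j = -1 := by simp [hσ, hj]
          rw [abs_of_nonpos (not_lt.1 hj)] at h3
          have h5 : c' j < 0 := by linarith
          have h6 := shift_neg (fun i => a i ⬝ᵥ y) (ζ j) hN ε t hε (hζ0 j) (hζs j) j
          rw [hσj, abs_of_neg h5]
          have h7 : (1 - ε * -1) * (a j ⬝ᵥ y) + ∑ i, (ε * -1 / N + t * ζ j i) * (a i ⬝ᵥ y) =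
              (1 + ε) * (a j ⬝ᵥ y) + ∑ i, (-(ε / N) + t * ζ j i) * (a i ⬝ᵥ y) := by
            congr 1
            · ring
            · exact Finset.sum_congr rfl fun i _ => by ring
          rw [h7]
          have := mul_le_mul_of_nonneg_left h6 (neg_pos.2 h5).le
          linarith
      have hsumc : ∑ j, |c' j| ≤ K := by
        refine Finset.sum_le_sum fun j _ => ?_
        have := abs_sub_abs_le_abs_sub (c' j) (c j)
        have := hdiff j
        linarith
      calc expSum a' c' y = ∑ j, c' j * Real.exp (a' j ⬝ᵥ y) := rfl
        _ ≤ ∑ j, (c' j * Real.exp (a j ⬝ᵥ y) + |c' j| * (2 * ε * S)) := Finset.sum_le_sum fun j _ => hterm j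
        _ = ∑ j, c' j * Real.exp (a j ⬝ᵥ y) + (∑ j, |c' j|) * (2 * ε * S) := by
          rw [Finset.sum_add_distrib, Finset.sum_mul]
        _ ≤ ∑ j, c' j * Real.exp (a j ⬝ᵥ y) + K * (2 * ε * S) := by
          have : 0 ≤ 2 * ε * S := by positivity
          have := mul_le_mul_of_nonneg_right hsumc this
          linarith
        _ = ∑ j, (c' j + 2 * ε * K) * Real.exp (a j ⬝ᵥ y) := by
          rw [hS, Finset.mul_sum, Finset.mul_sum, ← Finset.sum_add_distrib]
          exact Finset.sum_congr rfl fun j _ => by ring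
        _ ≤ ∑ j, c j * Real.exp (a j ⬝ᵥ y) := by
          refine Finset.sum_le_sum fun j _ => mul_le_mul_of_nonneg_right ?_ (Real.exp_pos _).le
          obtain ⟨h1, h2⟩ := hc' j trivial
          linarith
        _ = expSum a c y := rfl
    · refine hηW a' c' (fun j q => ?_) fun j => (hdiff j).trans_lt hεKη
      have h1 : a' j q - a j q = ε * σ j * (o q - a j q) + t * mom n N j q := by
        simp only [ha', ha0]; ring
      rw [h1]
      refine lt_of_le_of_lt (abs_add_le _ _) (lt_of_le_of_lt ?_ hεB)
      rw [abs_mul, abs_mul, abs_mul, hσabs, abs_of_pos hε, abs_of_pos ht0, mul_one]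
      have h2 := hBle j q
      have h3 : t * |mom n N j q| ≤ ε * |mom n N j q| := mul_le_mul_of_nonneg_right htε.le (abs_nonneg _)
      nlinarith

/-- the bound for an arbitrary spanning configuration -/
theorem pos_bound (k : ℕ) (hn1 : 1 ≤ n) (hk : 1 ≤ k) (hN : N = n + k) (a : Fin N → Fin n → ℝ)
    (ha : NotAllInAffineHyperplane a) (c : Fin N → ℝ) (hc : ∀ j, c j ≠ 0)
    (W : Finset (Fin n → ℝ)) (hW : ∀ w ∈ W, 0 < expSum a c w)
    (hinj : Set.InjOn (fun w => connectedComponentIn {y | 0 < expSum a c y} w) (W : Set (Fin n → ℝ))) :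
    (W.card : ℝ) ≤ posB n k (Finset.univ.filter fun j => 0 < c j).card
        (Finset.univ.filter fun j => c j < 0).card := by
  obtain ⟨a', hGP, O, hO, hOn, hsign, hOc⟩ := perturb a (by omega) ha c hc W hW
  obtain ⟨c', hc'O, hb⟩ := gp_bound k hn1 hk hN a' hGP c O hO hOn hsign
  obtain ⟨hle, hpos⟩ := hOc c' hc'O
  refine hb W hpos ?_
  intro w hw w' hw' h
  apply hinj hw hw'
  have h' : connectedComponentIn {y | 0 < expSum a' c' y} w = connectedComponentIn {y | 0 < expSum a' c' y} w' := h
  have h1 : w' ∈ connectedComponentIn {y | 0 < expSum a' c' y} w := by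
    rw [h']; exact mem_connectedComponentIn (hpos w' hw')
  have h2 := connectedComponentIn_mono w (F := {y | 0 < expSum a' c' y}) (G := {y | 0 < expSum a c y})
    (fun y hy => lt_of_lt_of_le hy (hle y)) h1
  exact connectedComponentIn_eq h2

end Perturb


/-! ## Final assembly -/
section Final
open Set Filter Topology Matrix

lemma sign_change {n N : ℕ} (a : Fin N → Fin n → ℝ) (c : Fin N → ℝ) (z : Fin n → ℝ)
    (hz : expSum a c z = 0) (i' : Fin n) (hi : ∑ j, c j * Real.exp (∑ i, a j i * z i) * a j i' ≠ 0)
    (U : Set (Fin n → ℝ)) (hU : U ∈ 𝓝 z) : (∃ u ∈ U, expSum a c u < 0) ∧ ∃ v ∈ U, 0 < expSum a c v := by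
  set f : ℝ → ℝ := fun t => expSum a c (z + t • Pi.single i' 1) with hf
  have hfe : f = fun t => ∑ j, (c j * Real.exp (∑ i, a j i * z i)) * Real.exp (t * a j i') := by
    ext t
    simp only [hf, expSum]
    refine Finset.sum_congr rfl fun j _ => ?_
    rw [mul_assoc, ← Real.exp_add]
    congr 2
    show a j ⬝ᵥ (z + t • Pi.single i' 1) = _
    rw [dotProduct_add, dotProduct_smul, dotProduct_single_one]
    rfl
  have hd : HasDerivAt f (∑ j, c j * Real.exp (∑ i, a j i * z i) * a j i') 0 := by
    rw [hfe]
    simpa using hasDerivAt_expLine (T := Fin N) (fun j => c j * Real.exp (∑ i, a j i * z i)) (fun j => a j i') 0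
  have hf0 : f 0 = 0 := by simp [hf, hz]
  have hcont : ContinuousAt (fun t : ℝ => z + t • (Pi.single i' 1 : Fin n → ℝ)) 0 := by fun_prop
  have hU' : ∀ᶠ t : ℝ in 𝓝 0, z + t • (Pi.single i' 1 : Fin n → ℝ) ∈ U :=
    hcont.eventually (by simpa using hU)
  have hpos : ∃ᶠ t in 𝓝 (0 : ℝ), 0 < f t := by
    intro hcon
    have hmax : IsLocalMax f 0 := hcon.mono fun t ht => by rw [hf0]; exact not_lt.1 ht
    exact hi (hmax.hasDerivAt_eq_zero hd)
  have hneg : ∃ᶠ t in 𝓝 (0 : ℝ), f t < 0 := by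
    intro hcon
    have hmin : IsLocalMin f 0 := hcon.mono fun t ht => by rw [hf0]; exact not_lt.1 ht
    exact hi (hmin.hasDerivAt_eq_zero hd)
  obtain ⟨t, ht1, ht2⟩ := (hpos.and_eventually hU').exists
  obtain ⟨s, hs1, hs2⟩ := (hneg.and_eventually hU').exists
  exact ⟨⟨_, hs2, hs1⟩, ⟨_, ht2, ht1⟩⟩

lemma expSum_neg {n N : ℕ} (a : Fin N → Fin n → ℝ) (c : Fin N → ℝ) (y : Fin n → ℝ) :
    expSum a (fun j => -c j) y = -expSum a c y := by
  unfold expSum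
  rw [← Finset.sum_neg_distrib]
  exact Finset.sum_congr rfl fun j _ => by ring

lemma TT_nonneg (n l : ℕ) : 0 ≤ TT n l := by unfold TT; positivity

lemma posB_sum (n l p q : ℕ) (h1 : 1 ≤ n) (hpq : p + q = n + l + 2) :
    posB n (l + 2) p q + posB n (l + 2) q p ≤ (n + l + 2 : ℕ) + TT n l := by
  unfold posB
  have hT := TT_nonneg n l
  have hs : (p : ℝ) + q = (n + l + 2 : ℕ) := by exact_mod_cast hpq
  simp only [Nat.add_sub_cancel]
  have hhalf : Mb n l / 2 ≤ TT n l := by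
    rcases Nat.lt_or_ge l n with h | h
    · exact num_large n l h
    · have := num_small n l h1 h; linarith
  split_ifs with hA hB hB
  · have := num_small n l h1 (by omega); linarith
  · linarith
  · linarith
  · linarith

lemma count_int (P Q K : ℕ) (x y : ℝ) (hP : (P : ℝ) ≤ x) (hQ : (Q : ℝ) ≤ y) (h : x + y ≤ (K : ℝ) + 1) :
    P + Q ≤ K + 1 := by
  have : (P : ℝ) + Q ≤ (K : ℝ) + 1 := by linarith
  exact_mod_cast this

lemma compLe_of_bound {n : ℕ} (Ω : Set (Fin n → ℝ)) (x : ℝ)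
    (h : ∀ W : Finset (Fin n → ℝ), (∀ w ∈ W, w ∈ Ω) →
      Set.InjOn (fun w => connectedComponentIn Ω w) (W : Set (Fin n → ℝ)) → (W.card : ℝ) ≤ x) :
    0 ≤ x ∧ CompLe Ω ⌊x⌋₊ := by
  refine ⟨?_, fun W hW hinj => Nat.le_floor (h W hW hinj)⟩
  simpa using h ∅ (by simp) (by simp)

theorem stmt0_aux (n k : ℕ) (hn : 1 ≤ n) (hk : 1 ≤ k)
    (a : Fin (n + k) → Fin n → ℝ) (ha : NotAllInAffineHyperplane a) :
    ∃ U : Set (Fin (n + k) → ℝ), IsOpen U ∧ Dense U ∧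
      ∀ c ∈ U,
        Finite (ConnectedComponents {y : Fin n → ℝ // expSum a c y = 0}) ∧
        (Nat.card (ConnectedComponents {y : Fin n → ℝ // expSum a c y = 0}) : ℤ)
          ≤ ((n + k) * (n + k - 1) / 2 : ℕ)
            + ⌊(2 : ℝ) ^ ((((k : ℝ) - 2) * ((k : ℝ) - 3)) / 2)
                * ((n : ℝ) + 2) ^ ((k : ℝ) - 2)⌋ := by
  obtain ⟨U, hUo, hUd, hU⟩ := exists_generic a (by omega)
  refine ⟨U, hUo, hUd, fun c hc => ?_⟩
  obtain ⟨hc0, hgrad⟩ := hU c hc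
  set p := (Finset.univ.filter fun j => 0 < c j).card with hp
  set q := (Finset.univ.filter fun j => c j < 0).card with hq
  have hpq : p + q = n + k := by
    have h1 : (Finset.univ.filter fun j => c j < 0) = Finset.univ.filter fun j => ¬ 0 < c j := by
      refine Finset.filter_congr fun j _ => ?_
      rw [not_lt]; exact ⟨fun h => h.le, fun h => lt_of_le_of_ne h (hc0 j)⟩
    rw [hp, hq, h1, Finset.card_filter_add_card_filter_not]
    simp
  have hP := compLe_of_bound {y | 0 < expSum a c y} (posB n k p q) fun W hW hinj =>
    pos_bound k hn hk rfl a ha c hc0 W hW hinj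
  have hQ := compLe_of_bound {y | expSum a c y < 0} (posB n k q p) fun W hW hinj => by
    have hset : {y | expSum a c y < 0} = {y | 0 < expSum a (fun j => -c j) y} := by
      ext y
      show expSum a c y < 0 ↔ 0 < expSum a (fun j => -c j) y
      rw [expSum_neg, neg_pos]
    rw [hset] at hinj
    have := pos_bound k hn hk rfl a ha (fun j => -c j) (fun j => neg_ne_zero.2 (hc0 j)) W
      (fun w hw => by
        have := hW w hw
        rw [hset] at this
        exact this) hinj
    simpa [hp, hq] using this
  have hsc : ∀ z, expSum a c z = 0 → ∀ V ∈ 𝓝 z, (∃ u ∈ V, expSum a c u < 0) ∧ ∃ v ∈ V, 0 < expSum a c v := by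
    intro z hz V hV
    obtain ⟨i', hi'⟩ := hgrad z hz
    exact sign_change a c z hz i' hi' V hV
  have main : ∀ K : ℕ, posB n k p q + posB n k q p ≤ (K : ℝ) + 1 →
      Finite (ConnectedComponents {y : Fin n → ℝ // expSum a c y = 0}) ∧
      Nat.card (ConnectedComponents {y : Fin n → ℝ // expSum a c y = 0}) ≤ K := by
    intro K hK
    exact comps_bound (expSum_cont a c) hsc _ _ K hP.2 hQ.2
      (count_int _ _ K _ _ (Nat.floor_le hP.1) (Nat.floor_le hQ.1) hK)
  rcases Nat.lt_or_ge k 2 with hk2 | hk2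
  · have hk1 : k = 1 := by omega
    have h1 : posB n k p q + posB n k q p ≤ ((n : ℕ) : ℝ) + 1 := by
      unfold posB
      rw [if_neg (by omega), if_neg (by omega)]
      have : (p : ℝ) + q = (n + k : ℕ) := by exact_mod_cast hpq
      rw [hk1] at this; push_cast at this; linarith
    obtain ⟨hfin, hcard⟩ := main n h1
    refine ⟨hfin, ?_⟩
    have h2 : 0 ≤ ⌊(2 : ℝ) ^ ((((k : ℝ) - 2) * ((k : ℝ) - 3)) / 2) * ((n : ℝ) + 2) ^ ((k : ℝ) - 2)⌋ :=
      Int.floor_nonneg.2 (by positivity)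
    have h3 : n ≤ (n + k) * (n + k - 1) / 2 := by
      rw [hk1, Nat.add_sub_cancel, Nat.le_div_iff_mul_le (by norm_num)]
      nlinarith
    have h4 : (Nat.card (ConnectedComponents {y : Fin n → ℝ // expSum a c y = 0}) : ℤ) ≤
        ((n + k) * (n + k - 1) / 2 : ℕ) := by exact_mod_cast hcard.trans h3
    linarith
  · obtain ⟨l, rfl⟩ := Nat.exists_eq_add_of_le' hk2
    have hfl : (2 : ℝ) ^ (((((l + 2 : ℕ) : ℝ) - 2) * (((l + 2 : ℕ) : ℝ) - 3)) / 2) *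
        ((n : ℝ) + 2) ^ (((l + 2 : ℕ) : ℝ) - 2) = ((2 ^ (l * (l - 1) / 2) * (n + 2) ^ l : ℕ) : ℝ) := by
      have e1 : ((l + 2 : ℕ) : ℝ) - 2 = (l : ℝ) := by push_cast; ring
      have e2 : (l : ℝ) * (((l + 2 : ℕ) : ℝ) - 3) / 2 = ((l * (l - 1) / 2 : ℕ) : ℝ) := by
        rw [Nat.cast_div (Nat.even_mul_pred_self l).two_dvd (by norm_num)]
        rcases l with _ | l
        · simp
        · push_cast [Nat.add_sub_cancel]; ring
      rw [e1, e2, Real.rpow_natCast, Real.rpow_natCast]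
      push_cast; rfl
    rw [hfl, Int.floor_natCast]
    have hmain := main ((n + (l + 2)) * (n + (l + 2) - 1) / 2 + 2 ^ (l * (l - 1) / 2) * (n + 2) ^ l) (by
      refine (posB_sum n l p q hn (by omega)).trans (le_of_eq ?_)
      have e3 : (((n + (l + 2)) * (n + (l + 2) - 1) / 2 : ℕ) : ℝ) = ((n : ℝ) + l + 2) * (n + l + 1) / 2 := by
        rw [Nat.cast_div (Nat.even_mul_pred_self _).two_dvd (by norm_num)]
        have : n + (l + 2) - 1 = n + l + 1 := by omega
        rw [this]; push_cast; ring
      rw [Nat.cast_add ((n + (l + 2)) * (n + (l + 2) - 1) / 2) _, e3]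
      unfold TT
      push_cast
      ring)
    refine ⟨hmain.1, ?_⟩
    exact_mod_cast hmain.2

end Final

theorem stmt0 (n k : ℕ) (hn : 1 ≤ n) (hk : 1 ≤ k)
    (a : Fin (n + k) → Fin n → ℝ)
    (ha : NotAllInAffineHyperplane a) :
    ∃ U : Set (Fin (n + k) → ℝ), IsOpen U ∧ Dense U ∧
      ∀ c ∈ U,
        Finite (ConnectedComponents {y : Fin n → ℝ // expSum a c y = 0}) ∧
        (Nat.card (ConnectedComponents {y : Fin n → ℝ // expSum a c y = 0}) : ℤ)
          ≤ ((n + k) * (n + k - 1) / 2 : ℕ) +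
            ⌊(2 : ℝ) ^ ((((k : ℝ) - 2) * ((k : ℝ) - 3)) / 2) *
              ((n : ℝ) + 2) ^ ((k : ℝ) - 2)⌋ :=
  stmt0_aux n k hn hk a ha
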